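/- There exists a universal constant c > 0 such that for every dimension n ≥ 1 and every random vector X in ℝⁿ with log-concave density f having finite second moments, the relative entropy from Gaussianity satisfies D(f) ≤ (1/4) n log n + c n. Here D(f) = h(g) − h(f), where g is the density of the Gaussian with the same mean and the same covariance matrix as X. -/

import Mathlib

open MeasureTheory Real Pointwise

/-- A nonnegative function on ℝⁿ is log-concave if
`f(tx + (1-t)y) ≥ f(x)^t f(y)^(1-t)` for all `x, y` and `t ∈ [0,1]`. -/
def IsLogConcave {n : ℕ} (f : EuclideanSpace ℝ (Fin n) → ℝ) : Prop :=
  (∀ x, 0 ≤ f x) ∧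
  ∀ x y : EuclideanSpace ℝ (Fin n), ∀ t : ℝ, 0 ≤ t → t ≤ 1 →
    f x ^ t * f y ^ (1 - t) ≤ f (t • x + (1 - t) • y)

/-- The Shannon differential entropy `h(f) = -∫ f log f` of a density `f` on ℝⁿ. -/
noncomputable def hEnt {n : ℕ} (f : EuclideanSpace ℝ (Fin n) → ℝ) : ℝ :=
  -∫ x, f x * Real.log (f x)

lemma bm_one {A B C : Set ℝ} (hA : MeasurableSet A) (hB : MeasurableSet B)
    (hAn : A.Nonempty) (hBn : B.Nonempty)
    (hC : ∀ a ∈ A, ∀ b ∈ B, (a + b) / 2 ∈ C) :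
    volume A + volume B ≤ 2 * volume C := by
  rw [hA.measure_eq_iSup_isCompact, hB.measure_eq_iSup_isCompact]
  obtain ⟨a0, ha0⟩ := hAn
  obtain ⟨b0, hb0⟩ := hBn
  have key : ∀ K1 : Set ℝ, K1 ⊆ A → IsCompact K1 → K1.Nonempty →
      ∀ K2 : Set ℝ, K2 ⊆ B → IsCompact K2 → K2.Nonempty →
      volume K1 + volume K2 ≤ 2 * volume C := by
    intro K1 h1 c1 n1 K2 h2 c2 n2
    obtain ⟨α, hα, hα'⟩ := c1.exists_isGreatest n1
    obtain ⟨β, hβ, hβ'⟩ := c2.exists_isLeast n2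
    have e1 : volume ((fun x => x + β) '' K1) = volume K1 := by
      simp
    have e2 : volume ((fun x => α + x) '' K2) = volume K2 := by
      simp
    have hsub : (fun x => x + β) '' K1 ∪ (fun x => α + x) '' K2 ⊆ (2 : ℝ) • C := by
      rintro _ (⟨x, hx, rfl⟩ | ⟨x, hx, rfl⟩)
      · refine ⟨(x + β) / 2, hC _ (h1 hx) _ (h2 hβ), ?_⟩
        simp only [smul_eq_mul]; ring
      · refine ⟨(α + x) / 2, hC _ (h1 hα) _ (h2 hx), ?_⟩
        simp only [smul_eq_mul]; ring
    have hd : AEDisjoint volume ((fun x => x + β) '' K1) ((fun x => α + x) '' K2) := by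
      have : (fun x => x + β) '' K1 ∩ (fun x => α + x) '' K2 ⊆ {α + β} := by
        rintro z ⟨⟨x, hx, rfl⟩, ⟨y, hy, hxy⟩⟩
        have := hα' hx
        have := hβ' hy
        simp only [Set.mem_singleton_iff] at *
        linarith
      exact measure_mono_null this (by simp)
    have m2 : NullMeasurableSet ((fun x => α + x) '' K2) volume :=
      (c2.image (by fun_prop)).measurableSet.nullMeasurableSet
    calc volume K1 + volume K2
        = volume ((fun x => x + β) '' K1 ∪ (fun x => α + x) '' K2) := by
          rw [measure_union₀ m2 hd, e1, e2]
      _ ≤ volume ((2 : ℝ) • C) := measure_mono hsub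
      _ = 2 * volume C := by
          rw [Measure.addHaar_smul]; simp
  have red : ∀ K1 : Set ℝ, K1 ⊆ A ∧ IsCompact K1 → ∀ K2 : Set ℝ, K2 ⊆ B ∧ IsCompact K2 →
      volume K1 + volume K2 ≤ 2 * volume C := by
    intro K1 h1 K2 h2
    calc volume K1 + volume K2 ≤ volume (insert a0 K1) + volume (insert b0 K2) := by
          gcongr <;> exact Set.subset_insert _ _
      _ ≤ _ := key _ (Set.insert_subset ha0 h1.1) (h1.2.insert a0) (Set.insert_nonempty _ _)
          _ (Set.insert_subset hb0 h2.1) (h2.2.insert b0) (Set.insert_nonempty _ _)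
  simp only [iSup_and']
  exact ENNReal.biSup_add_biSup_le' ⟨∅, by simp⟩ ⟨∅, by simp⟩ red

lemma pl_one_norm {f g h : ℝ → ℝ} (hf : Measurable f) (hg : Measurable g) (hh : Measurable h)
    (f0 : ∀ x, 0 ≤ f x) (g0 : ∀ x, 0 ≤ g x) (h0 : ∀ x, 0 ≤ h x)
    (f1 : ∀ x, f x ≤ 1) (g1 : ∀ x, g x ≤ 1)
    (fs : ∀ s < 1, ∃ x, s < f x) (gs : ∀ s < 1, ∃ x, s < g x)
    (H : ∀ x y, f x * g y ≤ h ((x + y) / 2) ^ 2) :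
    (∫⁻ x, ENNReal.ofReal (f x)) + ∫⁻ x, ENNReal.ofReal (g x)
      ≤ 2 * ∫⁻ x, ENNReal.ofReal (h x) := by
  have lc : ∀ u : ℝ → ℝ, Measurable u → (∀ x, 0 ≤ u x) →
      ∫⁻ x, ENNReal.ofReal (u x) = ∫⁻ s in Set.Ioi 0, volume {x | s < u x} := fun u hu u0 =>
    lintegral_eq_lintegral_meas_lt volume (Filter.Eventually.of_forall u0) hu.aemeasurable
  have lc1 : ∀ u : ℝ → ℝ, Measurable u → (∀ x, 0 ≤ u x) → (∀ x, u x ≤ 1) →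
      ∫⁻ x, ENNReal.ofReal (u x) = ∫⁻ s in Set.Ioo 0 1, volume {x | s < u x} := by
    intro u hu u0 u1
    rw [lc u hu u0]
    rw [← Set.Ioo_union_Ici_eq_Ioi (zero_lt_one (α := ℝ)),
      lintegral_union measurableSet_Ici (by
        rw [Set.disjoint_left]; intro x hx hx'; exact absurd hx.2 (not_lt.2 hx'))]
    have : ∫⁻ s in Set.Ici (1 : ℝ), volume {x | s < u x} = 0 := by
      rw [setLIntegral_congr_fun (g := fun _ => 0) measurableSet_Ici]
      · simp
      · intro s hs
        have : {x | s < u x} = ∅ := by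
          ext x; simp only [Set.mem_ofPred_eq, Set.mem_empty_iff_false, iff_false, not_lt]
          exact (u1 x).trans hs
        simp [this]
    rw [this, add_zero]
  rw [lc1 f hf f0 f1, lc1 g hg g0 g1, lc h hh h0]
  have mono : ∀ u : ℝ → ℝ, Measurable (fun s : ℝ => volume {x | s < u x}) := by
    intro u
    apply Antitone.measurable
    intro s t hst
    exact measure_mono fun x hx => lt_of_le_of_lt hst hx
  rw [← lintegral_add_left (mono f)]
  calc ∫⁻ s in Set.Ioo (0 : ℝ) 1, (volume {x | s < f x} + volume {x | s < g x})
      ≤ ∫⁻ s in Set.Ioo (0 : ℝ) 1, 2 * volume {x | s < h x} := by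
        apply setLIntegral_mono' measurableSet_Ioo
        intro s hs
        apply bm_one (measurableSet_lt measurable_const hf) (measurableSet_lt measurable_const hg)
          (fs s hs.2) (gs s hs.2)
        intro a ha b hb
        have : s * s < f a * g b := mul_lt_mul'' ha hb hs.1.le hs.1.le
        have h2 := this.trans_le (H a b)
        show s < _
        nlinarith [h0 ((a + b) / 2), hs.1]
    _ = 2 * ∫⁻ s in Set.Ioo (0 : ℝ) 1, volume {x | s < h x} := by
        rw [lintegral_const_mul _ (mono h)]
    _ ≤ _ := by
        gcongr
        exact Set.Ioo_subset_Ioi_self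

lemma pl_one_real {f g h : ℝ → ℝ} (hf : Measurable f) (hg : Measurable g) (hh : Measurable h)
    (f0 : ∀ x, 0 ≤ f x) (g0 : ∀ x, 0 ≤ g x) (h0 : ∀ x, 0 ≤ h x)
    {N : ℝ} (f1 : ∀ x, f x ≤ N) (g1 : ∀ x, g x ≤ N)
    (H : ∀ x y, f x * g y ≤ h ((x + y) / 2) ^ 2) :
    (∫⁻ x, ENNReal.ofReal (f x)) * ∫⁻ x, ENNReal.ofReal (g x)
      ≤ (∫⁻ x, ENNReal.ofReal (h x)) ^ 2 := by
  have bf : BddAbove (Set.range f) := ⟨N, by rintro _ ⟨x, rfl⟩; exact f1 x⟩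
  have bg : BddAbove (Set.range g) := ⟨N, by rintro _ ⟨x, rfl⟩; exact g1 x⟩
  set a := ⨆ x, f x with ha
  set b := ⨆ x, g x with hb
  have fa : ∀ x, f x ≤ a := fun x => le_ciSup bf x
  have gb : ∀ x, g x ≤ b := fun x => le_ciSup bg x
  have a0 : 0 ≤ a := (f0 0).trans (fa 0)
  have b0 : 0 ≤ b := (g0 0).trans (gb 0)
  rcases a0.eq_or_lt with h' | apos
  · have : ∀ x, f x = 0 := fun x => le_antisymm ((fa x).trans h'.symm.le) (f0 x)
    simp [this]
  rcases b0.eq_or_lt with h' | bpos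
  · have : ∀ x, g x = 0 := fun x => le_antisymm ((gb x).trans h'.symm.le) (g0 x)
    simp [this]
  set c := √(a * b) with hc
  have cpos : 0 < c := Real.sqrt_pos.2 (by positivity)
  have c2 : c ^ 2 = a * b := Real.sq_sqrt (by positivity)
  have key := pl_one_norm (f := fun x => f x / a) (g := fun x => g x / b) (h := fun x => h x / c)
    (by fun_prop) (by fun_prop) (by fun_prop) (fun x => by have := f0 x; positivity)
    (fun x => by have := g0 x; positivity) (fun x => by have := h0 x; positivity)
    (fun x => (div_le_one apos).2 (fa x)) (fun x => (div_le_one bpos).2 (gb x))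
    (fun s hs => by
      obtain ⟨x, hx⟩ := exists_lt_of_lt_ciSup (show s * a < ⨆ x, f x by rw [← ha]; nlinarith)
      exact ⟨x, by rwa [lt_div_iff₀ apos]⟩)
    (fun s hs => by
      obtain ⟨x, hx⟩ := exists_lt_of_lt_ciSup (show s * b < ⨆ x, g x by rw [← hb]; nlinarith)
      exact ⟨x, by rwa [lt_div_iff₀ bpos]⟩)
    (fun x y => by
      rw [div_pow, c2, div_mul_div_comm]
      gcongr
      exact H x y)
  have sc : ∀ (u : ℝ → ℝ) (r : ℝ), Measurable u → 0 < r → ∫⁻ x, ENNReal.ofReal (u x) =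
      ENNReal.ofReal r * ∫⁻ x, ENNReal.ofReal (u x / r) := by
    intro u r hu hr
    rw [← lintegral_const_mul _ (by fun_prop)]
    congr 1; ext x
    rw [← ENNReal.ofReal_mul hr.le]
    congr 1; field_simp
  rw [sc f a hf apos, sc g b hg bpos, sc h c hh cpos]
  generalize (∫⁻ x, ENNReal.ofReal (f x / a)) = F at *
  generalize (∫⁻ x, ENNReal.ofReal (g x / b)) = G at *
  generalize (∫⁻ x, ENNReal.ofReal (h x / c)) = K at *
  have FG : F * G ≤ K ^ 2 := by
    by_cases hK : K = ⊤
    · simp [hK]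
    have hF : F ≠ ⊤ := fun h => by
      rw [h, top_add, top_le_iff] at key
      exact ENNReal.mul_ne_top (by simp) hK key
    have hG : G ≠ ⊤ := fun h => by
      rw [h, add_top, top_le_iff] at key
      exact ENNReal.mul_ne_top (by simp) hK key
    lift F to NNReal using hF
    lift G to NNReal using hG
    lift K to NNReal using hK
    have k2 : (F : ℝ) + G ≤ 2 * K := by exact_mod_cast key
    have : (F : ℝ) * G ≤ K ^ 2 := by
      nlinarith [sq_nonneg ((F : ℝ) - G), F.2, G.2, K.2, F.coe_nonneg, G.coe_nonneg, K.coe_nonneg]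
    exact_mod_cast this
  calc ENNReal.ofReal a * F * (ENNReal.ofReal b * G)
      = ENNReal.ofReal (a * b) * (F * G) := by rw [ENNReal.ofReal_mul a0]; ring
    _ ≤ ENNReal.ofReal (a * b) * K ^ 2 := by gcongr
    _ = (ENNReal.ofReal c * K) ^ 2 := by rw [← c2, ENNReal.ofReal_pow cpos.le]; ring

lemma pl_one {f g h : ℝ → ENNReal} (hf : Measurable f) (hg : Measurable g) (hh : Measurable h)
    (H : ∀ x y, f x * g y ≤ h ((x + y) / 2) ^ 2) :
    (∫⁻ x, f x) * ∫⁻ x, g x ≤ (∫⁻ x, h x) ^ 2 := by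
  have lim : ∀ u : ℝ → ENNReal, Measurable u → ∫⁻ x, u x = ⨆ N : ℕ, ∫⁻ x, min (u x) N := by
    intro u hu
    rw [← lintegral_iSup (fun N => by fun_prop)]
    · congr 1; ext x
      rw [← inf_iSup_eq, ENNReal.iSup_natCast]; simp
    · intro a b hab x
      exact min_le_min le_rfl (by exact_mod_cast hab)
  have step : ∀ N : ℕ, (∫⁻ x, min (f x) N) * ∫⁻ x, min (g x) N ≤ (∫⁻ x, h x) ^ 2 := by
    intro N
    have fin : ∀ z : ENNReal, min z N ≠ ⊤ := fun z => (min_le_right _ _).trans_lt (by simp) |>.ne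
    have := pl_one_real (f := fun x => (min (f x) N).toReal) (g := fun x => (min (g x) N).toReal)
      (h := fun x => (min (h x) N).toReal) (by fun_prop) (by fun_prop) (by fun_prop)
      (by intro; positivity) (by intro; positivity) (by intro; positivity) (N := N)
      (fun x => by
        have := ENNReal.toReal_mono (by simp) (min_le_right (f x) (N : ENNReal)); simpa using this)
      (fun x => by
        have := ENNReal.toReal_mono (by simp) (min_le_right (g x) (N : ENNReal)); simpa using this)
      (fun x y => by
        rw [← ENNReal.toReal_mul, ← ENNReal.toReal_pow]
        apply ENNReal.toReal_mono (ENNReal.pow_ne_top (fin _))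
        rcases le_total (h ((x + y) / 2)) (N : ENNReal) with h' | h'
        · rw [min_eq_left h']
          refine le_trans ?_ (H x y)
          gcongr <;> exact min_le_left _ _
        · rw [min_eq_right h', sq]
          gcongr <;> exact min_le_right _ _)
    simp only [ENNReal.ofReal_toReal (fin _)] at this
    refine this.trans ?_
    gcongr
    exact min_le_left _ _
  rw [lim f hf, lim g hg]
  simp only [ENNReal.iSup_mul, ENNReal.mul_iSup]
  refine iSup_le fun i => iSup_le fun j => ?_
  refine le_trans ?_ (step (max i j))
  gcongr <;> simp

lemma pl_half : ∀ (n : ℕ) {f g h : (Fin n → ℝ) → ENNReal}, Measurable f → Measurable g →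
    Measurable h → (∀ x y, f x * g y ≤ h ((2⁻¹ : ℝ) • (x + y)) ^ 2) →
    (∫⁻ x, f x) * ∫⁻ x, g x ≤ (∫⁻ x, h x) ^ 2 := by
  intro n
  induction n with
  | zero =>
    intro f g h hf hg hh H
    simp only [lintegral_unique, volume_pi]
    have := H default default
    rw [Subsingleton.elim ((2⁻¹ : ℝ) • (default + default : Fin 0 → ℝ)) default] at this
    simp only [Measure.pi_univ, Finset.univ_eq_empty, Finset.prod_empty, mul_one]
    convert this using 3
  | succ n ih =>
    intro f g h hf hg hh H
    have e := volume_preserving_piFinSuccAbove (fun _ : Fin (n + 1) => ℝ) 0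
    have conv : ∀ u : (Fin (n + 1) → ℝ) → ENNReal, Measurable u →
        ∫⁻ x, u x = ∫⁻ a : ℝ, ∫⁻ z : Fin n → ℝ, u (Fin.cons a z) := by
      intro u hu
      rw [← e.symm.lintegral_comp hu]
      rw [Measure.volume_eq_prod, lintegral_prod _ (by
        exact (hu.comp (MeasurableEquiv.measurable _)).aemeasurable)]
      simp [MeasurableEquiv.piFinSuccAbove, Fin.insertNthEquiv]
    have mc : ∀ u : (Fin (n + 1) → ℝ) → ENNReal, Measurable u →
        Measurable (fun p : ℝ × (Fin n → ℝ) => u (Fin.cons p.1 p.2)) := by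
      intro u hu
      have h2 := hu.comp (MeasurableEquiv.piFinSuccAbove (fun _ : Fin (n + 1) => ℝ) 0).symm.measurable
      have : (fun p : ℝ × (Fin n → ℝ) => u (Fin.cons p.1 p.2)) =
        u ∘ (MeasurableEquiv.piFinSuccAbove (fun _ : Fin (n + 1) => ℝ) 0).symm := by
        ext p
        simp [MeasurableEquiv.piFinSuccAbove, Fin.insertNthEquiv]
      rw [this]; exact h2
    rw [conv f hf, conv g hg, conv h hh]
    apply pl_one (mc f hf).lintegral_prod_right' (mc g hg).lintegral_prod_right'
      (mc h hh).lintegral_prod_right'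
    intro a b
    apply ih ((mc f hf).comp (measurable_const.prodMk measurable_id))
      ((mc g hg).comp (measurable_const.prodMk measurable_id))
      ((mc h hh).comp (measurable_const.prodMk measurable_id))
    intro x y
    refine (H (Fin.cons a x) (Fin.cons b y)).trans_eq ?_
    simp only [Function.comp, id]
    congr 2
    ext i
    refine Fin.cases ?_ (fun j => ?_) i
    · simp; ring
    · simp [mul_add]

noncomputable def kurtC : ℝ := 16 + ∑' k : ℕ, 2 * (6 + 4 * (k : ℝ)) ^ 4 * (1 / 3) ^ k

lemma kurt_summable : Summable fun k : ℕ => 2 * (6 + 4 * (k : ℝ)) ^ 4 * (1 / 3 : ℝ) ^ k := by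
  have h := fun j => summable_pow_mul_geometric_of_norm_lt_one (R := ℝ) j (r := 1 / 3)
    (by norm_num)
  have := (((((h 4).mul_left 512).add ((h 3).mul_left 3072)).add ((h 2).mul_left 6912)).add
    ((h 1).mul_left 6912)).add ((h 0).mul_left 2592)
  refine this.congr fun k => ?_
  ring

lemma kurtC_ge : 16 ≤ kurtC := by
  unfold kurtC
  have : 0 ≤ ∑' k : ℕ, 2 * (6 + 4 * (k : ℝ)) ^ 4 * (1 / 3 : ℝ) ^ k :=
    tsum_nonneg fun k => by positivity
  linarith

lemma tail_decay {T : ℝ → ℝ} (T0 : ∀ s, 0 ≤ T s) (Tm : Antitone T)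
    (H : ∀ a b, T a * T b ≤ T ((a + b) / 2) ^ 2) {σ : ℝ} (hσ : 0 < σ)
    (h1 : 3 / 4 ≤ T (-2 * σ)) (h2 : T (2 * σ) ≤ 1 / 4) (k : ℕ) :
    T ((2 + 4 * (k : ℝ)) * σ) ≤ (1 / 3) ^ k := by
  have ratio : ∀ k : ℕ, T ((2 + 4 * (k : ℝ)) * σ) ≤ T ((2 + 4 * ((k : ℝ) - 1)) * σ) / 3 := by
    intro k
    induction k with
    | zero =>
      have e1 : (2 + 4 * (((0 : ℕ) : ℝ) - 1)) * σ = -2 * σ := by push_cast; ring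
      have e2 : (2 + 4 * ((0 : ℕ) : ℝ)) * σ = 2 * σ := by push_cast; ring
      rw [e1, e2]; linarith
    | succ k ih =>
      have e1 : (2 + 4 * (((k + 1 : ℕ) : ℝ) - 1)) * σ = (2 + 4 * (k : ℝ)) * σ := by
        push_cast; ring
      rw [e1]
      have hh := H ((2 + 4 * ((k : ℝ) - 1)) * σ) ((2 + 4 * ((k + 1 : ℕ) : ℝ)) * σ)
      have e2 : ((2 + 4 * ((k : ℝ) - 1)) * σ + (2 + 4 * ((k + 1 : ℕ) : ℝ)) * σ) / 2
        = (2 + 4 * (k : ℝ)) * σ := by push_cast; ring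
      rw [e2] at hh
      have mono : T ((2 + 4 * ((k + 1 : ℕ) : ℝ)) * σ) ≤ T ((2 + 4 * ((k : ℝ) - 1)) * σ) := by
        apply Tm; push_cast; nlinarith
      set x := T ((2 + 4 * ((k : ℝ) - 1)) * σ)
      set y := T ((2 + 4 * (k : ℝ)) * σ)
      set z := T ((2 + 4 * ((k + 1 : ℕ) : ℝ)) * σ)
      have y0 : 0 ≤ y := T0 _
      rcases (T0 ((2 + 4 * ((k : ℝ) - 1)) * σ)).eq_or_lt with h' | h'
      · change 0 = x at h'
        linarith
      · change 0 < x at h'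
        by_contra hc
        push Not at hc
        nlinarith
  induction k with
  | zero =>
    have e2 : (2 + 4 * ((0 : ℕ) : ℝ)) * σ = 2 * σ := by push_cast; ring
    rw [e2]; norm_num; linarith
  | succ k ih =>
    have := ratio (k + 1)
    have e1 : (2 + 4 * (((k + 1 : ℕ) : ℝ) - 1)) * σ = (2 + 4 * (k : ℝ)) * σ := by
        push_cast; ring
    rw [e1] at this
    rw [pow_succ]
    linarith

lemma kurtosis {Ω : Type*} [MeasurableSpace Ω] (P : Measure Ω) [IsProbabilityMeasure P]
    {Z : Ω → ℝ} (hZ : Measurable Z)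
    (H : ∀ a b, P {x | a ≤ Z x} * P {x | b ≤ Z x} ≤ P {x | (a + b) / 2 ≤ Z x} ^ 2)
    (H' : ∀ a b, P {x | a ≤ -Z x} * P {x | b ≤ -Z x} ≤ P {x | (a + b) / 2 ≤ -Z x} ^ 2) :
    ∫⁻ x, ENNReal.ofReal (Z x ^ 4) ∂P ≤
      ENNReal.ofReal kurtC * (∫⁻ x, ENNReal.ofReal (Z x ^ 2) ∂P) ^ 2 := by
  have kpos : 0 < kurtC := by linarith [kurtC_ge]
  set v := ∫⁻ x, ENNReal.ofReal (Z x ^ 2) ∂P with hv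
  by_cases hvt : v = ⊤
  · rw [hvt]
    simp [ENNReal.mul_top, kpos]
  by_cases hv0 : v = 0
  · rw [hv, lintegral_eq_zero_iff (by fun_prop)] at hv0
    have : ∫⁻ x, ENNReal.ofReal (Z x ^ 4) ∂P = 0 := by
      rw [lintegral_eq_zero_iff (by fun_prop)]
      filter_upwards [hv0] with x hx
      have hx1 : Z x ^ 2 ≤ 0 := by simpa [ENNReal.ofReal_eq_zero] using hx
      have : Z x = 0 := by nlinarith
      simp [this]
    rw [this]; exact zero_le
  set σ := √v.toReal with hσd
  have vpos : 0 < v.toReal := ENNReal.toReal_pos hv0 hvt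
  have hσ : 0 < σ := Real.sqrt_pos.2 vpos
  have σ2 : σ ^ 2 = v.toReal := Real.sq_sqrt vpos.le
  have hvσ : v = ENNReal.ofReal (σ ^ 2) := by rw [σ2, ENNReal.ofReal_toReal hvt]
  -- Chebyshev
  have cheb : P {x | 2 * σ ≤ |Z x|} ≤ ENNReal.ofReal (1 / 4) := by
    have h := mul_meas_ge_le_lintegral (μ := P) (f := fun x => ENNReal.ofReal (Z x ^ 2))
      (by fun_prop) (ENNReal.ofReal (4 * σ ^ 2))
    have hs : {x | 2 * σ ≤ |Z x|} ⊆ {x | ENNReal.ofReal (4 * σ ^ 2) ≤ ENNReal.ofReal (Z x ^ 2)} := by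
      intro x hx
      apply ENNReal.ofReal_le_ofReal
      have hx' : 2 * σ ≤ |Z x| := hx
      rw [← sq_abs (Z x)]
      nlinarith
    have h2 : ENNReal.ofReal (4 * σ ^ 2) * P {x | 2 * σ ≤ |Z x|} ≤
        ENNReal.ofReal (4 * σ ^ 2) * ENNReal.ofReal (1 / 4) := by
      refine le_trans (mul_le_mul_right (measure_mono hs) _) (h.trans ?_)
      rw [← hv, hvσ, ← ENNReal.ofReal_mul (by positivity)]
      apply ENNReal.ofReal_le_ofReal
      linarith
    rwa [ENNReal.mul_le_mul_iff_right (by simp; positivity) ENNReal.ofReal_ne_top] at h2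
  have one : ∀ W : Ω → ℝ, Measurable W → (∀ x, |W x| = |Z x|) →
      (∀ a b, P {x | a ≤ W x} * P {x | b ≤ W x} ≤ P {x | (a + b) / 2 ≤ W x} ^ 2) →
      ∀ k : ℕ, P {x | (2 + 4 * (k : ℝ)) * σ ≤ W x} ≤ ENNReal.ofReal ((1 / 3) ^ k) := by
    intro W hW hWZ HW k
    have := tail_decay (T := fun s => P.real {x | s ≤ W x}) (fun s => measureReal_nonneg)
      (fun s t hst => measureReal_mono (fun x hx => hst.trans hx))
      (fun a b => by
        have h := ENNReal.toReal_mono (by finiteness) (HW a b)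
        simpa [Measure.real, ENNReal.toReal_mul, ENNReal.toReal_pow] using h)
      hσ ?_ ?_ k
    · rw [← ENNReal.ofReal_toReal (measure_ne_top P {x | (2 + 4 * (k : ℝ)) * σ ≤ W x})]
      exact ENNReal.ofReal_le_ofReal this
    · have hc : P.real {x | -2 * σ ≤ W x}ᶜ ≤ 1 / 4 := by
        apply ENNReal.toReal_le_of_le_ofReal (by norm_num)
        refine le_trans (measure_mono ?_) cheb
        intro x hx
        have hx' : ¬ (-2 * σ ≤ W x) := hx
        show 2 * σ ≤ |Z x|
        rw [← hWZ]
        have := neg_abs_le (W x)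
        linarith
      rw [probReal_compl_eq_one_sub (measurableSet_le measurable_const hW)] at hc
      linarith
    · apply ENNReal.toReal_le_of_le_ofReal (by norm_num)
      refine le_trans (measure_mono ?_) cheb
      intro x hx
      show 2 * σ ≤ |Z x|
      rw [← hWZ]
      exact le_trans hx (le_abs_self _)
  have tails : ∀ k : ℕ, P {x | (2 + 4 * (k : ℝ)) * σ ≤ |Z x|} ≤ ENNReal.ofReal (2 * (1 / 3) ^ k) := by
    intro k
    have h1 := one Z hZ (fun _ => rfl) H k
    have h2 := one (fun x => -Z x) hZ.neg (fun _ => abs_neg _) H' k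
    calc P {x | (2 + 4 * (k : ℝ)) * σ ≤ |Z x|}
        ≤ P ({x | (2 + 4 * (k : ℝ)) * σ ≤ Z x} ∪ {x | (2 + 4 * (k : ℝ)) * σ ≤ -Z x}) := by
          apply measure_mono
          intro x hx
          have hx' : (2 + 4 * (k : ℝ)) * σ ≤ |Z x| := hx
          exact le_abs.1 hx'
      _ ≤ _ := measure_union_le _ _
      _ ≤ _ := add_le_add h1 h2
      _ = _ := by rw [← ENNReal.ofReal_add (by positivity) (by positivity)]; congr 1; ring
  have mS : ∀ k : ℕ, MeasurableSet {x | (2 + 4 * (k : ℝ)) * σ ≤ |Z x|} := fun k =>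
    measurableSet_le measurable_const (by fun_prop)
  have pw : ∀ x, ENNReal.ofReal (Z x ^ 4) ≤ ENNReal.ofReal (16 * σ ^ 4) +
      ∑' k : ℕ, Set.indicator {x | (2 + 4 * (k : ℝ)) * σ ≤ |Z x|}
        (fun _ => ENNReal.ofReal (((6 + 4 * (k : ℝ)) * σ) ^ 4)) x := by
    intro x
    have e4 : Z x ^ 4 = |Z x| ^ 4 := (Even.pow_abs (by decide) _).symm
    rw [e4]
    by_cases hx : |Z x| < 2 * σ
    · refine le_trans (ENNReal.ofReal_le_ofReal ?_) le_self_add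
      calc |Z x| ^ 4 ≤ (2 * σ) ^ 4 := by gcongr
        _ = _ := by ring
    · push Not at hx
      set k := ⌊(|Z x| / σ - 2) / 4⌋₊ with hk
      have hnn : 0 ≤ (|Z x| / σ - 2) / 4 := by
        have : 2 ≤ |Z x| / σ := by rwa [le_div_iff₀ hσ]
        linarith
      have l1 := Nat.floor_le hnn
      have l2 := Nat.lt_floor_add_one ((|Z x| / σ - 2) / 4)
      rw [← hk] at l1 l2
      have k1 : (2 + 4 * (k : ℝ)) * σ ≤ |Z x| := by
        rw [← le_div_iff₀ hσ]; linarith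
      have k2 : |Z x| ≤ (6 + 4 * (k : ℝ)) * σ := by
        rw [← div_le_iff₀ hσ]; linarith
      refine le_trans ?_ le_add_self
      refine le_trans ?_ (ENNReal.le_tsum k)
      rw [Set.indicator_of_mem (by exact k1)]
      apply ENNReal.ofReal_le_ofReal
      gcongr
  calc ∫⁻ x, ENNReal.ofReal (Z x ^ 4) ∂P
      ≤ ∫⁻ x, (ENNReal.ofReal (16 * σ ^ 4) +
      ∑' k : ℕ, Set.indicator {x | (2 + 4 * (k : ℝ)) * σ ≤ |Z x|}
        (fun _ => ENNReal.ofReal (((6 + 4 * (k : ℝ)) * σ) ^ 4)) x) ∂P := lintegral_mono pw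
    _ = ENNReal.ofReal (16 * σ ^ 4) + ∑' k : ℕ, ENNReal.ofReal (((6 + 4 * (k : ℝ)) * σ) ^ 4) *
          P {x | (2 + 4 * (k : ℝ)) * σ ≤ |Z x|} := by
        rw [lintegral_add_left measurable_const, lintegral_tsum]
        · simp only [lintegral_const, measure_univ, mul_one]
          congr 1
          congr 1; ext k
          rw [lintegral_indicator (mS k)]
          simp
        · intro k
          exact (measurable_const.indicator (mS k)).aemeasurable
    _ ≤ ENNReal.ofReal (16 * σ ^ 4) + ∑' k : ℕ, ENNReal.ofReal
          (σ ^ 4 * (2 * (6 + 4 * (k : ℝ)) ^ 4 * (1 / 3 : ℝ) ^ k)) := by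
        gcongr with k
        refine le_trans (mul_le_mul_right (tails k) _) ?_
        rw [← ENNReal.ofReal_mul (by positivity)]
        apply ENNReal.ofReal_le_ofReal
        apply le_of_eq; ring
    _ = ENNReal.ofReal kurtC * v ^ 2 := by
        rw [← ENNReal.ofReal_tsum_of_nonneg (fun k => by positivity)
          (kurt_summable.mul_left _), tsum_mul_left, ← ENNReal.ofReal_add (by positivity)
          (by have : 0 ≤ ∑' k : ℕ, 2 * (6 + 4 * (k : ℝ)) ^ 4 * (1 / 3 : ℝ) ^ k :=
                tsum_nonneg fun k => by positivity
              positivity), hvσ, ← ENNReal.ofReal_pow (by positivity),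
            ← ENNReal.ofReal_mul kpos.le]
        congr 1
        unfold kurtC
        ring

/-- Half-space tails are midpoint log-concave. -/
def TailLC {n : ℕ} (μ : Measure (Fin n → ℝ)) : Prop :=
  ∀ (θ : Fin n → ℝ) (a b : ℝ), μ {x | a ≤ θ ⬝ᵥ x} * μ {x | b ≤ θ ⬝ᵥ x} ≤
    μ {x | (a + b) / 2 ≤ θ ⬝ᵥ x} ^ 2

lemma measurable_dot {n : ℕ} (θ : Fin n → ℝ) : Measurable fun x : Fin n → ℝ => θ ⬝ᵥ x := by
  unfold dotProduct; fun_prop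

lemma tailLC_withDensity {n : ℕ} {p : (Fin n → ℝ) → ENNReal} (hp : Measurable p)
    (H : ∀ x y, p x * p y ≤ p ((2⁻¹ : ℝ) • (x + y)) ^ 2) : TailLC (volume.withDensity p) := by
  intro θ a b
  have ms : ∀ c : ℝ, MeasurableSet {x : Fin n → ℝ | c ≤ θ ⬝ᵥ x} := fun c =>
    measurableSet_le measurable_const (measurable_dot θ)
  simp only [withDensity_apply _ (ms _), ← lintegral_indicator (ms _)]
  apply pl_half n (hp.indicator (ms _)) (hp.indicator (ms _)) (hp.indicator (ms _))
  intro x y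
  by_cases hx : a ≤ θ ⬝ᵥ x
  · by_cases hy : b ≤ θ ⬝ᵥ y
    · have hz : (a + b) / 2 ≤ θ ⬝ᵥ ((2⁻¹ : ℝ) • (x + y)) := by
        rw [dotProduct_smul, dotProduct_add, smul_eq_mul]; linarith
      rw [Set.indicator_of_mem (by exact hx), Set.indicator_of_mem (by exact hy),
        Set.indicator_of_mem (by exact hz)]
      exact H x y
    · rw [Set.indicator_of_notMem (s := {x | b ≤ θ ⬝ᵥ x}) (by exact hy)]; simp
  · rw [Set.indicator_of_notMem (s := {x | a ≤ θ ⬝ᵥ x}) (by exact hx)]; simp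

lemma TailLC.kurt {n : ℕ} {μ : Measure (Fin n → ℝ)} [IsProbabilityMeasure μ] (h : TailLC μ)
    (θ : Fin n → ℝ) (c : ℝ) :
    ∫⁻ x, ENNReal.ofReal ((θ ⬝ᵥ x - c) ^ 4) ∂μ ≤
      ENNReal.ofReal kurtC * (∫⁻ x, ENNReal.ofReal ((θ ⬝ᵥ x - c) ^ 2) ∂μ) ^ 2 := by
  apply kurtosis μ ((measurable_dot θ).sub_const c)
  · intro a b
    have e : ∀ t : ℝ, {x : Fin n → ℝ | t ≤ θ ⬝ᵥ x - c} = {x | t + c ≤ θ ⬝ᵥ x} := fun t =>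
      Set.ext fun x => by
        show t ≤ θ ⬝ᵥ x - c ↔ t + c ≤ θ ⬝ᵥ x
        exact le_sub_iff_add_le
    have := h θ (a + c) (b + c)
    rw [e, e, e]
    rwa [show (a + b) / 2 + c = (a + c + (b + c)) / 2 by ring]
  · intro a b
    have e : ∀ t : ℝ, {x : Fin n → ℝ | t ≤ -(θ ⬝ᵥ x - c)} = {x | t - c ≤ (-θ) ⬝ᵥ x} := fun t =>
      Set.ext fun x => by
        show t ≤ -(θ ⬝ᵥ x - c) ↔ t - c ≤ (-θ) ⬝ᵥ x
        rw [neg_dotProduct]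
        constructor <;> intro h <;> linarith
    have := h (-θ) (a - c) (b - c)
    rw [e, e, e]
    rwa [show (a + b) / 2 - c = (a - c + (b - c)) / 2 by ring]

section Tilt
variable {n : ℕ}

/-- The tilting weight. -/
noncomputable def gw (s : ℝ) (g x : Fin n → ℝ) : ℝ :=
  Real.exp (s * (g ⬝ᵥ x) - s ^ 2 / 2 * (x ⬝ᵥ x))

/-- Standard Gaussian density. -/
noncomputable def gphi (g : Fin n → ℝ) : ℝ := (√(2 * π))⁻¹ ^ n * Real.exp (-(g ⬝ᵥ g) / 2)

lemma gw_pos (s : ℝ) (g x : Fin n → ℝ) : 0 < gw s g x := Real.exp_pos _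
lemma gphi_pos (g : Fin n → ℝ) : 0 < gphi g := by unfold gphi; positivity

lemma continuous_gw : Continuous fun p : ℝ × (Fin n → ℝ) × (Fin n → ℝ) => gw p.1 p.2.1 p.2.2 := by
  unfold gw dotProduct; fun_prop

lemma continuous_gphi : Continuous (gphi : (Fin n → ℝ) → ℝ) := by
  unfold gphi dotProduct; fun_prop

lemma dot_self_nonneg' (x : Fin n → ℝ) : 0 ≤ x ⬝ᵥ x :=
  Finset.sum_nonneg fun i _ => mul_self_nonneg _

lemma dot_le_sum {R : ℝ} (g x : Fin n → ℝ) (hx : ‖x‖ ≤ R) : |g ⬝ᵥ x| ≤ R * ∑ i, |g i| := by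
  unfold dotProduct
  rw [Finset.mul_sum]
  refine (Finset.abs_sum_le_sum_abs _ _).trans (Finset.sum_le_sum fun i _ => ?_)
  rw [abs_mul, mul_comm]
  gcongr
  exact (norm_le_pi_norm x i).trans hx

lemma gw_le {T R s : ℝ} (hs : |s| ≤ T) (g x : Fin n → ℝ) (hx : ‖x‖ ≤ R) :
    gw s g x ≤ Real.exp (T * R * ∑ i, |g i|) := by
  unfold gw
  apply Real.exp_le_exp.2
  have h1 := dot_le_sum g x hx
  have h2 := dot_self_nonneg' x
  have h3 : s * (g ⬝ᵥ x) ≤ T * (R * ∑ i, |g i|) := by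
    refine (le_abs_self _).trans ?_
    rw [abs_mul]
    exact mul_le_mul hs h1 (abs_nonneg _) ((abs_nonneg _).trans hs)
  have : 0 ≤ s ^ 2 / 2 * (x ⬝ᵥ x) := by positivity
  linarith

lemma gphi_eq_prod (g : Fin n → ℝ) : gphi g = ∏ i, ((√(2 * π))⁻¹ * Real.exp (-(1/2) * g i ^ 2)) := by
  unfold gphi dotProduct
  rw [Finset.prod_mul_distrib, ← Real.exp_sum]
  simp only [Finset.prod_const, Finset.card_univ, Fintype.card_fin]
  congr 2
  rw [← Finset.mul_sum]
  have : ∑ i, g i ^ 2 = ∑ i, g i * g i := Finset.sum_congr rfl fun i _ => by ring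
  rw [this]; ring

lemma integral_gphi : ∫ g : Fin n → ℝ, gphi g = 1 := by
  simp_rw [gphi_eq_prod]
  rw [integral_fintype_prod_volume_eq_pow (fun t : ℝ => (√(2 * π))⁻¹ * Real.exp (-(1/2) * t ^ 2)),
    integral_const_mul, integral_gaussian]
  have : √(π / (1 / 2)) = √(2 * π) := by congr 1; ring
  rw [this, inv_mul_cancel₀ (by positivity), one_pow]

lemma integrable_gphi_exp (c : ℝ) :
    Integrable fun g : Fin n → ℝ => gphi g * Real.exp (c * ∑ i, |g i|) := by
  have h : Integrable fun g : Fin n → ℝ => ∏ i, Real.exp (-(1/4) * g i ^ 2) :=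
    Integrable.fintype_prod (f := fun (_ : Fin n) (t : ℝ) => Real.exp (-(1/4) * t ^ 2))
      fun i => integrable_exp_neg_mul_sq (by norm_num)
  refine (h.const_mul ((√(2 * π))⁻¹ ^ n * Real.exp (n * c ^ 2))).mono' ?_ ?_
  · refine Continuous.aestronglyMeasurable ?_
    have := continuous_gphi (n := n)
    fun_prop
  · refine Filter.Eventually.of_forall fun g => ?_
    rw [Real.norm_of_nonneg (mul_nonneg (gphi_pos g).le (Real.exp_pos _).le)]
    unfold gphi
    rw [← Real.exp_sum, mul_assoc, mul_assoc, ← Real.exp_add, ← Real.exp_add]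
    refine mul_le_mul_of_nonneg_left (Real.exp_le_exp.2 ?_) (by positivity)
    have : ∀ i, -(g i * g i) / 2 + c * |g i| ≤ c ^ 2 + -(1/4) * g i ^ 2 := by
      intro i
      have := sq_abs (g i)
      nlinarith [sq_nonneg (|g i| / 2 - c)]
    have h2 := Finset.sum_le_sum fun i (_ : i ∈ Finset.univ) => this i
    simp only [Finset.sum_add_distrib, Finset.sum_const, Finset.card_univ, Fintype.card_fin,
      nsmul_eq_mul, ← Finset.mul_sum, ← Finset.sum_div, Finset.sum_neg_distrib] at h2
    unfold dotProduct
    simpa [← Finset.mul_sum] using h2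

variable {E : Type*} [NormedAddCommGroup E] [NormedSpace ℝ E] [CompleteSpace E]
variable {μ : Measure (Fin n → ℝ)} {R : ℝ}

lemma integrable_cont [IsFiniteMeasure μ] (hμ : ∀ᵐ x ∂μ, ‖x‖ ≤ R) {Ξ : (Fin n → ℝ) → E}
    (hΞ : Continuous Ξ) : Integrable Ξ μ := by
  obtain ⟨C, hC⟩ := (isCompact_closedBall (0 : Fin n → ℝ) R).exists_bound_of_continuousOn
    hΞ.continuousOn
  refine Integrable.of_bound hΞ.aestronglyMeasurable C ?_
  filter_upwards [hμ] with x hx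
  exact hC x (by simpa using hx)

/-- Tilted unnormalized integrals. -/
noncomputable def Jm (μ : Measure (Fin n → ℝ)) (Ξ : (Fin n → ℝ) → E) (s : ℝ) (g : Fin n → ℝ) : E :=
  ∫ x, gw s g x • Ξ x ∂μ

lemma Jm_integrable [IsFiniteMeasure μ] (hμ : ∀ᵐ x ∂μ, ‖x‖ ≤ R) {Ξ : (Fin n → ℝ) → E}
    (hΞ : Continuous Ξ) (s : ℝ) (g : Fin n → ℝ) : Integrable (fun x => gw s g x • Ξ x) μ := by
  apply integrable_cont hμ
  have := continuous_gw (n := n)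
  exact (this.comp (by fun_prop : Continuous fun x : Fin n → ℝ => (s, g, x))).smul hΞ

lemma Jm_hasDerivAt_s [IsFiniteMeasure μ] (hμ : ∀ᵐ x ∂μ, ‖x‖ ≤ R) {Ξ : (Fin n → ℝ) → E}
    (hΞ : Continuous Ξ) (s : ℝ) (g : Fin n → ℝ) :
    HasDerivAt (fun s => Jm μ Ξ s g) (Jm μ (fun x => (g ⬝ᵥ x - s * (x ⬝ᵥ x)) • Ξ x) s g) s := by
  have hcont : Continuous fun p : ℝ × (Fin n → ℝ) =>
      gw p.1 g p.2 • (g ⬝ᵥ p.2 - p.1 * (p.2 ⬝ᵥ p.2)) • Ξ p.2 := by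
    have := continuous_gw (n := n)
    have h1 : Continuous fun p : ℝ × (Fin n → ℝ) => gw p.1 g p.2 :=
      this.comp (by fun_prop : Continuous fun p : ℝ × (Fin n → ℝ) => (p.1, g, p.2))
    unfold dotProduct
    fun_prop
  obtain ⟨C, hC⟩ := ((isCompact_closedBall s 1).prod
    (isCompact_closedBall (0 : Fin n → ℝ) R)).exists_bound_of_continuousOn hcont.continuousOn
  refine (hasDerivAt_integral_of_dominated_loc_of_deriv_le (bound := fun _ => C)
    (F := fun s x => gw s g x • Ξ x)
    (F' := fun s x => gw s g x • (g ⬝ᵥ x - s * (x ⬝ᵥ x)) • Ξ x)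
    (Metric.closedBall_mem_nhds s one_pos) ?_ ?_ ?_ ?_ ?_ ?_).2
  · exact Filter.Eventually.of_forall fun s => (Jm_integrable hμ hΞ s g).aestronglyMeasurable
  · exact Jm_integrable hμ hΞ s g
  · exact (hcont.comp (by fun_prop : Continuous fun x => (s, x))).aestronglyMeasurable
  · filter_upwards [hμ] with x hx r hr
    exact hC (r, x) ⟨hr, by simpa using hx⟩
  · exact integrable_const _
  · refine Filter.Eventually.of_forall fun x r _ => ?_
    rw [smul_smul]
    refine HasDerivAt.smul_const ?_ _
    unfold gw
    have : HasDerivAt (fun r : ℝ => r * (g ⬝ᵥ x) - r ^ 2 / 2 * (x ⬝ᵥ x))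
        (g ⬝ᵥ x - r * (x ⬝ᵥ x)) r := by
      have h1 := (hasDerivAt_id r).mul_const (g ⬝ᵥ x)
      have h2 := (((hasDerivAt_id r).pow 2).div_const 2).mul_const (x ⬝ᵥ x)
      refine (h1.sub h2).congr_deriv ?_
      simp
    exact this.exp

/-- `v ↦ v ⬝ x` as a continuous linear map. -/
noncomputable def dotL (x : Fin n → ℝ) : (Fin n → ℝ) →L[ℝ] ℝ :=
  ∑ i, x i • ContinuousLinearMap.proj (R := ℝ) (φ := fun _ : Fin n => ℝ) i

lemma dotL_apply (x v : Fin n → ℝ) : dotL x v = v ⬝ᵥ x := by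
  simp [dotL, dotProduct, mul_comm]

lemma continuous_dotL : Continuous (dotL : (Fin n → ℝ) → _) := by
  unfold dotL; fun_prop

lemma Jm_hasFDerivAt [IsFiniteMeasure μ] (hμ : ∀ᵐ x ∂μ, ‖x‖ ≤ R) {Ξ : (Fin n → ℝ) → E}
    (hΞ : Continuous Ξ) (s : ℝ) (g : Fin n → ℝ) :
    ∃ D : (Fin n → ℝ) →L[ℝ] E, HasFDerivAt (fun g => Jm μ Ξ s g) D g ∧
      ∀ v, D v = s • Jm μ (fun x => (v ⬝ᵥ x) • Ξ x) s g := by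
  have hcont : Continuous fun p : (Fin n → ℝ) × (Fin n → ℝ) =>
      gw s p.1 p.2 • s • (dotL p.2).smulRight (Ξ p.2) := by
    have := continuous_gw (n := n)
    have h1 : Continuous fun p : (Fin n → ℝ) × (Fin n → ℝ) => gw s p.1 p.2 :=
      this.comp (by fun_prop : Continuous fun p : (Fin n → ℝ) × (Fin n → ℝ) => (s, p.1, p.2))
    have h2 := continuous_dotL (n := n)
    refine h1.smul (Continuous.const_smul ?_ s)
    exact ((ContinuousLinearMap.smulRightL ℝ (Fin n → ℝ) E).isBoundedBilinearMap.continuous).comp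
      (((h2.comp continuous_snd)).prodMk (hΞ.comp continuous_snd))
  obtain ⟨C, hC⟩ := ((isCompact_closedBall g 1).prod
    (isCompact_closedBall (0 : Fin n → ℝ) R)).exists_bound_of_continuousOn hcont.continuousOn
  have hint : Integrable (fun x => gw s g x • s • (dotL x).smulRight (Ξ x)) μ :=
    integrable_cont hμ (hcont.comp (by fun_prop : Continuous fun x => (g, x)))
  refine ⟨∫ x, gw s g x • s • (dotL x).smulRight (Ξ x) ∂μ, ?_, ?_⟩
  · refine (hasFDerivAt_integral_of_dominated_of_fderiv_le (bound := fun _ => C)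
      (F := fun g x => gw s g x • Ξ x)
      (F' := fun g x => gw s g x • s • (dotL x).smulRight (Ξ x))
      (Metric.closedBall_mem_nhds g one_pos) ?_ ?_ ?_ ?_ ?_ ?_)
    · exact Filter.Eventually.of_forall fun g => (Jm_integrable hμ hΞ s g).aestronglyMeasurable
    · exact Jm_integrable hμ hΞ s g
    · exact hint.aestronglyMeasurable
    · filter_upwards [hμ] with x hx r hr
      exact hC (r, x) ⟨hr, by simpa using hx⟩
    · exact integrable_const _
    · refine Filter.Eventually.of_forall fun x r _ => ?_
      have h0 : HasFDerivAt (fun r : Fin n → ℝ => s * (r ⬝ᵥ x) - s ^ 2 / 2 * (x ⬝ᵥ x))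
          (s • dotL x) r := by
        have h1 : HasFDerivAt (fun r : Fin n → ℝ => dotL x r) (dotL x) r := (dotL x).hasFDerivAt
        have h2 := (h1.const_mul s).sub_const (s ^ 2 / 2 * (x ⬝ᵥ x))
        simpa only [dotL_apply] using h2
      refine (h0.exp.smul_const (Ξ x)).congr_fderiv ?_
      ext v
      simp [gw, smul_smul]
  · intro v
    rw [ContinuousLinearMap.integral_apply hint]
    unfold Jm
    rw [← integral_smul]
    congr 1; ext x
    simp [dotL_apply, smul_smul]
    congr 1; ring

lemma Jm_continuous [IsFiniteMeasure μ] (hμ : ∀ᵐ x ∂μ, ‖x‖ ≤ R) {Ξ : (Fin n → ℝ) → E}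
    (hΞ : Continuous Ξ) (s : ℝ) : Continuous fun g => Jm μ Ξ s g :=
  continuous_iff_continuousAt.2 fun g => by
    obtain ⟨D, hD, -⟩ := Jm_hasFDerivAt hμ hΞ s g
    exact hD.continuousAt

lemma Jm_hasLineDerivAt [IsFiniteMeasure μ] (hμ : ∀ᵐ x ∂μ, ‖x‖ ≤ R) {Ξ : (Fin n → ℝ) → E}
    (hΞ : Continuous Ξ) (s : ℝ) (g : Fin n → ℝ) (v : Fin n → ℝ) :
    HasLineDerivAt ℝ (fun g => Jm μ Ξ s g) (s • Jm μ (fun x => (v ⬝ᵥ x) • Ξ x) s g) g v := by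
  obtain ⟨D, hD, h⟩ := Jm_hasFDerivAt hμ hΞ s g
  rw [← h]
  exact hD.hasLineDerivAt v

lemma Jm_norm_le [IsFiniteMeasure μ] (hμ : ∀ᵐ x ∂μ, ‖x‖ ≤ R) {Ξ : (Fin n → ℝ) → E}
    (hΞ : Continuous Ξ) : ∃ C, 0 ≤ C ∧ ∀ s g, ‖Jm μ Ξ s g‖ ≤ C * Jm μ (fun _ => (1:ℝ)) s g := by
  obtain ⟨C, hC⟩ := (isCompact_closedBall (0 : Fin n → ℝ) R).exists_bound_of_continuousOn
    hΞ.continuousOn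
  refine ⟨max C 0, le_max_right _ _, fun s g => ?_⟩
  unfold Jm
  rw [← integral_const_mul]
  refine norm_integral_le_of_norm_le ((Jm_integrable hμ continuous_const s g).const_mul _) ?_
  filter_upwards [hμ] with x hx
  rw [norm_smul, Real.norm_of_nonneg (gw_pos s g x).le, smul_eq_mul, mul_one, mul_comm]
  have := (hC x (by simpa using hx)).trans (le_max_left C 0)
  exact mul_le_mul_of_nonneg_right this (gw_pos s g x).le

lemma Jm_one_pos [IsProbabilityMeasure μ] (hμ : ∀ᵐ x ∂μ, ‖x‖ ≤ R) (s : ℝ) (g : Fin n → ℝ) :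
    0 < Jm μ (fun _ => (1:ℝ)) s g := by
  unfold Jm
  have hi := Jm_integrable hμ (continuous_const (y := (1:ℝ))) s g
  rw [integral_pos_iff_support_of_nonneg (fun x => by simpa using (gw_pos s g x).le) hi]
  have : (Function.support fun x => gw s g x • (1:ℝ)) = Set.univ := by
    ext x; simp [(gw_pos s g x).ne']
  rw [this]; simp

lemma Jm_one_le [IsProbabilityMeasure μ] (hμ : ∀ᵐ x ∂μ, ‖x‖ ≤ R) {T s : ℝ} (hs : |s| ≤ T)
    (g : Fin n → ℝ) :
    Jm μ (fun _ => (1:ℝ)) s g ≤ Real.exp (T * R * ∑ i, |g i|) := by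
  unfold Jm
  have : ∫ x, Real.exp (T * R * ∑ i, |g i|) ∂μ = Real.exp (T * R * ∑ i, |g i|) := by simp
  rw [← this]
  refine integral_mono_ae (Jm_integrable hμ continuous_const s g) (integrable_const _) ?_
  filter_upwards [hμ] with x hx
  simpa using gw_le hs g x hx

end Tilt

section Evo
variable {n : ℕ}

lemma integrable_gphi_mul {b : (Fin n → ℝ) → ℝ} (hb : Continuous b) {C c : ℝ}
    (h : ∀ g, |b g| ≤ C * Real.exp (c * ∑ i, |g i|)) : Integrable fun g => gphi g * b g := by
  refine ((integrable_gphi_exp (n := n) c).const_mul C).mono'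
    (continuous_gphi.mul hb).aestronglyMeasurable (Filter.Eventually.of_forall fun g => ?_)
  rw [norm_mul, Real.norm_of_nonneg (gphi_pos g).le]
  calc gphi g * ‖b g‖ ≤ gphi g * (C * Real.exp (c * ∑ i, |g i|)) :=
        mul_le_mul_of_nonneg_left (h g) (gphi_pos g).le
    _ = _ := by ring

lemma abs_coord_le_exp (g : Fin n → ℝ) (k : Fin n) : |g k| ≤ Real.exp (∑ i, |g i|) :=
  calc |g k| ≤ ∑ i, |g i| := Finset.single_le_sum (f := fun i => |g i|)
        (fun i _ => abs_nonneg _) (Finset.mem_univ k)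
    _ ≤ _ := by linarith [Real.add_one_le_exp (∑ i, |g i|)]

lemma gphi_hasLineDerivAt (g : Fin n → ℝ) (k : Fin n) :
    HasLineDerivAt ℝ (gphi : (Fin n → ℝ) → ℝ) (-(g k) * gphi g) g (Pi.single k 1) := by
  unfold HasLineDerivAt gphi
  have h : HasDerivAt (fun t : ℝ => -((g + t • Pi.single k (1:ℝ)) ⬝ᵥ
      (g + t • Pi.single k (1:ℝ))) / 2) (-(g k)) 0 := by
    have : (fun t : ℝ => -((g + t • Pi.single k (1:ℝ)) ⬝ᵥ (g + t • Pi.single k (1:ℝ))) / 2) =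
        fun t : ℝ => -(g ⬝ᵥ g + 2 * (t * g k) + t ^ 2) / 2 := by
      ext t
      simp only [add_dotProduct, dotProduct_add, smul_dotProduct, dotProduct_smul,
        single_one_dotProduct, dotProduct_single_one, smul_eq_mul, Pi.add_apply, Pi.smul_apply,
        Pi.single_eq_same]
      ring
    rw [this]
    have h1 := (((((hasDerivAt_id (0:ℝ)).mul_const (g k)).const_mul 2).const_add (g ⬝ᵥ g)).add
      ((hasDerivAt_id (0:ℝ)).pow 2)).neg.div_const 2
    refine h1.congr_deriv ?_
    simp
    ring
  refine (h.exp.const_mul _).congr_deriv ?_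
  simp
  ring

lemma gaussian_ibp {h h' : (Fin n → ℝ) → ℝ} (k : Fin n) (hc : Continuous h) (hc' : Continuous h')
    {C c : ℝ} (hb : ∀ g, |h g| ≤ C * Real.exp (c * ∑ i, |g i|))
    (hb' : ∀ g, |h' g| ≤ C * Real.exp (c * ∑ i, |g i|))
    (hd : ∀ g, HasLineDerivAt ℝ h (h' g) g (Pi.single k 1)) :
    ∫ g, gphi g * (g k * h g) = ∫ g, gphi g * h' g := by
  have i1 : Integrable fun g : Fin n → ℝ => gphi g * (g k * h g) := by
    refine integrable_gphi_mul (by fun_prop) (C := C) (c := c + 1) fun g => ?_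
    rw [abs_mul, add_mul, Real.exp_add, one_mul]
    calc |g k| * |h g| ≤ Real.exp (∑ i, |g i|) * (C * Real.exp (c * ∑ i, |g i|)) :=
          mul_le_mul (abs_coord_le_exp g k) (hb g) (abs_nonneg _) (Real.exp_pos _).le
      _ = _ := by ring
  have i2 := integrable_gphi_mul hc' hb'
  have i3 := integrable_gphi_mul hc hb
  have := integral_bilinear_hasLineDerivAt_right_eq_neg_left_of_integrable
    (μ := (volume : Measure (Fin n → ℝ))) (f := gphi) (f' := fun g => -(g k) * gphi g) (g := h)
    (g' := h') (v := Pi.single k 1) (B := ContinuousLinearMap.mul ℝ ℝ)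
    (by
      refine i1.neg.congr (Filter.Eventually.of_forall fun g => ?_)
      simp; ring) (by simpa using i2) (by simpa using i3)
    (fun g _ => gphi_hasLineDerivAt g k) (fun g _ => hd g)
  simp only [ContinuousLinearMap.mul_apply'] at this
  rw [this, ← integral_neg]
  congr 1; ext g; ring

variable {E : Type*} [NormedAddCommGroup E] [NormedSpace ℝ E] [CompleteSpace E]
variable {μ : Measure (Fin n → ℝ)} {R : ℝ}

/-- Hypotheses on the homogeneous functional. -/
structure HomC2 (G : E → ℝ) (Ω : Set E) : Prop where
  opn : IsOpen Ω
  smooth : ContDiffOn ℝ 2 G Ω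
  cone : ∀ M ∈ Ω, ∀ c : ℝ, 0 < c → c • M ∈ Ω
  hom : ∀ M ∈ Ω, ∀ c : ℝ, 0 < c → G (c • M) = c * G M

lemma HomC2.hasFDerivAt {G : E → ℝ} {Ω : Set E} (h : HomC2 G Ω) {M : E} (hM : M ∈ Ω) :
    HasFDerivAt G (fderiv ℝ G M) M :=
  ((h.smooth.differentiableOn (by norm_num)).differentiableAt (h.opn.mem_nhds hM)).hasFDerivAt

lemma HomC2.smooth1 {G : E → ℝ} {Ω : Set E} (h : HomC2 G Ω) : ContDiffOn ℝ 1 (fderiv ℝ G) Ω :=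
  h.smooth.fderiv_of_isOpen h.opn (by norm_num)

lemma HomC2.hasFDerivAt1 {G : E → ℝ} {Ω : Set E} (h : HomC2 G Ω) {M : E} (hM : M ∈ Ω) :
    HasFDerivAt (fderiv ℝ G) (fderiv ℝ (fderiv ℝ G) M) M :=
  ((h.smooth1.differentiableOn (by norm_num)).differentiableAt (h.opn.mem_nhds hM)).hasFDerivAt

lemma HomC2.cont2 {G : E → ℝ} {Ω : Set E} (h : HomC2 G Ω) :
    ContinuousOn (fderiv ℝ (fderiv ℝ G)) Ω :=
  h.smooth1.continuousOn_fderiv_of_isOpen h.opn (by norm_num)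

lemma HomC2.fderiv_smul {G : E → ℝ} {Ω : Set E} (h : HomC2 G Ω) {M : E} (hM : M ∈ Ω) {c : ℝ}
    (hc : 0 < c) : fderiv ℝ G (c • M) = fderiv ℝ G M := by
  have h1 : (fun M => G (c • M)) =ᶠ[nhds M] fun M => c • G M := by
    filter_upwards [h.opn.mem_nhds hM] with N hN using h.hom N hN c hc
  have h2 := h1.fderiv_eq (𝕜 := ℝ)
  rw [fderiv_comp_smul, fderiv_fun_const_smul (h.hasFDerivAt hM).differentiableAt] at h2
  exact smul_right_injective _ hc.ne' h2

lemma HomC2.fderiv2_smul {G : E → ℝ} {Ω : Set E} (h : HomC2 G Ω) {M : E} (hM : M ∈ Ω) {c : ℝ}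
    (hc : 0 < c) : fderiv ℝ (fderiv ℝ G) (c • M) = c⁻¹ • fderiv ℝ (fderiv ℝ G) M := by
  have h1 : (fun M => fderiv ℝ G (c • M)) =ᶠ[nhds M] fderiv ℝ G := by
    filter_upwards [h.opn.mem_nhds hM] with N hN using h.fderiv_smul hN hc
  have h2 := h1.fderiv_eq (𝕜 := ℝ)
  rw [fderiv_comp_smul] at h2
  rw [← h2, smul_smul, inv_mul_cancel₀ hc.ne', one_smul]

theorem evolution [IsProbabilityMeasure μ] (hR : 0 ≤ R) (hμ : ∀ᵐ x ∂μ, ‖x‖ ≤ R)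
    {Ψ : (Fin n → ℝ) → E}
    (hΨ : Continuous Ψ) {G : E → ℝ} {Ω K : Set E} (hG : HomC2 G Ω) (hK : IsCompact K)
    (hKΩ : K ⊆ Ω)
    (hJ : ∀ s g, (Jm μ (fun _ => (1:ℝ)) s g)⁻¹ • Jm μ Ψ s g ∈ K) (s₀ : ℝ) :
    Integrable (fun g => gphi g * G (Jm μ Ψ s₀ g)) ∧
    Integrable (fun g => gphi g * ∑ k, fderiv ℝ (fderiv ℝ G) (Jm μ Ψ s₀ g)
      (Jm μ (fun x => x k • Ψ x) s₀ g) (Jm μ (fun x => x k • Ψ x) s₀ g)) ∧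
    HasDerivAt (fun s => ∫ g, gphi g * G (Jm μ Ψ s g))
      (s₀ * ∫ g, gphi g * ∑ k, fderiv ℝ (fderiv ℝ G) (Jm μ Ψ s₀ g)
        (Jm μ (fun x => x k • Ψ x) s₀ g) (Jm μ (fun x => x k • Ψ x) s₀ g)) s₀ := by
  set Z : ℝ → (Fin n → ℝ) → ℝ := fun s g => Jm μ (fun _ => (1:ℝ)) s g with hZ
  have Zpos : ∀ s g, 0 < Z s g := fun s g => Jm_one_pos hμ s g
  have hΨk : ∀ k : Fin n, Continuous fun x => x k • Ψ x := fun k => by fun_prop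
  have hΨkk : ∀ k : Fin n, Continuous fun x => x k • x k • Ψ x := fun k => by fun_prop
  have Jeq : ∀ s g, Jm μ Ψ s g = Z s g • ((Z s g)⁻¹ • Jm μ Ψ s g) := fun s g => by
    rw [smul_smul, mul_inv_cancel₀ (Zpos s g).ne', one_smul]
  have hΩ : ∀ s g, Jm μ Ψ s g ∈ Ω := fun s g => by
    rw [Jeq]; exact hG.cone _ (hKΩ (hJ s g)) _ (Zpos s g)
  -- bounds
  obtain ⟨C0, hC0⟩ := hK.exists_bound_of_continuousOn (hG.smooth.continuousOn.mono hKΩ)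
  obtain ⟨C1, hC1⟩ := hK.exists_bound_of_continuousOn (hG.smooth1.continuousOn.mono hKΩ)
  obtain ⟨C2, hC2⟩ := hK.exists_bound_of_continuousOn (f := fderiv ℝ (fderiv ℝ G))
    (hG.cont2.mono hKΩ)
  have C1n : 0 ≤ C1 := (norm_nonneg _).trans (hC1 _ (hJ 0 0))
  have C2n : 0 ≤ C2 := (norm_nonneg _).trans (hC2 _ (hJ 0 0))
  have C0n : 0 ≤ C0 := (norm_nonneg _).trans (hC0 _ (hJ 0 0))
  have b0 : ∀ s g, |G (Jm μ Ψ s g)| ≤ C0 * Z s g := fun s g => by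
    rw [Jeq, hG.hom _ (hKΩ (hJ s g)) _ (Zpos s g), abs_mul, abs_of_pos (Zpos s g), mul_comm]
    exact mul_le_mul_of_nonneg_right (hC0 _ (hJ s g)) (Zpos s g).le
  have b1 : ∀ s g v, |fderiv ℝ G (Jm μ Ψ s g) v| ≤ C1 * ‖v‖ := fun s g v => by
    rw [Jeq, hG.fderiv_smul (hKΩ (hJ s g)) (Zpos s g)]
    exact (ContinuousLinearMap.le_opNorm _ v).trans
      (mul_le_mul_of_nonneg_right (hC1 _ (hJ s g)) (norm_nonneg _))
  have b2 : ∀ s g v, |fderiv ℝ (fderiv ℝ G) (Jm μ Ψ s g) v v| ≤ (Z s g)⁻¹ * (C2 * ‖v‖ * ‖v‖) :=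
    fun s g v => by
      rw [Jeq, hG.fderiv2_smul (hKΩ (hJ s g)) (Zpos s g)]
      rw [ContinuousLinearMap.smul_apply, ContinuousLinearMap.smul_apply, smul_eq_mul, abs_mul,
        abs_of_pos (inv_pos.2 (Zpos s g))]
      refine mul_le_mul_of_nonneg_left ?_ (inv_pos.2 (Zpos s g)).le
      refine (ContinuousLinearMap.le_opNorm₂
        (fderiv ℝ (fderiv ℝ G) ((Z s g)⁻¹ • Jm μ Ψ s g)) v v).trans ?_
      gcongr
      exact hC2 _ (hJ s g)
  choose A hA0 hA using fun k => Jm_norm_le hμ (hΨk k)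
  choose B hB0 hB using fun k => Jm_norm_le hμ (hΨkk k)
  set T := |s₀| + 1 with hT
  have Tpos : 0 ≤ T := by positivity
  have Zle : ∀ s, |s| ≤ T → ∀ g, Z s g ≤ Real.exp (T * R * ∑ i, |g i|) := fun s hs g =>
    Jm_one_le hμ hs g
  have hs₀T : |s₀| ≤ T := by linarith
  -- continuity
  have cJ : ∀ s, Continuous fun g => Jm μ Ψ s g := Jm_continuous hμ hΨ
  have cJk : ∀ k s, Continuous fun g => Jm μ (fun x => x k • Ψ x) s g :=
    fun k => Jm_continuous hμ (hΨk k)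
  have cJkk : ∀ k s, Continuous fun g => Jm μ (fun x => x k • x k • Ψ x) s g :=
    fun k => Jm_continuous hμ (hΨkk k)
  have cG : ∀ s, Continuous fun g => G (Jm μ Ψ s g) := fun s =>
    hG.smooth.continuousOn.comp_continuous (cJ s) (hΩ s)
  have cG1 : ∀ s, Continuous fun g => fderiv ℝ G (Jm μ Ψ s g) := fun s =>
    hG.smooth1.continuousOn.comp_continuous (cJ s) (hΩ s)
  have cG2 : ∀ s, Continuous fun g => fderiv ℝ (fderiv ℝ G) (Jm μ Ψ s g) := fun s =>
    hG.cont2.comp_continuous (cJ s) (hΩ s)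
  -- decomposition of derivative
  have dec : ∀ s g, Jm μ (fun x => (g ⬝ᵥ x - s * (x ⬝ᵥ x)) • Ψ x) s g =
      ∑ k, (g k • Jm μ (fun x => x k • Ψ x) s g - s • Jm μ (fun x => x k • x k • Ψ x) s g) := by
    intro s g
    unfold Jm
    simp_rw [← integral_smul]
    have : ∀ k, (∫ x, g k • gw s g x • x k • Ψ x ∂μ) - ∫ x, s • gw s g x • x k • x k • Ψ x ∂μ =
        ∫ x, (g k • gw s g x • x k • Ψ x - s • gw s g x • x k • x k • Ψ x) ∂μ := fun k =>
      (integral_sub ((Jm_integrable hμ (hΨk k) s g).smul _)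
        ((Jm_integrable hμ (hΨkk k) s g).smul _)).symm
    simp_rw [this]
    rw [← integral_finsetSum]
    · congr 1; ext x
      simp only [dotProduct, smul_smul, ← sub_smul, ← Finset.sum_smul]
      congr 1
      rw [Finset.mul_sum, ← Finset.sum_sub_distrib, Finset.mul_sum]
      exact Finset.sum_congr rfl fun k _ => by ring
    · intro k _
      exact ((Jm_integrable hμ (hΨk k) s g).smul _).sub ((Jm_integrable hμ (hΨkk k) s g).smul _)
  have Fd : ∀ s g, HasDerivAt (fun s => gphi g * G (Jm μ Ψ s g))
      (gphi g * ∑ k, (g k * fderiv ℝ G (Jm μ Ψ s g) (Jm μ (fun x => x k • Ψ x) s g) -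
        s * fderiv ℝ G (Jm μ Ψ s g) (Jm μ (fun x => x k • x k • Ψ x) s g))) s := by
    intro s g
    have h1 := (hG.hasFDerivAt (hΩ s g)).comp_hasDerivAt s (Jm_hasDerivAt_s hμ hΨ s g)
    refine (h1.const_mul (gphi g)).congr_deriv ?_
    rw [dec]
    simp [map_sum, map_sub, map_smul]
  have bterm : ∀ s, |s| ≤ T → ∀ g k,
      |g k * fderiv ℝ G (Jm μ Ψ s g) (Jm μ (fun x => x k • Ψ x) s g) -
        s * fderiv ℝ G (Jm μ Ψ s g) (Jm μ (fun x => x k • x k • Ψ x) s g)| ≤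
      (C1 * A k + T * (C1 * B k)) * Real.exp ((T * R + 1) * ∑ i, |g i|) := by
    intro s hs g k
    have e1 : 1 ≤ Real.exp (∑ i, |g i|) := Real.one_le_exp (Finset.sum_nonneg fun i _ => abs_nonneg _)
    have z1 := Zle s hs g
    rw [add_mul (T * R), one_mul, Real.exp_add]
    have h1 : |g k * fderiv ℝ G (Jm μ Ψ s g) (Jm μ (fun x => x k • Ψ x) s g)| ≤
        Real.exp (∑ i, |g i|) * (C1 * (A k * Real.exp (T * R * ∑ i, |g i|))) := by
      rw [abs_mul]
      refine mul_le_mul (abs_coord_le_exp g k) ((b1 s g _).trans ?_) (abs_nonneg _)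
        (Real.exp_pos _).le
      exact mul_le_mul_of_nonneg_left ((hA k s g).trans (mul_le_mul_of_nonneg_left z1 (hA0 k))) C1n
    have h2 : |s * fderiv ℝ G (Jm μ Ψ s g) (Jm μ (fun x => x k • x k • Ψ x) s g)| ≤
        T * (C1 * (B k * (Real.exp (∑ i, |g i|) * Real.exp (T * R * ∑ i, |g i|)))) := by
      rw [abs_mul]
      refine mul_le_mul hs ((b1 s g _).trans ?_) (abs_nonneg _) Tpos
      refine mul_le_mul_of_nonneg_left ((hB k s g).trans (mul_le_mul_of_nonneg_left ?_ (hB0 k))) C1n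
      exact z1.trans (le_mul_of_one_le_left (Real.exp_pos _).le e1)
    refine (abs_sub _ _).trans ((add_le_add h1 h2).trans (le_of_eq ?_))
    ring
  have i0 : ∀ s, |s| ≤ T → Integrable (fun g => gphi g * G (Jm μ Ψ s g)) := fun s hs =>
    integrable_gphi_mul (cG s) (C := C0) (c := T * R) fun g =>
      (b0 s g).trans (mul_le_mul_of_nonneg_left (Zle s hs g) C0n)
  -- second derivative terms
  set D2 : Fin n → (Fin n → ℝ) → ℝ := fun k g => fderiv ℝ (fderiv ℝ G) (Jm μ Ψ s₀ g)
      (Jm μ (fun x => x k • Ψ x) s₀ g) (Jm μ (fun x => x k • Ψ x) s₀ g) with hD2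
  have cD2 : ∀ k, Continuous (D2 k) := fun k => by
    exact ((cG2 s₀).clm_apply (cJk k s₀)).clm_apply (cJk k s₀)
  have bD2 : ∀ k g, |D2 k g| ≤ (C2 * A k * A k) * Real.exp (T * R * ∑ i, |g i|) := by
    intro k g
    refine (b2 s₀ g _).trans ?_
    have h1 := hA k s₀ g
    have zp := Zpos s₀ g
    calc (Z s₀ g)⁻¹ * (C2 * ‖Jm μ (fun x => x k • Ψ x) s₀ g‖ * ‖Jm μ (fun x => x k • Ψ x) s₀ g‖)
        ≤ (Z s₀ g)⁻¹ * (C2 * (A k * Z s₀ g) * (A k * Z s₀ g)) := by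
          have := hA0 k
          gcongr
      _ = (C2 * A k * A k) * Z s₀ g := by field_simp
      _ ≤ _ := by
          have := hA0 k
          exact mul_le_mul_of_nonneg_left (Zle s₀ hs₀T g) (by positivity)
  have iD2 : ∀ k, Integrable fun g => gphi g * D2 k g := fun k =>
    integrable_gphi_mul (cD2 k) (bD2 k)
  -- first derivative terms
  set h : Fin n → (Fin n → ℝ) → ℝ := fun k g => fderiv ℝ G (Jm μ Ψ s₀ g)
      (Jm μ (fun x => x k • Ψ x) s₀ g) with hh
  set hk : Fin n → (Fin n → ℝ) → ℝ := fun k g => fderiv ℝ G (Jm μ Ψ s₀ g)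
      (Jm μ (fun x => x k • x k • Ψ x) s₀ g) with hhk
  have ch : ∀ k, Continuous (h k) := fun k => (cG1 s₀).clm_apply (cJk k s₀)
  have chk : ∀ k, Continuous (hk k) := fun k => (cG1 s₀).clm_apply (cJkk k s₀)
  have bh : ∀ k g, |h k g| ≤ C1 * A k * Real.exp (T * R * ∑ i, |g i|) := fun k g => by
    refine (b1 s₀ g _).trans ?_
    rw [mul_assoc]
    exact mul_le_mul_of_nonneg_left ((hA k s₀ g).trans
      (mul_le_mul_of_nonneg_left (Zle s₀ hs₀T g) (hA0 k))) C1n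
  have bhk : ∀ k g, |hk k g| ≤ C1 * B k * Real.exp (T * R * ∑ i, |g i|) := fun k g => by
    refine (b1 s₀ g _).trans ?_
    rw [mul_assoc]
    exact mul_le_mul_of_nonneg_left ((hB k s₀ g).trans
      (mul_le_mul_of_nonneg_left (Zle s₀ hs₀T g) (hB0 k))) C1n
  have dh : ∀ k g, HasLineDerivAt ℝ (h k) (s₀ * D2 k g + s₀ * hk k g) g (Pi.single k 1) := by
    intro k g
    have l1 : HasDerivAt (fun t : ℝ => Jm μ Ψ s₀ (g + t • Pi.single k 1))
        (s₀ • Jm μ (fun x => x k • Ψ x) s₀ g) 0 := by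
      have := Jm_hasLineDerivAt hμ hΨ s₀ g (Pi.single k 1)
      simp only [single_one_dotProduct] at this
      exact this
    have l2 : HasDerivAt (fun t : ℝ => Jm μ (fun x => x k • Ψ x) s₀ (g + t • Pi.single k 1))
        (s₀ • Jm μ (fun x => x k • x k • Ψ x) s₀ g) 0 := by
      have := Jm_hasLineDerivAt hμ (hΨk k) s₀ g (Pi.single k 1)
      simp only [single_one_dotProduct] at this
      exact this
    have l3 : HasFDerivAt (fderiv ℝ G) (fderiv ℝ (fderiv ℝ G) (Jm μ Ψ s₀ g))
        (Jm μ Ψ s₀ (g + (0:ℝ) • Pi.single k 1)) := by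
      simpa using hG.hasFDerivAt1 (hΩ s₀ g)
    have l4 := l3.comp_hasDerivAt (0:ℝ) l1
    have l5 := l4.clm_apply l2
    refine l5.congr_deriv ?_
    simp [hD2, hhk]
  have ibp : ∀ k, ∫ g, gphi g * (g k * h k g) = ∫ g, gphi g * (s₀ * D2 k g + s₀ * hk k g) := by
    intro k
    have q1 := hA0 k
    have q2 := hB0 k
    refine gaussian_ibp k (ch k) (((cD2 k).const_mul s₀).add ((chk k).const_mul s₀))
      (C := C1 * A k + T * (C2 * A k * A k + C1 * B k)) (c := T * R) (fun g => ?_) (fun g => ?_)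
      (dh k)
    · refine (bh k g).trans (mul_le_mul_of_nonneg_right ?_ (Real.exp_pos _).le)
      have : 0 ≤ T * (C2 * A k * A k + C1 * B k) := by positivity
      linarith
    · rw [← mul_add, abs_mul]
      calc |s₀| * |D2 k g + hk k g| ≤ T * ((C2 * A k * A k) * Real.exp (T * R * ∑ i, |g i|) +
            C1 * B k * Real.exp (T * R * ∑ i, |g i|)) :=
            mul_le_mul hs₀T ((abs_add_le _ _).trans (add_le_add (bD2 k g) (bhk k g)))
              (abs_nonneg _) Tpos
        _ = T * (C2 * A k * A k + C1 * B k) * Real.exp (T * R * ∑ i, |g i|) := by ring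
        _ ≤ _ := by
            refine mul_le_mul_of_nonneg_right ?_ (Real.exp_pos _).le
            have : 0 ≤ C1 * A k := by positivity
            linarith
  refine ⟨i0 s₀ hs₀T, ?_, ?_⟩
  · simp_rw [Finset.mul_sum]
    exact integrable_finsetSum _ fun k _ => iD2 k
  have main := (hasDerivAt_integral_of_dominated_loc_of_deriv_le
    (μ := (volume : Measure (Fin n → ℝ)))
    (bound := fun g => ∑ k, (C1 * A k + T * (C1 * B k)) *
      (gphi g * Real.exp ((T * R + 1) * ∑ i, |g i|)))
    (F := fun s g => gphi g * G (Jm μ Ψ s g))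
    (F' := fun s g => gphi g * ∑ k, (g k * fderiv ℝ G (Jm μ Ψ s g) (Jm μ (fun x => x k • Ψ x) s g) -
        s * fderiv ℝ G (Jm μ Ψ s g) (Jm μ (fun x => x k • x k • Ψ x) s g)))
    (Metric.closedBall_mem_nhds s₀ one_pos)
    (Filter.Eventually.of_forall fun s => (continuous_gphi.mul (cG s)).aestronglyMeasurable)
    (i0 s₀ hs₀T) ?_ ?_ ?_ ?_).2
  · refine main.congr_deriv ?_
    have e : ∀ g, gphi g * ∑ k, (g k * fderiv ℝ G (Jm μ Ψ s₀ g) (Jm μ (fun x => x k • Ψ x) s₀ g) -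
        s₀ * fderiv ℝ G (Jm μ Ψ s₀ g) (Jm μ (fun x => x k • x k • Ψ x) s₀ g)) =
        ∑ k, (gphi g * (g k * h k g) - s₀ * (gphi g * hk k g)) := fun g => by
      rw [Finset.mul_sum]
      exact Finset.sum_congr rfl fun k _ => by simp only [hh, hhk]; ring
    have ihk : ∀ k, Integrable fun g => gphi g * hk k g := fun k =>
      integrable_gphi_mul (chk k) (bhk k)
    have igh : ∀ k, Integrable fun g => gphi g * (g k * h k g) := fun k => by
      refine integrable_gphi_mul (by have := ch k; fun_prop) (C := C1 * A k) (c := T * R + 1) fun g => ?_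
      rw [abs_mul, add_mul, Real.exp_add, one_mul]
      calc |g k| * |h k g| ≤ Real.exp (∑ i, |g i|) * (C1 * A k * Real.exp (T * R * ∑ i, |g i|)) :=
            mul_le_mul (abs_coord_le_exp g k) (bh k g) (abs_nonneg _) (Real.exp_pos _).le
        _ = _ := by ring
    simp_rw [e]
    have idf : ∀ k, Integrable fun g => gphi g * (g k * h k g) - s₀ * (gphi g * hk k g) :=
      fun k => (igh k).sub ((ihk k).const_mul _)
    rw [integral_finsetSum _ fun k _ => idf k]
    simp_rw [Finset.mul_sum]
    rw [integral_finsetSum _ fun k _ => iD2 k, Finset.mul_sum]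
    refine Finset.sum_congr rfl fun k _ => ?_
    rw [integral_sub (igh k) ((ihk k).const_mul _), ibp k]
    have : ∀ g, gphi g * (s₀ * D2 k g + s₀ * hk k g) =
        s₀ * (gphi g * D2 k g) + s₀ * (gphi g * hk k g) := fun g => by ring
    simp_rw [this]
    rw [integral_add ((iD2 k).const_mul _) ((ihk k).const_mul _), integral_const_mul,
      integral_const_mul]
    ring
  · refine Continuous.aestronglyMeasurable (continuous_gphi.mul (continuous_finsetSum _ fun k _ => ?_))
    exact ((continuous_apply k).mul (ch k)).sub ((chk k).const_mul s₀)
  · refine Filter.Eventually.of_forall fun g s hs => ?_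
    have hsT : |s| ≤ T := by
      have : |s - s₀| ≤ 1 := by simpa [Real.dist_eq] using hs
      have h2 := abs_add_le (s - s₀) s₀
      rw [sub_add_cancel] at h2
      linarith
    rw [norm_mul, Real.norm_of_nonneg (gphi_pos g).le]
    calc _ ≤ gphi g * ∑ k, (C1 * A k + T * (C1 * B k)) * Real.exp ((T * R + 1) * ∑ i, |g i|) := by
          refine mul_le_mul_of_nonneg_left ?_ (gphi_pos g).le
          refine (Finset.abs_sum_le_sum_abs _ _).trans (Finset.sum_le_sum fun k _ => bterm s hsT g k)
      _ = _ := by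
          rw [Finset.mul_sum]
          exact Finset.sum_congr rfl fun k _ => by ring
  · exact integrable_finsetSum _ fun k _ => (integrable_gphi_exp _).const_mul _
  · exact Filter.Eventually.of_forall fun g s _ => Fd s g

end Evo

section MatCalc
attribute [local instance] Matrix.linftyOpNormedRing Matrix.linftyOpNormedAlgebra
variable {n : ℕ}

noncomputable def entryL (i j : Fin n) : Matrix (Fin n) (Fin n) ℝ →L[ℝ] ℝ :=
  LinearMap.toContinuousLinearMap (Matrix.entryLinearMap ℝ ℝ i j)

noncomputable def traceL : Matrix (Fin n) (Fin n) ℝ →L[ℝ] ℝ :=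
  LinearMap.toContinuousLinearMap (Matrix.traceLinearMap (Fin n) ℝ ℝ)

lemma traceL_apply (M : Matrix (Fin n) (Fin n) ℝ) : traceL M = M.trace := rfl

lemma hasDerivAt_trace {N : ℝ → Matrix (Fin n) (Fin n) ℝ} {N' : Matrix (Fin n) (Fin n) ℝ} {σ : ℝ}
    (h : HasDerivAt N N' σ) : HasDerivAt (fun τ => (N τ).trace) N'.trace σ :=
  (traceL (n := n)).hasFDerivAt.comp_hasDerivAt σ h

lemma det_differentiable : Differentiable ℝ (Matrix.det : Matrix (Fin n) (Fin n) ℝ → ℝ) := by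
  have h : (Matrix.det : Matrix (Fin n) (Fin n) ℝ → ℝ) = fun M =>
      ∑ σ : Equiv.Perm (Fin n), ((Equiv.Perm.sign σ : ℤ) : ℝ) * ∏ i, entryL (σ i) i M := by
    ext M; rw [Matrix.det_apply']; rfl
  rw [h]
  fun_prop

lemma det_hasFDerivAt_one : HasFDerivAt (Matrix.det : Matrix (Fin n) (Fin n) ℝ → ℝ) traceL 1 := by
  have h := (det_differentiable (n := n) 1).hasFDerivAt
  convert h using 1
  ext M
  have h1 : HasDerivAt (fun t : ℝ => (1 : Matrix (Fin n) (Fin n) ℝ) + t • M) M 0 := by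
    refine (((hasDerivAt_id (0:ℝ)).smul_const M).const_add (1 : Matrix (Fin n) (Fin n) ℝ)).congr_deriv ?_
    exact one_smul ℝ M
  have h0 : HasFDerivAt (Matrix.det : Matrix (Fin n) (Fin n) ℝ → ℝ)
      (fderiv ℝ Matrix.det 1) ((1 : Matrix (Fin n) (Fin n) ℝ) + (0:ℝ) • M) := by simpa using h
  have h2 := h0.comp_hasDerivAt (0:ℝ) h1
  have h3 : HasDerivAt (fun t : ℝ => Matrix.det ((1 : Matrix (Fin n) (Fin n) ℝ) + t • M))
      M.trace 0 := by
    have : (fun t : ℝ => Matrix.det ((1 : Matrix (Fin n) (Fin n) ℝ) + t • M)) = _ :=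
      funext fun t => Matrix.det_one_add_smul t M
    rw [this]
    generalize (Matrix.det (1 + (Polynomial.X : Polynomial ℝ) • M.map Polynomial.C)).divX.divX = p
    have h4 := (((hasDerivAt_id (0:ℝ)).const_mul M.trace).const_add 1).add
      ((p.hasDerivAt (0:ℝ)).mul ((hasDerivAt_id (0:ℝ)).pow 2))
    refine h4.congr_deriv ?_
    simp
  rw [traceL_apply]
  exact h3.unique h2

lemma hasDerivAt_det {N : ℝ → Matrix (Fin n) (Fin n) ℝ} {N' : Matrix (Fin n) (Fin n) ℝ} {σ : ℝ}
    (h : HasDerivAt N N' σ) (hu : (N σ).det ≠ 0) :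
    HasDerivAt (fun τ => (N τ).det) ((N σ).det * ((N σ)⁻¹ * N').trace) σ := by
  have hu' : IsUnit (N σ).det := isUnit_iff_ne_zero.2 hu
  have e : (fun τ => (N τ).det) = fun τ => (N σ).det * ((N σ)⁻¹ * N τ).det := by
    ext τ
    rw [Matrix.det_mul, Matrix.det_nonsing_inv, Ring.inverse_eq_inv', mul_inv_cancel_left₀ hu]
  rw [e]
  have h1 : HasDerivAt (fun τ => (N σ)⁻¹ * N τ) ((N σ)⁻¹ * N') σ := h.const_mul _
  have h0 : HasFDerivAt (Matrix.det : Matrix (Fin n) (Fin n) ℝ → ℝ) traceL ((N σ)⁻¹ * N σ) := by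
    rw [Matrix.nonsing_inv_mul _ hu']; exact det_hasFDerivAt_one
  exact (h0.comp_hasDerivAt σ h1).const_mul _

lemma hasDerivAt_matInv {N : ℝ → Matrix (Fin n) (Fin n) ℝ} {N' : Matrix (Fin n) (Fin n) ℝ} {σ : ℝ}
    (h : HasDerivAt N N' σ) (hu : (N σ).det ≠ 0) :
    HasDerivAt (fun τ => (N τ)⁻¹) (-((N σ)⁻¹ * N' * (N σ)⁻¹)) σ := by
  have hu' : IsUnit (N σ) := (Matrix.isUnit_iff_isUnit_det _).2 (isUnit_iff_ne_zero.2 hu)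
  obtain ⟨u, hu2⟩ := hu'
  have h0 := hasFDerivAt_ringInverse (𝕜 := ℝ) u
  rw [hu2] at h0
  have h1 := h0.comp_hasDerivAt σ h
  have e : (fun τ => (N τ)⁻¹) = Ring.inverse ∘ N := by
    ext τ : 1
    rw [Matrix.nonsing_inv_eq_ringInverse]; rfl
  rw [e]
  refine h1.congr_deriv ?_
  have : (N σ)⁻¹ = ↑u⁻¹ := by rw [← hu2, Matrix.coe_units_inv]
  simp [this]

/-- The functional on covariance matrices. -/
noncomputable def psiF (ε : ℝ) (A : Matrix (Fin n) (Fin n) ℝ) : ℝ :=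
  (Real.log (A + ε • (1 : Matrix (Fin n) (Fin n) ℝ)).det - (A * A).trace) / n

lemma psi_curve (ε : ℝ) (A H P : Matrix (Fin n) (Fin n) ℝ)
    (hA : (A + ε • (1 : Matrix (Fin n) (Fin n) ℝ)).det ≠ 0) :
    ∃ p1 : ℝ → ℝ, (∀ᶠ σ in nhds (0:ℝ), HasDerivAt (fun σ : ℝ => psiF ε (A + σ • H - σ ^ 2 • P))
      (p1 σ) σ) ∧ HasDerivAt p1 ((-((A + ε • 1)⁻¹ * H * (A + ε • 1)⁻¹ * H).trace
        - 2 * ((A + ε • 1)⁻¹ * P).trace - 2 * (H * H).trace + 4 * (A * P).trace) / n) 0 := by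
  set A' : ℝ → Matrix (Fin n) (Fin n) ℝ := fun σ => A + σ • H - σ ^ 2 • P with hA'
  set N : ℝ → Matrix (Fin n) (Fin n) ℝ := fun σ => A' σ + ε • 1 with hN
  have dA : ∀ σ, HasDerivAt A' (H - (2 * σ) • P) σ := fun σ => by
    have h1 := (((hasDerivAt_id σ).smul_const H).const_add A).sub
      (((hasDerivAt_id σ).pow 2).smul_const P)
    refine h1.congr_deriv ?_
    simp
  have dN : ∀ σ, HasDerivAt N (H - (2 * σ) • P) σ := fun σ => (dA σ).add_const _
  have N0 : N 0 = A + ε • 1 := by simp [hN, hA']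
  have A0 : A' 0 = A := by simp [hA']
  have cdet : ContinuousAt (fun σ => (N σ).det) 0 :=
    (hasDerivAt_det (dN 0) (by rw [N0]; exact hA)).continuousAt
  have ev : ∀ᶠ σ in nhds (0:ℝ), (N σ).det ≠ 0 := cdet.eventually_ne (by rw [N0]; exact hA)
  refine ⟨fun σ => (((N σ)⁻¹ * (H - (2 * σ) • P)).trace - 2 * (A' σ * (H - (2 * σ) • P)).trace) / n,
    ?_, ?_⟩
  · filter_upwards [ev] with σ hσ
    have h1 := (hasDerivAt_det (dN σ) hσ).log hσ
    have h2 := hasDerivAt_trace ((dA σ).mul (dA σ))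
    refine ((h1.sub h2).div_const (n:ℝ)).congr_deriv ?_
    rw [mul_div_cancel_left₀ _ hσ, Matrix.trace_add,
      Matrix.trace_mul_comm (H - (2 * σ) • P) (A' σ)]
    ring
  · have dI := hasDerivAt_matInv (dN 0) (by rw [N0]; exact hA)
    have dH : HasDerivAt (fun σ : ℝ => H - (2 * σ) • P) (-((2:ℝ) • P)) 0 := by
      refine ((((hasDerivAt_id (0:ℝ)).const_mul 2).smul_const P).const_sub H).congr_deriv ?_
      rw [mul_one]
    have h1 := hasDerivAt_trace (dI.mul dH)
    have h2 := hasDerivAt_trace ((dA 0).mul dH)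
    refine ((h1.sub (h2.const_mul 2)).div_const (n:ℝ)).congr_deriv ?_
    rw [N0, A0]
    simp only [mul_zero, zero_smul, sub_zero, Matrix.trace_add, Matrix.neg_mul,
      Matrix.mul_neg, Matrix.trace_neg, Matrix.mul_smul, Matrix.trace_smul, smul_eq_mul]
    ring

end MatCalc

lemma persp_curve {ψ p1 : ℝ → ℝ} {p2 c : ℝ} (h1 : ∀ᶠ σ in nhds (0:ℝ), HasDerivAt ψ (p1 σ) σ)
    (h2 : HasDerivAt p1 p2 0) :
    ∃ e : ℝ → ℝ, (∀ᶠ τ in nhds (0:ℝ),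
      HasDerivAt (fun τ => (1 + τ * c) * Real.exp (ψ (τ / (1 + τ * c)))) (e τ) τ) ∧
      HasDerivAt e (Real.exp (ψ 0) * (p1 0 ^ 2 + p2)) 0 := by
  have dσ : ∀ τ : ℝ, 1 + τ * c ≠ 0 →
      HasDerivAt (fun τ : ℝ => τ / (1 + τ * c)) (1 / (1 + τ * c) ^ 2) τ := fun τ hτ => by
    have d1 : HasDerivAt (fun τ : ℝ => 1 + τ * c) c τ := by
      simpa using ((hasDerivAt_id τ).mul_const c).const_add 1
    refine ((hasDerivAt_id τ).div d1 hτ).congr_deriv ?_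
    simp
  have ne : ∀ᶠ τ in nhds (0:ℝ), 1 + τ * c ≠ 0 := by
    have : ContinuousAt (fun τ : ℝ => 1 + τ * c) 0 := by fun_prop
    exact this.eventually_ne (by simp)
  have tend : Filter.Tendsto (fun τ : ℝ => τ / (1 + τ * c)) (nhds 0) (nhds 0) := by
    have := (dσ 0 (by simp)).continuousAt.tendsto
    simpa using this
  refine ⟨fun τ => Real.exp (ψ (τ / (1 + τ * c))) * (c + p1 (τ / (1 + τ * c)) / (1 + τ * c)), ?_, ?_⟩
  · filter_upwards [ne, tend.eventually h1] with τ hτ h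
    have d1 : HasDerivAt (fun τ : ℝ => 1 + τ * c) c τ := by
      simpa using ((hasDerivAt_id τ).mul_const c).const_add 1
    refine (d1.mul (h.comp τ (dσ τ hτ)).exp).congr_deriv ?_
    simp only [Function.comp]
    field_simp
  · have d1 : HasDerivAt (fun τ : ℝ => 1 + τ * c) c 0 := by
      simpa using ((hasDerivAt_id (0:ℝ)).mul_const c).const_add 1
    have z : (0:ℝ) / (1 + 0 * c) = 0 := by simp
    have hψ : HasDerivAt ψ (p1 0) (0 / (1 + 0 * c)) := by rw [z]; exact h1.self_of_nhds
    have hp : HasDerivAt p1 p2 (0 / (1 + 0 * c)) := by rw [z]; exact h2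
    have a1 := (hψ.comp (0:ℝ) (dσ 0 (by simp))).exp
    have a2 := ((hp.comp (0:ℝ) (dσ 0 (by simp))).div d1 (by simp)).const_add c
    refine (a1.mul a2).congr_deriv ?_
    simp
    ring

section GDef
variable {n : ℕ}

/-- Moment space. -/
abbrev EE (n : ℕ) : Type := ℝ × (Fin n → ℝ) × (Fin n → Fin n → ℝ)

def Psi (x : Fin n → ℝ) : EE n := (1, x, fun i j => x i * x j)

lemma continuous_Psi : Continuous (Psi : (Fin n → ℝ) → EE n) := by
  unfold Psi; fun_prop

noncomputable def covM (M : EE n) : Matrix (Fin n) (Fin n) ℝ :=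
  Matrix.of fun i j => M.2.2 i j / M.1 - M.2.1 i * M.2.1 j / M.1 ^ 2

noncomputable def Gf (ε : ℝ) (M : EE n) : ℝ := M.1 * Real.exp (psiF ε (covM M))

def Om (n : ℕ) (ε : ℝ) : Set (EE n) :=
  {M | 0 < M.1 ∧ 0 < (covM M + ε • (1 : Matrix (Fin n) (Fin n) ℝ)).det}

lemma covM_smul (M : EE n) {c : ℝ} (hc : c ≠ 0) : covM (c • M) = covM M := by
  ext i j
  simp only [covM, Matrix.of_apply, Prod.smul_fst, Prod.smul_snd, Pi.smul_apply, smul_eq_mul]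
  by_cases h : M.1 = 0
  · simp [h]
  · field_simp

lemma covM_entry_contDiffAt (M : EE n) (hM : M.1 ≠ 0) (i j : Fin n) :
    ContDiffAt ℝ 2 (fun M : EE n => covM M i j) M := by
  simp only [covM, Matrix.of_apply]
  have h1 : ContDiffAt ℝ 2 (fun M : EE n => M.2.2 i j) M := by fun_prop
  have h2 : ∀ i, ContDiffAt ℝ 2 (fun M : EE n => M.2.1 i) M := fun i => by fun_prop
  have h3 : ContDiffAt ℝ 2 (fun M : EE n => M.1) M := by fun_prop
  exact (h1.div h3 hM).sub (((h2 i).mul (h2 j)).div (h3.pow 2) (pow_ne_zero 2 hM))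

lemma covM_det_contDiffAt (ε : ℝ) (M : EE n) (hM : M.1 ≠ 0) :
    ContDiffAt ℝ 2 (fun M : EE n => (covM M + ε • (1 : Matrix (Fin n) (Fin n) ℝ)).det) M := by
  simp only [Matrix.det_apply', Matrix.add_apply]
  refine ContDiffAt.sum fun σ _ => contDiffAt_const.mul (contDiffAt_prod fun i _ => ?_)
  exact (covM_entry_contDiffAt M hM _ _).add contDiffAt_const

lemma covM_trace_contDiffAt (M : EE n) (hM : M.1 ≠ 0) :
    ContDiffAt ℝ 2 (fun M : EE n => (covM M * covM M).trace) M := by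
  simp only [Matrix.trace, Matrix.diag, Matrix.mul_apply]
  refine ContDiffAt.sum fun i _ => ContDiffAt.sum fun j _ => ?_
  exact (covM_entry_contDiffAt M hM _ _).mul (covM_entry_contDiffAt M hM _ _)

lemma homC2_Gf (ε : ℝ) : HomC2 (Gf (n := n) ε) (Om n ε) where
  opn := by
    rw [isOpen_iff_mem_nhds]
    rintro M ⟨h1, h2⟩
    have c1 : ContinuousAt (fun M : EE n => M.1) M := continuousAt_fst
    have c2 := (covM_det_contDiffAt ε M h1.ne').continuousAt
    filter_upwards [c1.tendsto.eventually_const_lt h1, c2.tendsto.eventually_const_lt h2] with N a b using ⟨a, b⟩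
  smooth := by
    rintro M ⟨h1, h2⟩
    apply ContDiffAt.contDiffWithinAt
    unfold Gf psiF
    have c3 : ContDiffAt ℝ 2 (fun M : EE n => M.1) M := by fun_prop
    exact c3.mul (((((covM_det_contDiffAt ε M h1.ne').log h2.ne').sub
      (covM_trace_contDiffAt M h1.ne')).div_const _).exp)
  cone := by
    rintro M ⟨h1, h2⟩ c hc
    refine ⟨?_, ?_⟩
    · simpa using mul_pos hc h1
    · rw [covM_smul _ hc.ne']; exact h2
  hom := by
    rintro M - c hc
    unfold Gf
    rw [covM_smul _ hc.ne']
    simp [mul_assoc]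

lemma HomC2.second_line {E : Type*} [NormedAddCommGroup E] [NormedSpace ℝ E] [CompleteSpace E] {G : E → ℝ}
    {Ω : Set E} (hG : HomC2 G Ω) {M : E} (hM : M ∈ Ω)
    (v : E) {e : ℝ → ℝ} {e' : ℝ} (h : ∀ᶠ τ in nhds (0:ℝ), HasDerivAt (fun τ => G (M + τ • v)) (e τ) τ)
    (h' : HasDerivAt e e' 0) : fderiv ℝ (fderiv ℝ G) M v v = e' := by
  have l1 : ∀ τ : ℝ, HasDerivAt (fun τ : ℝ => M + τ • v) v τ := fun τ => by
    simpa using ((hasDerivAt_id τ).smul_const v).const_add M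
  have c1 : ContinuousAt (fun τ : ℝ => M + τ • v) 0 := (l1 0).continuousAt
  have ev : ∀ᶠ τ in nhds (0:ℝ), M + τ • v ∈ Ω :=
    c1.eventually_mem (hG.opn.mem_nhds (by simpa using hM))
  have eq : e =ᶠ[nhds 0] fun τ => fderiv ℝ G (M + τ • v) v := by
    filter_upwards [h, ev] with τ h1 h2
    exact h1.unique ((hG.hasFDerivAt h2).comp_hasDerivAt τ (l1 τ))
  have h0 : HasFDerivAt (fderiv ℝ G) (fderiv ℝ (fderiv ℝ G) M) (M + (0:ℝ) • v) := by
    simpa using hG.hasFDerivAt1 hM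
  have h2 : HasDerivAt (fun τ : ℝ => fderiv ℝ G (M + τ • v)) (fderiv ℝ (fderiv ℝ G) M v) 0 :=
    h0.comp_hasDerivAt (0:ℝ) (l1 0)
  have h2' : HasDerivAt (fun τ : ℝ => fderiv ℝ G (M + τ • v) v)
      (fderiv ℝ (fderiv ℝ G) M v v) 0 :=
    (ContinuousLinearMap.apply ℝ ℝ v).hasFDerivAt.comp_hasDerivAt (0:ℝ) h2
  have h3 : HasDerivAt (fun τ : ℝ => fderiv ℝ G (M + τ • v) v) e' 0 :=
    h'.congr_of_eventuallyEq eq.symm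
  exact h2'.unique h3

lemma Gf_second (ε : ℝ) (a : Fin n → ℝ) (B : Fin n → Fin n → ℝ) (c : ℝ) (d : Fin n → ℝ)
    (T : Fin n → Fin n → ℝ) (A H P : Matrix (Fin n) (Fin n) ℝ)
    (hA : ∀ i j, A i j = B i j - a i * a j)
    (hH : ∀ i j, H i j = T i j - c * B i j - a i * (d j - c * a j) - a j * (d i - c * a i))
    (hP : ∀ i j, P i j = (d i - c * a i) * (d j - c * a j))
    (hdet : 0 < (A + ε • (1 : Matrix (Fin n) (Fin n) ℝ)).det) :
    Real.exp (psiF ε A) * ((-((A + ε • 1)⁻¹ * H * (A + ε • 1)⁻¹ * H).trace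
        - 2 * ((A + ε • 1)⁻¹ * P).trace - 2 * (H * H).trace + 4 * (A * P).trace) / n) ≤
    fderiv ℝ (fderiv ℝ (Gf ε)) ((1, a, B) : EE n) (c, d, T) (c, d, T) := by
  obtain ⟨p1, h1, h2⟩ := psi_curve ε A H P hdet.ne'
  obtain ⟨e, h3, h4⟩ := persp_curve (c := c) h1 h2
  have cA : covM ((1, a, B) : EE n) = A := by
    ext i j; simp [covM, hA]
  have hM : ((1, a, B) : EE n) ∈ Om n ε := by
    refine ⟨one_pos, ?_⟩
    rw [cA]; exact hdet
  have key : ∀ᶠ τ in nhds (0:ℝ), HasDerivAt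
      (fun τ : ℝ => Gf ε (((1, a, B) : EE n) + τ • ((c, d, T) : EE n))) (e τ) τ := by
    have ne : ∀ᶠ τ in nhds (0:ℝ), 1 + τ * c ≠ 0 := by
      have : ContinuousAt (fun τ : ℝ => 1 + τ * c) 0 := by fun_prop
      exact this.eventually_ne (by simp)
    filter_upwards [h3, ne.eventually_nhds] with τ h ht
    refine h.congr_of_eventuallyEq ?_
    filter_upwards [ht] with t hne
    unfold Gf
    have : covM (((1, a, B) : EE n) + t • ((c, d, T) : EE n)) =
        A + (t / (1 + t * c)) • H - (t / (1 + t * c)) ^ 2 • P := by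
      ext i j
      simp only [covM, Matrix.of_apply, Prod.fst_add, Prod.snd_add, Prod.smul_fst, Prod.smul_snd,
        Pi.add_apply, Pi.smul_apply, smul_eq_mul, Matrix.sub_apply, Matrix.add_apply,
        Matrix.smul_apply, hA, hH, hP]
      field_simp
      ring
    rw [this]
    simp
  rw [(homC2_Gf ε).second_line hM _ key h4]
  have e0 : A + (0:ℝ) • H - (0:ℝ) ^ 2 • P = A := by simp
  rw [e0]
  refine mul_le_mul_of_nonneg_left ?_ (Real.exp_pos _).le
  have := sq_nonneg (p1 0)
  linarith

end GDef

section Moments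
variable {n : ℕ} {ν : Measure (Fin n → ℝ)} {R κ : ℝ}

lemma cs_int [IsProbabilityMeasure ν] (hν : ∀ᵐ x ∂ν, ‖x‖ ≤ R) {u v : (Fin n → ℝ) → ℝ}
    (hu : Continuous u) (hv : Continuous v) :
    (∫ x, u x * v x ∂ν) ^ 2 ≤ (∫ x, u x ^ 2 ∂ν) * ∫ x, v x ^ 2 ∂ν := by
  have iu : Integrable (fun x => u x ^ 2) ν := integrable_cont hν (hu.pow 2)
  have iv : Integrable (fun x => v x ^ 2) ν := integrable_cont hν (hv.pow 2)
  have iuv : Integrable (fun x => u x * v x) ν := integrable_cont hν (hu.mul hv)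
  have key : ∀ t : ℝ, 0 ≤ (∫ x, v x ^ 2 ∂ν) * (t * t) + (2 * ∫ x, u x * v x ∂ν) * t +
      ∫ x, u x ^ 2 ∂ν := by
    intro t
    have h0 : 0 ≤ ∫ x, (u x + t * v x) ^ 2 ∂ν := integral_nonneg fun x => sq_nonneg _
    have e : ∀ x, (u x + t * v x) ^ 2 = (t * t) * v x ^ 2 + (2 * t) * (u x * v x) + u x ^ 2 :=
      fun x => by ring
    simp_rw [e] at h0
    have i12 : Integrable (fun x => (t * t) * v x ^ 2 + (2 * t) * (u x * v x)) ν :=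
      (iv.const_mul _).add (iuv.const_mul _)
    rw [integral_add i12 iu,
      integral_add (iv.const_mul _) (iuv.const_mul _), integral_const_mul, integral_const_mul] at h0
    linarith
  have := discrim_le_zero key
  unfold discrim at this
  nlinarith

lemma psd_factor {A : Matrix (Fin n) (Fin n) ℝ} (h : A.PosSemidef) :
    ∃ Q : Matrix (Fin n) (Fin n) ℝ, A = Q.transpose * Q := by
  obtain ⟨Q, hQ⟩ := by
    classical
    open scoped MatrixOrder in
    exact CStarAlgebra.nonneg_iff_eq_star_mul_self.mp h.nonneg
  exact ⟨Q, hQ⟩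

/-- second moment matrix -/
noncomputable def mom2 (ν : Measure (Fin n → ℝ)) : Matrix (Fin n) (Fin n) ℝ :=
  Matrix.of fun i j => ∫ y, y i * y j ∂ν

noncomputable def mom3 (ν : Measure (Fin n → ℝ)) (k : Fin n) : Matrix (Fin n) (Fin n) ℝ :=
  Matrix.of fun i j => ∫ y, y k * (y i * y j) ∂ν

lemma sum_int [IsProbabilityMeasure ν] (hν : ∀ᵐ x ∂ν, ‖x‖ ≤ R) {φ : (Fin n → ℝ) → ℝ}
    (hφ : Continuous φ) (Y : Matrix (Fin n) (Fin n) ℝ) :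
    ∑ i, ∑ j, Y i j * ∫ y, φ y * (y i * y j) ∂ν = ∫ y, φ y * (y ⬝ᵥ Y.mulVec y) ∂ν := by
  simp_rw [← integral_const_mul]
  have : ∀ i j, Integrable (fun y : Fin n → ℝ => Y i j * (φ y * (y i * y j))) ν := fun i j =>
    integrable_cont hν (by fun_prop)
  simp_rw [← fun i => integral_finsetSum (μ := ν) Finset.univ fun j _ => this i j]
  rw [← integral_finsetSum _ fun i _ => integrable_finsetSum _ fun j _ => this i j]
  congr 1; ext y
  simp only [dotProduct, Matrix.mulVec, Finset.mul_sum]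
  refine Finset.sum_congr rfl fun i _ => Finset.sum_congr rfl fun j _ => by ring

lemma mom2_symm : (mom2 ν).transpose = mom2 ν := by
  ext i j; simp [mom2, mul_comm]

lemma mom3_symm (k : Fin n) : (mom3 ν k).transpose = mom3 ν k := by
  ext i j
  simp only [mom3, Matrix.transpose_apply, Matrix.of_apply]
  congr 1; ext y; ring

lemma mom2_quad [IsProbabilityMeasure ν] (hν : ∀ᵐ x ∂ν, ‖x‖ ≤ R) (θ : Fin n → ℝ) :
    ∫ y, (θ ⬝ᵥ y) ^ 2 ∂ν = θ ⬝ᵥ (mom2 ν).mulVec θ := by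
  have h := sum_int hν (continuous_const (y := (1:ℝ))) (Matrix.of fun i j => θ i * θ j)
  simp only [one_mul, Matrix.of_apply] at h
  have e : ∀ y : Fin n → ℝ, y ⬝ᵥ (Matrix.of fun i j => θ i * θ j).mulVec y = (θ ⬝ᵥ y) ^ 2 := by
    intro y
    simp only [dotProduct, Matrix.mulVec, Matrix.of_apply, sq, Finset.sum_mul, Finset.mul_sum]
    refine Finset.sum_congr rfl fun i _ => Finset.sum_congr rfl fun j _ => by ring
  simp_rw [e] at h
  rw [← h]
  simp only [dotProduct, Matrix.mulVec, mom2, Matrix.of_apply, Finset.mul_sum]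
  refine Finset.sum_congr rfl fun i _ => Finset.sum_congr rfl fun j _ => by ring

lemma mom3_quad [IsProbabilityMeasure ν] (hν : ∀ᵐ x ∂ν, ‖x‖ ≤ R) (k : Fin n) (θ : Fin n → ℝ) :
    ∫ y, y k * (θ ⬝ᵥ y) ^ 2 ∂ν = θ ⬝ᵥ (mom3 ν k).mulVec θ := by
  have h := sum_int hν (continuous_apply k) (Matrix.of fun i j => θ i * θ j)
  simp only [Matrix.of_apply] at h
  have e : ∀ y : Fin n → ℝ, y ⬝ᵥ (Matrix.of fun i j => θ i * θ j).mulVec y = (θ ⬝ᵥ y) ^ 2 := by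
    intro y
    simp only [dotProduct, Matrix.mulVec, Matrix.of_apply, sq, Finset.sum_mul, Finset.mul_sum]
    refine Finset.sum_congr rfl fun i _ => Finset.sum_congr rfl fun j _ => by ring
  simp_rw [e] at h
  rw [← h]
  simp only [dotProduct, Matrix.mulVec, mom3, Matrix.of_apply, Finset.mul_sum]
  refine Finset.sum_congr rfl fun i _ => Finset.sum_congr rfl fun j _ => by ring

lemma mom2_psd [IsProbabilityMeasure ν] (hν : ∀ᵐ x ∂ν, ‖x‖ ≤ R) : (mom2 ν).PosSemidef := by
  refine Matrix.PosSemidef.of_dotProduct_mulVec_nonneg ?_ fun θ => ?_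
  · rw [Matrix.IsHermitian, Matrix.conjTranspose_eq_transpose_of_trivial, mom2_symm]
  · rw [star_trivial, ← mom2_quad hν]
    exact integral_nonneg fun y => sq_nonneg _

lemma int_quad [IsProbabilityMeasure ν] (hν : ∀ᵐ x ∂ν, ‖x‖ ≤ R) (Y : Matrix (Fin n) (Fin n) ℝ) :
    ∫ y, y ⬝ᵥ Y.mulVec y ∂ν = (Y * mom2 ν).trace := by
  have h := sum_int hν (continuous_const (y := (1:ℝ))) Y
  simp only [one_mul] at h
  rw [← h]
  simp only [Matrix.trace, Matrix.diag, Matrix.mul_apply, mom2, Matrix.of_apply]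
  refine Finset.sum_congr rfl fun i _ => Finset.sum_congr rfl fun j _ => ?_
  congr 2; ext y; ring

lemma continuous_dot (θ : Fin n → ℝ) : Continuous fun y : Fin n → ℝ => θ ⬝ᵥ y := by
  unfold dotProduct; fun_prop

lemma continuous_quad (Y : Matrix (Fin n) (Fin n) ℝ) :
    Continuous fun y : Fin n → ℝ => y ⬝ᵥ Y.mulVec y := by
  unfold dotProduct Matrix.mulVec dotProduct; fun_prop

lemma quad4 [IsProbabilityMeasure ν] (hν : ∀ᵐ x ∂ν, ‖x‖ ≤ R) (hκ : 0 ≤ κ)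
    (hk : ∀ θ : Fin n → ℝ, ∫ y, (θ ⬝ᵥ y) ^ 4 ∂ν ≤ κ * (∫ y, (θ ⬝ᵥ y) ^ 2 ∂ν) ^ 2)
    (L : Matrix (Fin n) (Fin n) ℝ) :
    ∫ y, (L.mulVec y ⬝ᵥ L.mulVec y) ^ 2 ∂ν ≤ κ * ((L.transpose * L) * mom2 ν).trace ^ 2 := by
  have c : ∀ r, Continuous fun y : Fin n → ℝ => (L r ⬝ᵥ y) ^ 2 := fun r => (continuous_dot _).pow 2
  set σ : Fin n → ℝ := fun r => ∫ y, (L r ⬝ᵥ y) ^ 2 ∂ν with hσ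
  have σ0 : ∀ r, 0 ≤ σ r := fun r => integral_nonneg fun y => sq_nonneg _
  have e1 : ∀ y : Fin n → ℝ, (L.mulVec y ⬝ᵥ L.mulVec y) ^ 2 =
      ∑ r, ∑ q, (L r ⬝ᵥ y) ^ 2 * (L q ⬝ᵥ y) ^ 2 := by
    intro y
    have : L.mulVec y ⬝ᵥ L.mulVec y = ∑ r, (L r ⬝ᵥ y) ^ 2 := by
      simp only [dotProduct, Matrix.mulVec, sq]
    rw [this, sq, Finset.sum_mul_sum]
  have tr : ((L.transpose * L) * mom2 ν).trace = ∑ r, σ r := by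
    rw [← int_quad hν, hσ, ← integral_finsetSum _ fun r _ => integrable_cont hν (c r)]
    congr 1; ext y
    rw [← Matrix.mulVec_mulVec, Matrix.dotProduct_mulVec, Matrix.vecMul_transpose]
    simp only [dotProduct, Matrix.mulVec, sq]
  have i2 : ∀ r q, Integrable (fun y => (L r ⬝ᵥ y) ^ 2 * (L q ⬝ᵥ y) ^ 2) ν := fun r q =>
    integrable_cont hν ((c r).mul (c q))
  have b : ∀ r q, ∫ y, (L r ⬝ᵥ y) ^ 2 * (L q ⬝ᵥ y) ^ 2 ∂ν ≤ κ * (σ r * σ q) := by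
    intro r q
    have h := cs_int hν (c r) (c q)
    simp_rw [← pow_mul] at h
    norm_num at h
    have h2 : (∫ y, (L r ⬝ᵥ y) ^ 2 * (L q ⬝ᵥ y) ^ 2 ∂ν) ^ 2 ≤ (κ * (σ r * σ q)) ^ 2 := by
      refine h.trans ?_
      calc _ ≤ (κ * σ r ^ 2) * (κ * σ q ^ 2) :=
            mul_le_mul (hk _) (hk _) (integral_nonneg fun y => by positivity) (by positivity)
        _ = _ := by ring
    exact (le_abs_self _).trans (abs_le_of_sq_le_sq h2 (by have := σ0 r; have := σ0 q; positivity))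
  simp_rw [e1]
  rw [integral_finsetSum _ fun r _ => integrable_finsetSum _ fun q _ => i2 r q]
  simp_rw [fun r => integral_finsetSum (μ := ν) Finset.univ fun q _ => i2 r q]
  calc _ ≤ ∑ r, ∑ q, κ * (σ r * σ q) :=
        Finset.sum_le_sum fun r _ => Finset.sum_le_sum fun q _ => b r q
    _ = κ * (∑ r, σ r) ^ 2 := by
        rw [sq, Finset.sum_mul_sum, Finset.mul_sum]
        exact Finset.sum_congr rfl fun r _ => by rw [Finset.mul_sum]
    _ = _ := by rw [tr]

lemma third_bound [IsProbabilityMeasure ν] (hν : ∀ᵐ x ∂ν, ‖x‖ ≤ R) (hκ : 0 ≤ κ)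
    (hk : ∀ θ : Fin n → ℝ, ∫ y, (θ ⬝ᵥ y) ^ 4 ∂ν ≤ κ * (∫ y, (θ ⬝ᵥ y) ^ 2 ∂ν) ^ 2)
    (M : Matrix (Fin n) (Fin n) ℝ) (hM : M.transpose = M) :
    ∑ k, (M * mom3 ν k * M * mom3 ν k).trace ≤
      κ * (M * mom2 ν * M * mom2 ν).trace * √((mom2 ν * mom2 ν).trace) := by
  set A := mom2 ν with hA
  have psd : A.PosSemidef := mom2_psd hν
  obtain ⟨Q, hQ⟩ := psd_factor psd
  -- inner function
  set I : (Fin n → ℝ) → ℝ := fun y =>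
    ∑ k, y k * (M.mulVec y ⬝ᵥ (mom3 ν k).mulVec (M.mulVec y)) with hI
  have cMy : Continuous fun y : Fin n → ℝ => M.mulVec y := by
    unfold Matrix.mulVec dotProduct; fun_prop
  have cterm : ∀ k, Continuous fun y : Fin n → ℝ =>
      y k * (M.mulVec y ⬝ᵥ (mom3 ν k).mulVec (M.mulVec y)) := fun k =>
    (continuous_apply k).mul ((continuous_quad (mom3 ν k)).comp cMy)
  have quadM : ∀ (Y : Matrix (Fin n) (Fin n) ℝ) (y : Fin n → ℝ),
      M.mulVec y ⬝ᵥ Y.mulVec (M.mulVec y) = y ⬝ᵥ (M * Y * M).mulVec y := by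
    intro Y y
    conv_rhs => rw [← Matrix.mulVec_mulVec, ← Matrix.mulVec_mulVec, Matrix.dotProduct_mulVec,
      ← hM, Matrix.vecMul_transpose]
    rw [hM]
  have s1 : ∑ k, (M * mom3 ν k * M * mom3 ν k).trace = ∫ y, I y ∂ν := by
    rw [hI, integral_finsetSum _ fun k _ => integrable_cont hν (cterm k)]
    refine Finset.sum_congr rfl fun k _ => ?_
    simp_rw [quadM]
    rw [← sum_int hν (continuous_apply k)]
    simp only [Matrix.trace, Matrix.diag]
    refine Finset.sum_congr rfl fun i _ => ?_
    rw [Matrix.mul_apply]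
    refine Finset.sum_congr rfl fun j _ => ?_
    have := congrFun (congrFun (mom3_symm (ν := ν) k) i) j
    rw [Matrix.transpose_apply] at this
    rw [this]; rfl
  have s2 : ∀ y, I y = ∫ z, (y ⬝ᵥ z) * (M.mulVec y ⬝ᵥ z) ^ 2 ∂ν := by
    intro y
    have e : I y = ∑ k, ∫ z, y k * (z k * (M.mulVec y ⬝ᵥ z) ^ 2) ∂ν := by
      simp only [hI]
      refine Finset.sum_congr rfl fun k _ => ?_
      rw [← mom3_quad hν, ← integral_const_mul]
    rw [e, ← integral_finsetSum]
    · congr 1; ext z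
      simp only [dotProduct, Finset.sum_mul]
      exact Finset.sum_congr rfl fun k _ => by ring
    · intro k _
      apply integrable_cont hν
      have := continuous_dot (M.mulVec y)
      fun_prop
  have nn1 : ∀ y, 0 ≤ y ⬝ᵥ A.mulVec y := fun y => by
    rw [hA, ← mom2_quad hν]; exact integral_nonneg fun _ => sq_nonneg _
  have s3 : ∀ y, I y ≤ √κ * (√(y ⬝ᵥ A.mulVec y) * (M.mulVec y ⬝ᵥ A.mulVec (M.mulVec y))) := by
    intro y
    rw [s2]
    have h := cs_int (v := fun z => (M.mulVec y ⬝ᵥ z) ^ 2) hν (continuous_dot y)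
      ((continuous_dot (M.mulVec y)).pow 2)
    simp_rw [← pow_mul] at h
    norm_num at h
    have h3 := hk (M.mulVec y)
    rw [mom2_quad hν, ← hA] at h3
    rw [mom2_quad hν, ← hA] at h
    have h2 : (∫ z, (y ⬝ᵥ z) * (M.mulVec y ⬝ᵥ z) ^ 2 ∂ν) ^ 2 ≤
        (√κ * (√(y ⬝ᵥ A.mulVec y) * (M.mulVec y ⬝ᵥ A.mulVec (M.mulVec y)))) ^ 2 := by
      rw [mul_pow, mul_pow, Real.sq_sqrt hκ, Real.sq_sqrt (nn1 y)]
      refine h.trans ((mul_le_mul_of_nonneg_left h3 (nn1 y)).trans (le_of_eq (by ring)))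
    exact (le_abs_self _).trans (abs_le_of_sq_le_sq h2 (by have := nn1 (M.mulVec y); positivity))
  have cA : Continuous fun y : Fin n → ℝ => √(y ⬝ᵥ A.mulVec y) := (continuous_quad A).sqrt
  have cMA : Continuous fun y : Fin n → ℝ => M.mulVec y ⬝ᵥ A.mulVec (M.mulVec y) :=
    (continuous_quad A).comp cMy
  have s4 : ∫ y, I y ∂ν ≤ √κ * ∫ y, √(y ⬝ᵥ A.mulVec y) * (M.mulVec y ⬝ᵥ A.mulVec (M.mulVec y)) ∂ν := by
    rw [← integral_const_mul]
    refine integral_mono (integrable_cont hν (continuous_finsetSum _ fun k _ => cterm k)) ?_ s3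
    exact (integrable_cont hν (cA.mul cMA)).const_mul _
  have eqtr : ((Q * M).transpose * (Q * M) * A).trace = (M * A * M * A).trace := by
    rw [Matrix.transpose_mul, hM]
    congr 1
    rw [hQ]; simp only [Matrix.mul_assoc]
  have s5 : ∫ y, (M.mulVec y ⬝ᵥ A.mulVec (M.mulVec y)) ^ 2 ∂ν ≤ κ * (M * A * M * A).trace ^ 2 := by
    have := quad4 hν hκ hk (Q * M)
    rw [← hA, eqtr] at this
    convert this using 4 with y
    rw [hQ, ← Matrix.mulVec_mulVec, Matrix.dotProduct_mulVec, Matrix.vecMul_transpose,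
      Matrix.mulVec_mulVec]
  have trnn : 0 ≤ (M * A * M * A).trace := by
    rw [← eqtr, hA, ← int_quad hν]
    refine integral_nonneg fun y => ?_
    show 0 ≤ y ⬝ᵥ ((Q * M).transpose * (Q * M)).mulVec y
    rw [← Matrix.mulVec_mulVec, Matrix.dotProduct_mulVec, Matrix.vecMul_transpose]
    exact dot_self_nonneg' _
  have s6 := cs_int hν cA cMA
  have s7 : ∫ y, √(y ⬝ᵥ A.mulVec y) ^ 2 ∂ν = (A * A).trace := by
    rw [hA, ← int_quad hν]
    congr 1; ext y
    exact Real.sq_sqrt (nn1 y)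
  have tr2 : 0 ≤ (A * A).trace := by rw [← s7]; exact integral_nonneg fun y => sq_nonneg _
  have s8 : ∫ y, √(y ⬝ᵥ A.mulVec y) * (M.mulVec y ⬝ᵥ A.mulVec (M.mulVec y)) ∂ν ≤
      √κ * ((M * A * M * A).trace * √((A * A).trace)) := by
    refine (le_abs_self _).trans (abs_le_of_sq_le_sq ?_ (by positivity))
    rw [mul_pow, mul_pow, Real.sq_sqrt hκ, Real.sq_sqrt tr2]
    refine s6.trans ?_
    rw [s7]
    exact (mul_le_mul_of_nonneg_left s5 tr2).trans (le_of_eq (by ring))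
  rw [s1]
  refine s4.trans ((mul_le_mul_of_nonneg_left s8 (Real.sqrt_nonneg _)).trans (le_of_eq ?_))
  rw [← mul_assoc, Real.mul_self_sqrt hκ]; ring

end Moments

section Drift
variable {n : ℕ} {ν : Measure (Fin n → ℝ)} {R κ : ℝ}

lemma log_det_le {B : Matrix (Fin n) (Fin n) ℝ} (hB : B.PosDef) :
    Real.log B.det ≤ B.trace - n := by
  have h1 := hB.isHermitian.det_eq_prod_eigenvalues
  have h2 := hB.isHermitian.trace_eq_sum_eigenvalues
  simp only [RCLike.ofReal_real_eq_id, id_eq] at h1 h2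
  rw [h1, h2, Real.log_prod (fun i _ => (hB.eigenvalues_pos i).ne')]
  have : (n : ℝ) = ∑ _i : Fin n, (1:ℝ) := by simp
  rw [this, ← Finset.sum_sub_distrib]
  exact Finset.sum_le_sum fun i _ => Real.log_le_sub_one_of_pos (hB.eigenvalues_pos i)

lemma posDef_add_eps {A : Matrix (Fin n) (Fin n) ℝ} (hA : A.PosSemidef) {ε : ℝ} (hε : 0 < ε) :
    (A + ε • (1 : Matrix (Fin n) (Fin n) ℝ)).PosDef :=
  (Matrix.PosDef.one.smul hε).posSemidef_add hA

lemma trace_sq_le (A : Matrix (Fin n) (Fin n) ℝ) (hA : A.transpose = A) :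
    A.trace ^ 2 ≤ n * (A * A).trace := by
  have h1 : A.trace ^ 2 ≤ n * ∑ i, A i i ^ 2 := by
    have := sq_sum_le_card_mul_sum_sq (s := (Finset.univ : Finset (Fin n))) (f := fun i => A i i)
    simpa [Matrix.trace, Matrix.diag] using this
  refine h1.trans (mul_le_mul_of_nonneg_left ?_ (Nat.cast_nonneg _))
  simp only [Matrix.trace, Matrix.diag, Matrix.mul_apply]
  refine Finset.sum_le_sum fun i _ => ?_
  have : ∀ j, A i j * A j i = A i j ^ 2 := fun j => by
    rw [← congrFun (congrFun hA i) j, Matrix.transpose_apply, sq]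
  simp_rw [this]
  exact Finset.single_le_sum (f := fun j => A i j ^ 2) (fun j _ => sq_nonneg _) (Finset.mem_univ i)

lemma rho_bound {ρ : ℝ} (h : 0 ≤ ρ) : (ρ + ρ ^ 3) * exp (ρ - ρ ^ 2) ≤ 4 * exp (1 / 2) := by
  have h1 : ρ + ρ ^ 3 ≤ 4 * exp (ρ ^ 2 / 2) := by
    have := Real.quadratic_le_exp_of_nonneg (show 0 ≤ ρ ^ 2 / 2 by positivity)
    nlinarith [sq_nonneg (ρ - 1), sq_nonneg (ρ ^ 2 - ρ), sq_nonneg ρ]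
  calc (ρ + ρ ^ 3) * exp (ρ - ρ ^ 2) ≤ 4 * exp (ρ ^ 2 / 2) * exp (1 / 2 - ρ ^ 2 / 2) := by
        refine mul_le_mul h1 (exp_le_exp.2 ?_) (exp_pos _).le (by positivity)
        nlinarith [sq_nonneg (1 - ρ)]
    _ = _ := by rw [mul_assoc, ← exp_add]; ring_nf

lemma drift_matrix [IsProbabilityMeasure ν] (hn : 1 ≤ n) (hν : ∀ᵐ x ∂ν, ‖x‖ ≤ R) (hκ : 1 ≤ κ)
    (hk : ∀ θ : Fin n → ℝ, ∫ y, (θ ⬝ᵥ y) ^ 4 ∂ν ≤ κ * (∫ y, (θ ⬝ᵥ y) ^ 2 ∂ν) ^ 2)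
    {ε : ℝ} (hε : 0 < ε) (hε1 : ε ≤ 1) (A : Matrix (Fin n) (Fin n) ℝ) (hA : A = mom2 ν)
    (P : Fin n → Matrix (Fin n) (Fin n) ℝ) (hP : ∀ k i j, P k i j = A k i * A k j) :
    -(12 * κ * exp (1 / 2)) * √n ≤ ∑ k, exp (psiF ε A) *
      ((-((A + ε • 1)⁻¹ * mom3 ν k * (A + ε • 1)⁻¹ * mom3 ν k).trace
        - 2 * ((A + ε • 1)⁻¹ * P k).trace - 2 * (mom3 ν k * mom3 ν k).trace
        + 4 * (A * P k).trace) / n) := by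
  have psd : A.PosSemidef := hA ▸ mom2_psd hν
  have Asym : A.transpose = A := hA ▸ mom2_symm
  have pd := posDef_add_eps psd hε
  set N := (A + ε • (1 : Matrix (Fin n) (Fin n) ℝ))⁻¹ with hN
  have pdN : N.PosDef := pd.inv
  have Nsym : N.transpose = N := by
    have := pdN.isHermitian
    rwa [Matrix.IsHermitian, Matrix.conjTranspose_eq_transpose_of_trivial] at this
  have hu : IsUnit (A + ε • (1 : Matrix (Fin n) (Fin n) ℝ)).det :=
    (Matrix.isUnit_iff_isUnit_det _).1 pd.isUnit
  have NA : N * A = 1 - ε • N := by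
    have := Matrix.nonsing_inv_mul _ hu
    rw [← hN, Matrix.mul_add, Matrix.mul_smul, Matrix.mul_one] at this
    rw [← this]; abel
  have trNA : 0 ≤ (N * A).trace := by
    rw [hA, ← int_quad hν]
    refine integral_nonneg fun y => ?_
    simpa using pdN.posSemidef.dotProduct_mulVec_nonneg y
  have trNA_le : (N * A).trace ≤ n := by
    rw [NA, Matrix.trace_sub, Matrix.trace_one, Matrix.trace_smul, smul_eq_mul, Fintype.card_fin]
    have := mul_nonneg hε.le pdN.posSemidef.trace_nonneg
    linarith
  have trNNA : 0 ≤ (N * N * A).trace := by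
    rw [hA, ← int_quad hν]
    refine integral_nonneg fun y => ?_
    show 0 ≤ y ⬝ᵥ (N * N).mulVec y
    rw [← Matrix.mulVec_mulVec, Matrix.dotProduct_mulVec]
    nth_rewrite 1 [← Nsym]
    rw [Matrix.vecMul_transpose]
    exact dot_self_nonneg' _
  have b1 : (N * A * N * A).trace ≤ n := by
    have : N * A * N * A = N * A - ε • (N * N * A) := by
      rw [NA, Matrix.sub_mul, Matrix.sub_mul, Matrix.one_mul, NA, Matrix.smul_mul, Matrix.smul_mul]
    rw [this, Matrix.trace_sub, Matrix.trace_smul, smul_eq_mul]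
    have := mul_nonneg hε.le trNNA
    linarith
  have b2 : (N * (A * A)).trace ≤ A.trace := by
    have : N * (A * A) = A - ε • (N * A) := by
      rw [← Matrix.mul_assoc, NA, Matrix.sub_mul, Matrix.one_mul, Matrix.smul_mul, ← NA]
    rw [this, Matrix.trace_sub, Matrix.trace_smul, smul_eq_mul]
    have := mul_nonneg hε.le trNA
    linarith
  have n0 : (1:ℝ) ≤ n := by exact_mod_cast hn
  have T0 : 0 ≤ (A * A).trace := by
    rw [hA, ← int_quad hν, ← hA]
    refine integral_nonneg fun y => ?_
    simpa using psd.dotProduct_mulVec_nonneg y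
  set ρ := √((A * A).trace / n) with hρ
  have ρ0 : 0 ≤ ρ := Real.sqrt_nonneg _
  have hT : (A * A).trace = n * ρ ^ 2 := by
    rw [hρ, Real.sq_sqrt (by positivity)]; field_simp
  have sn := Real.sq_sqrt (show (0:ℝ) ≤ n by positivity)
  have sn1 : 1 ≤ √(n:ℝ) := Real.one_le_sqrt.2 n0
  have hsT : √((A * A).trace) = √n * ρ := by
    rw [hT, Real.sqrt_mul (by positivity), Real.sqrt_sq ρ0]
  have hAt : A.trace ≤ n * ρ := by
    refine (le_abs_self _).trans (abs_le_of_sq_le_sq ?_ (by positivity))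
    refine (trace_sq_le A Asym).trans (le_of_eq ?_)
    rw [hT]; ring
  have t1 := third_bound hν (by linarith) hk N Nsym
  have t2 := third_bound hν (by linarith) hk 1 Matrix.transpose_one
  simp only [Matrix.one_mul, Matrix.mul_one] at t2
  rw [← hA, hsT] at t1 t2
  rw [hT] at t2
  have t1' : ∑ k, (N * mom3 ν k * N * mom3 ν k).trace ≤ κ * n * (√n * ρ) := by
    refine t1.trans ?_
    gcongr
  have t3 : ∑ k, (N * P k).trace ≤ n * ρ := by
    have : ∑ k, (N * P k).trace = (N * (A * A)).trace := by
      rw [← Matrix.trace_sum, ← Matrix.mul_sum]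
      congr 2
      ext i j
      rw [Matrix.sum_apply, Matrix.mul_apply]
      refine Finset.sum_congr rfl fun k _ => ?_
      rw [hP, ← congrFun (congrFun Asym i) k, Matrix.transpose_apply]
    rw [this]; linarith
  have t4 : 0 ≤ ∑ k, (A * P k).trace := by
    refine Finset.sum_nonneg fun k _ => ?_
    have h0 : 0 ≤ A k ⬝ᵥ A.mulVec (A k) := by
      simpa using psd.dotProduct_mulVec_nonneg (A k)
    refine h0.trans (le_of_eq ?_)
    simp only [Matrix.trace, Matrix.diag, Matrix.mul_apply, dotProduct, Matrix.mulVec,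
      Finset.mul_sum, hP]
    exact Finset.sum_congr rfl fun i _ => Finset.sum_congr rfl fun j _ => by ring
  have psi_le : psiF ε A ≤ ρ - ρ ^ 2 := by
    have h1 := log_det_le pd
    rw [Matrix.trace_add, Matrix.trace_smul, Matrix.trace_one, Fintype.card_fin, smul_eq_mul] at h1
    unfold psiF
    rw [div_le_iff₀ (by positivity), hT]
    nlinarith
  have main := mul_le_mul_of_nonneg_left (rho_bound ρ0) (show 0 ≤ 3 * κ * √n by positivity)
  have eψ : exp (psiF ε A) ≤ exp (ρ - ρ ^ 2) := exp_le_exp.2 psi_le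
  rw [← Finset.mul_sum, ← Finset.sum_div, Finset.sum_add_distrib, Finset.sum_sub_distrib,
    Finset.sum_sub_distrib, Finset.sum_neg_distrib, ← Finset.mul_sum, ← Finset.mul_sum,
    ← Finset.mul_sum]
  have lower : -(3 * κ * √n * (ρ + ρ ^ 3)) ≤
      (-∑ k, (N * mom3 ν k * N * mom3 ν k).trace - 2 * ∑ k, (N * P k).trace
        - 2 * ∑ k, (mom3 ν k * mom3 ν k).trace + 4 * ∑ k, (A * P k).trace) / n := by
    rw [le_div_iff₀ (by positivity)]
    have h5 : n * ρ ≤ κ * n * (√n * ρ) := by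
      have : 1 ≤ κ * √n := one_le_mul_of_one_le_of_one_le hκ sn1
      have h6 : 0 ≤ n * ρ := by positivity
      nlinarith
    have h7 : 0 ≤ κ * n * (√n * ρ ^ 3) := by positivity
    nlinarith
  calc -(12 * κ * exp (1 / 2)) * √n ≤ -(3 * κ * √n * ((ρ + ρ ^ 3) * exp (ρ - ρ ^ 2))) := by
        linarith
    _ ≤ -(3 * κ * √n * ((ρ + ρ ^ 3) * exp (psiF ε A))) := by
        gcongr
    _ = exp (psiF ε A) * -(3 * κ * √n * (ρ + ρ ^ 3)) := by ring
    _ ≤ _ := mul_le_mul_of_nonneg_left lower (exp_pos _).le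

/-- Bochner version of the kurtosis bound. -/
lemma TailLC.kurt_int [IsProbabilityMeasure ν] (h : TailLC ν) (hν : ∀ᵐ x ∂ν, ‖x‖ ≤ R)
    (θ : Fin n → ℝ) (c : ℝ) :
    ∫ x, (θ ⬝ᵥ x - c) ^ 4 ∂ν ≤ kurtC * (∫ x, (θ ⬝ᵥ x - c) ^ 2 ∂ν) ^ 2 := by
  have hc := (continuous_dot θ).sub (continuous_const (y := c))
  have i4 : Integrable (fun x => (θ ⬝ᵥ x - c) ^ 4) ν := integrable_cont hν (hc.pow 4)
  have i2 : Integrable (fun x => (θ ⬝ᵥ x - c) ^ 2) ν := integrable_cont hν (hc.pow 2)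
  have := h.kurt θ c
  have k0 : 0 ≤ kurtC := by linarith [kurtC_ge]
  rw [← ofReal_integral_eq_lintegral_ofReal i4 (ae_of_all _ fun x => by positivity),
    ← ofReal_integral_eq_lintegral_ofReal i2 (ae_of_all _ fun x => by positivity),
    ← ENNReal.ofReal_pow (integral_nonneg fun x => by positivity), ← ENNReal.ofReal_mul k0] at this
  exact (ENNReal.ofReal_le_ofReal_iff (by positivity)).1 this

lemma drift [IsProbabilityMeasure ν] (hn : 1 ≤ n) (hν : ∀ᵐ x ∂ν, ‖x‖ ≤ R) (hT : TailLC ν)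
    {ε : ℝ} (hε : 0 < ε) (hε1 : ε ≤ 1) :
    -(12 * kurtC * exp (1 / 2)) * √n ≤ ∑ k, fderiv ℝ (fderiv ℝ (Gf ε)) (∫ x, Psi x ∂ν)
      (∫ x, x k • Psi x ∂ν) (∫ x, x k • Psi x ∂ν) := by
  set a : Fin n → ℝ := ∫ x, x ∂ν with ha
  set B : Fin n → Fin n → ℝ := fun i j => ∫ x, x i * x j ∂ν with hB
  have iid : Integrable (fun x : Fin n → ℝ => x) ν := integrable_cont hν continuous_id
  have ai : ∀ i, a i = ∫ x, x i ∂ν := fun i => by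
    rw [ha]; exact eval_integral (fun j => integrable_cont hν (continuous_apply j)) i
  have pint : ∀ φ : (Fin n → ℝ) → ℝ, Continuous φ → ∫ x, φ x • Psi x ∂ν =
      (∫ x, φ x ∂ν, fun i => ∫ x, φ x * x i ∂ν, fun i j => ∫ x, φ x * (x i * x j) ∂ν) := by
    intro φ hφ
    have i1 : Integrable (fun x => φ x) ν := integrable_cont hν hφ
    have i2 : Integrable (fun x : Fin n → ℝ => φ x • x) ν := integrable_cont hν (by fun_prop)
    have i3 : Integrable (fun x : Fin n → ℝ => (fun i j => φ x * (x i * x j) : Fin n → Fin n → ℝ)) ν :=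
      integrable_cont hν (by fun_prop)
    have e : ∀ x : Fin n → ℝ, φ x • Psi x = (φ x, φ x • x, fun i j => φ x * (x i * x j)) := by
      intro x; simp only [Psi, Prod.smul_mk, smul_eq_mul, mul_one]; rfl
    simp_rw [e]
    rw [integral_pair i1 (i2.prodMk i3), integral_pair i2 i3]
    refine Prod.ext rfl (Prod.ext ?_ ?_)
    · ext i
      exact eval_integral (f := fun x : Fin n → ℝ => φ x • x)
        (fun j => integrable_cont hν (by simp only [Pi.smul_apply, smul_eq_mul]; fun_prop)) i
    · ext i j
      have := eval_integral (μ := ν) (f := fun x : Fin n → ℝ => (fun i j => φ x * (x i * x j) : Fin n → Fin n → ℝ))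
        (fun j => integrable_cont hν (by fun_prop)) i
      have h2 := eval_integral (μ := ν) (f := fun x : Fin n → ℝ => (fun j => φ x * (x i * x j) : Fin n → ℝ))
        (fun j => integrable_cont hν (by fun_prop)) j
      exact (congrFun this j).trans h2
  have q0 : ∫ x, Psi x ∂ν = ((1, a, B) : EE n) := by
    have := pint (fun _ => 1) continuous_const
    simp only [one_smul, one_mul, integral_const, probReal_univ, smul_eq_mul] at this
    rw [this]
    refine Prod.ext rfl (Prod.ext ?_ rfl)
    ext i; exact (ai i).symm
  set ν' := ν.map (fun x => x - a) with hν'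
  have hm : Measurable fun x : Fin n → ℝ => x - a := by fun_prop
  have : IsProbabilityMeasure ν' := Measure.isProbabilityMeasure_map hm.aemeasurable
  have hbd : ∀ᵐ y ∂ν', ‖y‖ ≤ R + ‖a‖ := by
    rw [hν', ae_map_iff hm.aemeasurable (measurableSet_le (by fun_prop) (by fun_prop))]
    filter_upwards [hν] with x hx
    exact (norm_sub_le _ _).trans (by linarith)
  have im : ∀ φ : (Fin n → ℝ) → ℝ, Continuous φ → ∫ y, φ y ∂ν' = ∫ x, φ (x - a) ∂ν := fun φ hφ =>
    integral_map hm.aemeasurable hφ.aestronglyMeasurable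
  have hk : ∀ θ : Fin n → ℝ, ∫ y, (θ ⬝ᵥ y) ^ 4 ∂ν' ≤ kurtC * (∫ y, (θ ⬝ᵥ y) ^ 2 ∂ν') ^ 2 := by
    intro θ
    rw [im (fun y => (θ ⬝ᵥ y) ^ 4) ((continuous_dot θ).pow 4),
      im (fun y => (θ ⬝ᵥ y) ^ 2) ((continuous_dot θ).pow 2)]
    simp only [dotProduct_sub]
    exact hT.kurt_int hν θ _
  have ii : ∀ i, Integrable (fun x : Fin n → ℝ => x i) ν := fun i => integrable_cont hν (by fun_prop)
  have iij : ∀ i j, Integrable (fun x : Fin n → ℝ => x i * x j) ν := fun i j =>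
    integrable_cont hν (by fun_prop)
  have iijk : ∀ k i j, Integrable (fun x : Fin n → ℝ => x k * (x i * x j)) ν := fun k i j =>
    integrable_cont hν (by fun_prop)
  have hA : ∀ i j, mom2 ν' i j = B i j - a i * a j := by
    intro i j
    rw [mom2, Matrix.of_apply, im (fun y => y i * y j) (by fun_prop)]
    have e : ∀ x : Fin n → ℝ, (x - a) i * (x - a) j =
        x i * x j - a j * x i - a i * x j + a i * a j := fun x => by
      simp only [Pi.sub_apply]; ring
    simp_rw [e]
    have j1 : Integrable (fun x : Fin n → ℝ => x i * x j - a j * x i) ν :=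
      (iij i j).sub ((ii i).const_mul _)
    have j2 : Integrable (fun x : Fin n → ℝ => x i * x j - a j * x i - a i * x j) ν :=
      j1.sub ((ii j).const_mul _)
    rw [integral_add j2 (integrable_const _), integral_sub j1 ((ii j).const_mul _),
      integral_sub (iij i j) ((ii i).const_mul _), integral_const_mul, integral_const_mul,
      ← ai, ← ai, integral_const, probReal_univ, smul_eq_mul]
    simp only [hB]; ring
  have hH : ∀ k i j, mom3 ν' k i j = (∫ x, x k * (x i * x j) ∂ν) - a k * B i j
      - a i * (B k j - a k * a j) - a j * (B k i - a k * a i) := by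
    intro k i j
    rw [mom3, Matrix.of_apply, im (fun y => y k * (y i * y j)) (by fun_prop)]
    have e : ∀ x : Fin n → ℝ, (x - a) k * ((x - a) i * (x - a) j) =
        x k * (x i * x j) - a k * (x i * x j) - a i * (x k * x j) - a j * (x k * x i)
        + a k * a i * x j + a k * a j * x i + a i * a j * x k - a k * a i * a j := fun x => by
      simp only [Pi.sub_apply]; ring
    simp_rw [e]
    have j1 : Integrable (fun x : Fin n → ℝ => x k * (x i * x j) - a k * (x i * x j)) ν :=
      (iijk k i j).sub ((iij i j).const_mul _)
    have j2 : Integrable (fun x : Fin n → ℝ => x k * (x i * x j) - a k * (x i * x j)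
        - a i * (x k * x j)) ν := j1.sub ((iij k j).const_mul _)
    have j3 : Integrable (fun x : Fin n → ℝ => x k * (x i * x j) - a k * (x i * x j)
        - a i * (x k * x j) - a j * (x k * x i)) ν := j2.sub ((iij k i).const_mul _)
    have j4 : Integrable (fun x : Fin n → ℝ => x k * (x i * x j) - a k * (x i * x j)
        - a i * (x k * x j) - a j * (x k * x i) + a k * a i * x j) ν := j3.add ((ii j).const_mul _)
    have j5 : Integrable (fun x : Fin n → ℝ => x k * (x i * x j) - a k * (x i * x j)
        - a i * (x k * x j) - a j * (x k * x i) + a k * a i * x j + a k * a j * x i) ν :=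
      j4.add ((ii i).const_mul _)
    have j6 : Integrable (fun x : Fin n → ℝ => x k * (x i * x j) - a k * (x i * x j)
        - a i * (x k * x j) - a j * (x k * x i) + a k * a i * x j + a k * a j * x i
        + a i * a j * x k) ν := j5.add ((ii k).const_mul _)
    rw [integral_sub j6 (integrable_const _), integral_add j5 ((ii k).const_mul _),
      integral_add j4 ((ii i).const_mul _), integral_add j3 ((ii j).const_mul _),
      integral_sub j2 ((iij k i).const_mul _), integral_sub j1 ((iij k j).const_mul _),
      integral_sub (iijk k i j) ((iij i j).const_mul _)]
    simp only [integral_const_mul, ← ai, integral_const, probReal_univ, smul_eq_mul, hB]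
    ring
  have psd : (mom2 ν').PosSemidef := mom2_psd hbd
  have key := drift_matrix hn hbd (by linarith [kurtC_ge]) hk hε hε1 (mom2 ν') rfl
    (fun k => Matrix.of fun i j => mom2 ν' k i * mom2 ν' k j) (fun k i j => rfl)
  refine key.trans (Finset.sum_le_sum fun k _ => ?_)
  rw [q0, pint (fun x => x k) (continuous_apply k), ← ai]
  exact Gf_second ε a B (a k) (fun i => B k i) (fun i j => ∫ x, x k * (x i * x j) ∂ν) (mom2 ν')
    (mom3 ν' k) _ hA (hH k) (fun i j => by simp only [Matrix.of_apply, hA])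
    (posDef_add_eps psd hε).det_pos

end Drift

section Tilt
variable {n : ℕ} {ν μ : Measure (Fin n → ℝ)} {R : ℝ}

lemma mean_apply [IsProbabilityMeasure ν] (hν : ∀ᵐ x ∂ν, ‖x‖ ≤ R) (i : Fin n) :
    (∫ x, x ∂ν) i = ∫ x, x i ∂ν :=
  eval_integral (fun j => integrable_cont hν (continuous_apply j)) i

lemma Psi_int [IsProbabilityMeasure ν] (hν : ∀ᵐ x ∂ν, ‖x‖ ≤ R) :
    ∫ x, Psi x ∂ν = ((1, ∫ x, x ∂ν, fun i j => mom2 ν i j) : EE n) := by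
  have i1 : Integrable (fun _ : Fin n → ℝ => (1:ℝ)) ν := integrable_const _
  have i2 : Integrable (fun x : Fin n → ℝ => x) ν := integrable_cont hν (by fun_prop)
  have i3 : Integrable (fun x : Fin n → ℝ => (fun i j => x i * x j : Fin n → Fin n → ℝ)) ν :=
    integrable_cont hν (by fun_prop)
  unfold Psi
  rw [integral_pair i1 (i2.prodMk i3), integral_pair i2 i3]
  refine Prod.ext (by simp) (Prod.ext rfl ?_)
  ext i j
  have := eval_integral (μ := ν) (f := fun x : Fin n → ℝ => (fun i j => x i * x j : Fin n → Fin n → ℝ))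
    (fun j => integrable_cont hν (by fun_prop)) i
  have h2 := eval_integral (μ := ν) (f := fun x : Fin n → ℝ => (fun j => x i * x j : Fin n → ℝ))
    (fun j => integrable_cont hν (by fun_prop)) j
  exact (congrFun this j).trans h2

/-- covariance matrix -/
noncomputable def cov (ν : Measure (Fin n → ℝ)) : Matrix (Fin n) (Fin n) ℝ := covM (∫ x, Psi x ∂ν)

lemma cov_apply [IsProbabilityMeasure ν] (hν : ∀ᵐ x ∂ν, ‖x‖ ≤ R) (i j : Fin n) :
    cov ν i j = mom2 ν i j - (∫ x, x ∂ν) i * (∫ x, x ∂ν) j := by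
  rw [cov, Psi_int hν]; simp [covM]

lemma mean_dot [IsProbabilityMeasure ν] (hν : ∀ᵐ x ∂ν, ‖x‖ ≤ R) (θ : Fin n → ℝ) :
    ∫ x, θ ⬝ᵥ x ∂ν = θ ⬝ᵥ ∫ x, x ∂ν := by
  simp only [dotProduct]
  rw [integral_finsetSum _ fun i _ => integrable_cont hν (by fun_prop)]
  refine Finset.sum_congr rfl fun i _ => ?_
  rw [integral_const_mul, mean_apply hν]

lemma sq_shift [IsProbabilityMeasure ν] (hν : ∀ᵐ x ∂ν, ‖x‖ ≤ R) (θ : Fin n → ℝ) (c : ℝ) :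
    ∫ x, (θ ⬝ᵥ x - c) ^ 2 ∂ν = ∫ x, (θ ⬝ᵥ x) ^ 2 ∂ν - 2 * c * (θ ⬝ᵥ ∫ x, x ∂ν) + c ^ 2 := by
  have e : ∀ x : Fin n → ℝ, (θ ⬝ᵥ x - c) ^ 2 = (θ ⬝ᵥ x) ^ 2 - 2 * c * (θ ⬝ᵥ x) + c ^ 2 :=
    fun x => by ring
  simp_rw [e]
  have i1 : Integrable (fun x => (θ ⬝ᵥ x) ^ 2) ν := integrable_cont hν ((continuous_dot θ).pow 2)
  have i2 : Integrable (fun x => 2 * c * (θ ⬝ᵥ x)) ν :=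
    integrable_cont hν (continuous_const.mul (continuous_dot θ))
  have i3 : Integrable (fun x => (θ ⬝ᵥ x) ^ 2 - 2 * c * (θ ⬝ᵥ x)) ν := i1.sub i2
  rw [integral_add i3 (integrable_const _), integral_sub i1 i2, integral_const_mul, mean_dot hν]
  simp

lemma cov_quad [IsProbabilityMeasure ν] (hν : ∀ᵐ x ∂ν, ‖x‖ ≤ R) (θ : Fin n → ℝ) :
    θ ⬝ᵥ (cov ν).mulVec θ = ∫ x, (θ ⬝ᵥ x - θ ⬝ᵥ ∫ x, x ∂ν) ^ 2 ∂ν := by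
  rw [sq_shift hν, mom2_quad hν]
  have : cov ν = mom2 ν - Matrix.vecMulVec (∫ x, x ∂ν) (∫ x, x ∂ν) := by
    ext i j; rw [cov_apply hν]; simp [Matrix.vecMulVec]
  rw [this, Matrix.sub_mulVec, dotProduct_sub, Matrix.vecMulVec_mulVec]
  simp only [dotProduct_smul, MulOpposite.smul_eq_mul_unop, MulOpposite.unop_op]
  rw [dotProduct_comm (∫ x, x ∂ν) θ]; ring

lemma cov_symm [IsProbabilityMeasure ν] (hν : ∀ᵐ x ∂ν, ‖x‖ ≤ R) : (cov ν).transpose = cov ν := by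
  ext i j
  rw [Matrix.transpose_apply, cov_apply hν, cov_apply hν, ← congrFun (congrFun (mom2_symm (ν := ν)) i) j,
    Matrix.transpose_apply]
  ring

lemma cov_psd [IsProbabilityMeasure ν] (hν : ∀ᵐ x ∂ν, ‖x‖ ≤ R) : (cov ν).PosSemidef := by
  refine Matrix.PosSemidef.of_dotProduct_mulVec_nonneg ?_ fun θ => ?_
  · rw [Matrix.IsHermitian, Matrix.conjTranspose_eq_transpose_of_trivial, cov_symm hν]
  · rw [star_trivial, cov_quad hν]
    exact integral_nonneg fun y => sq_nonneg _

/-- the compact set of normalised moments -/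
def KK (n : ℕ) (C : ℝ) : Set (EE n) :=
  {M | M.1 = 1 ∧ ‖M‖ ≤ C ∧ (∀ i j, M.2.2 i j = M.2.2 j i) ∧
    ∀ θ : Fin n → ℝ, 0 ≤ ∑ i, ∑ j, θ i * ((M.2.2 i j - M.2.1 i * M.2.1 j) * θ j)}

lemma KK_compact (C : ℝ) : IsCompact (KK n C) := by
  refine Metric.isCompact_of_isClosed_isBounded ?_ ?_
  · have c1 : IsClosed {M : EE n | M.1 = 1} := isClosed_eq (by fun_prop) (by fun_prop)
    have c2 : IsClosed {M : EE n | ‖M‖ ≤ C} := isClosed_le (by fun_prop) (by fun_prop)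
    refine IsClosed.inter c1 (IsClosed.inter c2 (IsClosed.inter ?_ ?_))
    · have : {M : EE n | ∀ i j, M.2.2 i j = M.2.2 j i} = ⋂ i, ⋂ j, {M : EE n | M.2.2 i j = M.2.2 j i} := by
        ext M; simp
      show IsClosed {M : EE n | ∀ i j, M.2.2 i j = M.2.2 j i}
      rw [this]
      exact isClosed_iInter fun i => isClosed_iInter fun j => isClosed_eq (by fun_prop) (by fun_prop)
    · show IsClosed {M : EE n | ∀ θ : Fin n → ℝ,
        0 ≤ ∑ i, ∑ j, θ i * ((M.2.2 i j - M.2.1 i * M.2.1 j) * θ j)}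
      have : {M : EE n | ∀ θ : Fin n → ℝ,
        0 ≤ ∑ i, ∑ j, θ i * ((M.2.2 i j - M.2.1 i * M.2.1 j) * θ j)} = ⋂ θ : Fin n → ℝ,
        {M : EE n | 0 ≤ ∑ i, ∑ j, θ i * ((M.2.2 i j - M.2.1 i * M.2.1 j) * θ j)} := by
        ext M; simp
      rw [this]
      exact isClosed_iInter fun θ => isClosed_le (by fun_prop) (by fun_prop)
  · refine (Metric.isBounded_closedBall (x := (0 : EE n)) (r := C)).subset fun M hM => ?_
    have : ‖M‖ ≤ C := hM.2.1
    simpa using this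

lemma KK_sub_Om (C : ℝ) {ε : ℝ} (hε : 0 < ε) : KK n C ⊆ Om n ε := by
  rintro M ⟨h1, -, h3, h4⟩
  refine ⟨by rw [h1]; exact one_pos, ?_⟩
  have : (covM M).PosSemidef := by
    refine Matrix.PosSemidef.of_dotProduct_mulVec_nonneg ?_ fun θ => ?_
    · rw [Matrix.IsHermitian, Matrix.conjTranspose_eq_transpose_of_trivial]
      ext i j
      simp only [covM, Matrix.transpose_apply, Matrix.of_apply, h3 j i]; ring
    · refine (h4 θ).trans (le_of_eq ?_)
      simp only [covM, star_trivial, dotProduct, Matrix.mulVec, Matrix.of_apply, Finset.mul_sum, h1,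
        div_one, one_pow]
  exact (posDef_add_eps this hε).det_pos

lemma int_mem_KK (R : ℝ) : ∃ C, ∀ ν : Measure (Fin n → ℝ), IsProbabilityMeasure ν →
    (∀ᵐ x ∂ν, ‖x‖ ≤ R) → ∫ x, Psi x ∂ν ∈ KK n C := by
  obtain ⟨C, hC⟩ := (isCompact_closedBall (0 : Fin n → ℝ) R).exists_bound_of_continuousOn
    (continuous_Psi (n := n)).continuousOn
  refine ⟨C, fun ν _ hν => ⟨?_, ?_, ?_, ?_⟩⟩
  · rw [Psi_int hν]
  · have := norm_integral_le_of_norm_le_const (μ := ν) (f := Psi) (C := C) (by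
      filter_upwards [hν] with x hx using hC x (by simpa using hx))
    simpa using this
  · intro i j
    rw [Psi_int hν]
    exact congrFun (congrFun (mom2_symm (ν := ν)) j) i
  · intro θ
    have := (cov_psd hν).dotProduct_mulVec_nonneg θ
    refine this.trans (le_of_eq ?_)
    simp only [star_trivial, dotProduct, Matrix.mulVec, Finset.mul_sum, cov_apply hν, Psi_int hν]

/-- tilted measure -/
noncomputable def nuT (μ : Measure (Fin n → ℝ)) (s : ℝ) (g : Fin n → ℝ) : Measure (Fin n → ℝ) :=
  μ.tilted fun x => s * (g ⬝ᵥ x) - s ^ 2 / 2 * (x ⬝ᵥ x)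

lemma nuT_int {E : Type*} [NormedAddCommGroup E] [NormedSpace ℝ E] (Ξ : (Fin n → ℝ) → E) (s : ℝ)
    (g : Fin n → ℝ) :
    ∫ x, Ξ x ∂(nuT μ s g) = (Jm μ (fun _ => (1:ℝ)) s g)⁻¹ • Jm μ Ξ s g := by
  rw [nuT, integral_tilted, Jm, Jm, ← integral_smul]
  simp only [gw, smul_eq_mul, mul_one, smul_smul]
  congr 1; ext x; congr 1; rw [div_eq_inv_mul]

lemma nuT_prob [IsProbabilityMeasure μ] (hμ : ∀ᵐ x ∂μ, ‖x‖ ≤ R) (s : ℝ) (g : Fin n → ℝ) :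
    IsProbabilityMeasure (nuT μ s g) := by
  apply isProbabilityMeasure_tilted
  simpa [gw] using Jm_integrable hμ (continuous_const (y := (1:ℝ))) s g

lemma nuT_ae (hμ : ∀ᵐ x ∂μ, ‖x‖ ≤ R) (s : ℝ) (g : Fin n → ℝ) :
    ∀ᵐ x ∂(nuT μ s g), ‖x‖ ≤ R := (tilted_absolutelyContinuous μ _).ae_le hμ

lemma homC2_fst : HomC2 (Prod.fst : EE n → ℝ) Set.univ where
  opn := isOpen_univ
  smooth := contDiff_fst.contDiffOn
  cone := fun _ _ _ _ => trivial
  hom := fun M _ c _ => rfl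

lemma Jm_fst [IsProbabilityMeasure μ] (hμ : ∀ᵐ x ∂μ, ‖x‖ ≤ R) (s : ℝ) (g : Fin n → ℝ) :
    (Jm μ Psi s g).1 = Jm μ (fun _ => (1:ℝ)) s g := by
  have hi := Jm_integrable hμ continuous_Psi s g
  have := (ContinuousLinearMap.fst ℝ ℝ ((Fin n → ℝ) × (Fin n → Fin n → ℝ))).integral_comp_comm hi
  exact this.symm

lemma Z_total [IsProbabilityMeasure μ] (hR : 0 ≤ R) (hμ : ∀ᵐ x ∂μ, ‖x‖ ≤ R) (s : ℝ) :
    Integrable (fun g => gphi g * Jm μ (fun _ => (1:ℝ)) s g) ∧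
    ∫ g, gphi g * Jm μ (fun _ => (1:ℝ)) s g = 1 := by
  obtain ⟨C, hC⟩ := int_mem_KK (n := n) R
  have ev := evolution hR hμ continuous_Psi homC2_fst (KK_compact C) (Set.subset_univ _)
    (fun s g => by rw [← nuT_int]; exact hC _ (nuT_prob hμ s g) (nuT_ae hμ s g))
  simp only [Jm_fst hμ] at ev
  refine ⟨(ev s).1, ?_⟩
  have e : fderiv ℝ (fderiv ℝ (Prod.fst : EE n → ℝ)) = 0 := by
    have : fderiv ℝ (Prod.fst : EE n → ℝ) = fun _ => ContinuousLinearMap.fst ℝ _ _ := by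
      ext1 M; exact fderiv_fst
    rw [this]; ext1 M; simp
  have d : ∀ s, HasDerivAt (fun s => ∫ g, gphi g * Jm μ (fun _ => (1:ℝ)) s g) 0 s := by
    intro s
    have := (ev s).2.2
    simp only [e] at this
    simpa using this
  have c := is_const_of_deriv_eq_zero (fun s => (d s).differentiableAt) (fun s => (d s).deriv) s 0
  rw [c]
  have : ∀ g, Jm μ (fun _ => (1:ℝ)) 0 g = 1 := fun g => by simp [Jm, gw]
  simp_rw [this, mul_one]
  exact integral_gphi

/-- the main localization estimate -/
lemma main_lower [IsProbabilityMeasure μ] (hn : 1 ≤ n) (hR : 0 ≤ R) (hμ : ∀ᵐ x ∂μ, ‖x‖ ≤ R)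
    (hT : ∀ s g, TailLC (nuT μ s g)) {ε : ℝ} (hε : 0 < ε) (hε1 : ε ≤ 1) {s : ℝ} (hs : 0 ≤ s) :
    Integrable (fun g => gphi g * (Jm μ (fun _ => (1:ℝ)) s g * exp (psiF ε (cov (nuT μ s g))))) ∧
    exp (psiF ε (cov μ)) - 12 * kurtC * exp (1 / 2) * √n * (s ^ 2 / 2) ≤
      ∫ g, gphi g * (Jm μ (fun _ => (1:ℝ)) s g * exp (psiF ε (cov (nuT μ s g)))) := by
  obtain ⟨C, hC⟩ := int_mem_KK (n := n) R
  set Cd := 12 * kurtC * exp (1 / 2) with hCd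
  have Zp : ∀ s g, 0 < Jm μ (fun _ => (1:ℝ)) s g := fun s g => Jm_one_pos hμ s g
  have hJK : ∀ s g, (Jm μ (fun _ => (1:ℝ)) s g)⁻¹ • Jm μ Psi s g ∈ KK n C := fun s g => by
    rw [← nuT_int]; exact hC _ (nuT_prob hμ s g) (nuT_ae hμ s g)
  have ev := evolution hR hμ continuous_Psi (homC2_Gf ε) (KK_compact C) (KK_sub_Om C hε) hJK
  have Jeq : ∀ (Ξ : (Fin n → ℝ) → EE n) s g, Jm μ Ξ s g =
      Jm μ (fun _ => (1:ℝ)) s g • ∫ x, Ξ x ∂(nuT μ s g) := fun Ξ s g => by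
    rw [nuT_int, smul_smul, mul_inv_cancel₀ (Zp s g).ne', one_smul]
  have Geq : ∀ s g, Gf ε (Jm μ Psi s g) =
      Jm μ (fun _ => (1:ℝ)) s g * exp (psiF ε (cov (nuT μ s g))) := by
    intro s g
    rw [Gf, Jm_fst hμ, cov, nuT_int, covM_smul _ (inv_ne_zero (Zp s g).ne')]
  have Dlow : ∀ s g, -Cd * √n * Jm μ (fun _ => (1:ℝ)) s g ≤
      ∑ k, fderiv ℝ (fderiv ℝ (Gf ε)) (Jm μ Psi s g)
        (Jm μ (fun x => x k • Psi x) s g) (Jm μ (fun x => x k • Psi x) s g) := by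
    intro s g
    have := nuT_prob hμ s g
    have d := drift hn (nuT_ae hμ s g) (hT s g) hε hε1
    have hm : ∫ x, Psi x ∂(nuT μ s g) ∈ Om n ε := by
      rw [nuT_int]; exact KK_sub_Om C hε (hJK s g)
    simp_rw [Jeq]
    rw [(homC2_Gf ε).fderiv2_smul hm (Zp s g)]
    simp only [_root_.smul_apply, map_smul, smul_eq_mul]
    have z := (Zp s g).ne'
    calc _ ≤ (∑ k, fderiv ℝ (fderiv ℝ (Gf ε)) (∫ x, Psi x ∂(nuT μ s g))
          (∫ x, x k • Psi x ∂(nuT μ s g)) (∫ x, x k • Psi x ∂(nuT μ s g))) *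
            Jm μ (fun _ => (1:ℝ)) s g := mul_le_mul_of_nonneg_right d (Zp s g).le
      _ = _ := by
        rw [Finset.sum_mul]
        refine Finset.sum_congr rfl fun k _ => ?_
        field_simp
  set m : ℝ → ℝ := fun s => ∫ g, gphi g * Gf ε (Jm μ Psi s g) with hm
  have dlow : ∀ s, 0 ≤ s → -Cd * √n * s ≤ deriv m s := by
    intro s hs
    rw [(ev s).2.2.deriv]
    have h1 : -Cd * √n ≤ ∫ g, gphi g * ∑ k, fderiv ℝ (fderiv ℝ (Gf ε)) (Jm μ Psi s g)
        (Jm μ (fun x => x k • Psi x) s g) (Jm μ (fun x => x k • Psi x) s g) := by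
      have hz := Z_total hR hμ s
      calc -Cd * √n = ∫ g, -Cd * √n * (gphi g * Jm μ (fun _ => (1:ℝ)) s g) := by
            rw [integral_const_mul, hz.2, mul_one]
        _ ≤ _ := by
          refine integral_mono (hz.1.const_mul _) (ev s).2.1 fun g => ?_
          have := mul_le_mul_of_nonneg_left (Dlow s g) (gphi_pos g).le
          refine le_trans (le_of_eq ?_) this
          show -Cd * √n * (gphi g * Jm μ (fun _ => (1:ℝ)) s g) = _
          ring
    nlinarith
  have mono : MonotoneOn (fun s => m s + Cd * √n * (s ^ 2 / 2)) (Set.Ici 0) := by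
    have hd : ∀ s, HasDerivAt (fun s => m s + Cd * √n * (s ^ 2 / 2)) (deriv m s + Cd * √n * s) s := by
      intro s
      have h2 : HasDerivAt (fun s : ℝ => Cd * √n * (s ^ 2 / 2)) (Cd * √n * s) s := by
        have := ((hasDerivAt_pow 2 s).div_const 2).const_mul (Cd * √n)
        exact this.congr_deriv (by norm_num)
      have h3 := (ev s).2.2
      have h4 : HasDerivAt m (deriv m s) s := h3.differentiableAt.hasDerivAt
      exact h4.add h2
    refine monotoneOn_of_deriv_nonneg (convex_Ici 0)
      (fun s _ => (hd s).continuousAt.continuousWithinAt)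
      (fun s _ => (hd s).differentiableAt.differentiableWithinAt) fun s hs => ?_
    rw [(hd s).deriv]
    rw [interior_Ici] at hs
    have : 0 < s := hs
    have := dlow s this.le
    linarith
  have fin := mono (Set.mem_Ici.2 le_rfl) (Set.mem_Ici.2 hs) hs
  simp only [hm] at fin
  have m0 : ∫ g, gphi g * Gf ε (Jm μ Psi 0 g) = exp (psiF ε (cov μ)) := by
    have : ∀ g, Gf ε (Jm μ Psi 0 g) = exp (psiF ε (cov μ)) := by
      intro g
      rw [Geq]
      have e1 : Jm μ (fun _ => (1:ℝ)) 0 g = 1 := by simp [Jm, gw]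
      have e2 : nuT μ 0 g = μ := by
        unfold nuT; simp
      rw [e1, e2, one_mul]
    simp_rw [this]
    rw [integral_mul_const, integral_gphi, one_mul]
  rw [m0] at fin
  simp_rw [Geq] at fin
  refine ⟨by simpa only [Geq] using (ev s).1, ?_⟩
  norm_num at fin
  linarith

end Tilt

section Vol
variable {n : ℕ} {μ : Measure (Fin n → ℝ)} {R : ℝ}

lemma eig_quad {B : Matrix (Fin n) (Fin n) ℝ} (hB : B.IsHermitian) (i : Fin n) :
    ∃ v : Fin n → ℝ, v ⬝ᵥ v = 1 ∧ hB.eigenvalues i = v ⬝ᵥ B.mulVec v := by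
  refine ⟨(hB.eigenvectorBasis i).ofLp, ?_, ?_⟩
  · have h1 : inner ℝ (hB.eigenvectorBasis i) (hB.eigenvectorBasis i) = (1:ℝ) := by
      rw [real_inner_self_eq_norm_sq, hB.eigenvectorBasis.norm_eq_one]; norm_num
    rw [EuclideanSpace.inner_eq_star_dotProduct] at h1
    simpa using h1
  · have := hB.eigenvalues_eq i
    simpa using this

lemma det_lower {B : Matrix (Fin n) (Fin n) ℝ} (hB : B.IsHermitian) {c : ℝ} (hc : 0 ≤ c)
    (h : ∀ θ : Fin n → ℝ, c * (θ ⬝ᵥ θ) ≤ θ ⬝ᵥ B.mulVec θ) : c ^ n ≤ B.det := by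
  rw [hB.det_eq_prod_eigenvalues]
  have : c ^ n = ∏ _i : Fin n, c := by simp
  rw [this]
  refine Finset.prod_le_prod (fun _ _ => hc) fun i _ => ?_
  obtain ⟨v, h1, h2⟩ := eig_quad hB i
  show c ≤ hB.eigenvalues i
  rw [h2]
  have := h v
  rwa [h1, mul_one] at this

lemma trace_sq_upper {A : Matrix (Fin n) (Fin n) ℝ} (hA : A.PosSemidef)
    (h : ∀ θ : Fin n → ℝ, θ ⬝ᵥ A.mulVec θ ≤ 2 * (θ ⬝ᵥ θ)) : (A * A).trace ≤ 4 * n := by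
  obtain ⟨Q, hQ⟩ := psd_factor hA
  have h1 : (A * A).trace = ∑ r, Q r ⬝ᵥ A.mulVec (Q r) := by
    nth_rewrite 1 [hQ]
    rw [Matrix.mul_assoc, Matrix.trace_mul_comm]
    simp only [Matrix.trace, Matrix.diag]
    refine Finset.sum_congr rfl fun r _ => ?_
    rw [Matrix.mul_assoc]
    simp only [Matrix.mul_apply, Matrix.mulVec, dotProduct, Matrix.transpose_apply]
  have h2 : A.trace = ∑ r, Q r ⬝ᵥ Q r := by
    rw [hQ, Matrix.trace_mul_comm]
    simp only [Matrix.trace, Matrix.diag, Matrix.mul_apply, dotProduct, Matrix.transpose_apply]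
  have h3 : A.trace ≤ 2 * n := by
    have : ∀ i, A i i ≤ 2 := fun i => by
      have := h (Pi.single i 1)
      simpa using this
    calc A.trace ≤ ∑ _i : Fin n, (2:ℝ) := Finset.sum_le_sum fun i _ => this i
      _ = 2 * n := by simp [mul_comm]
  calc (A * A).trace ≤ ∑ r, 2 * (Q r ⬝ᵥ Q r) := by
        rw [h1]; exact Finset.sum_le_sum fun r _ => h _
    _ = 2 * A.trace := by rw [h2, Finset.mul_sum]
    _ ≤ _ := by linarith

lemma psi_init (hn : 1 ≤ n) {A : Matrix (Fin n) (Fin n) ℝ} (hA : A.PosSemidef)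
    (h1 : ∀ θ : Fin n → ℝ, (1/2) * (θ ⬝ᵥ θ) ≤ θ ⬝ᵥ A.mulVec θ)
    (h2 : ∀ θ : Fin n → ℝ, θ ⬝ᵥ A.mulVec θ ≤ 2 * (θ ⬝ᵥ θ)) {ε : ℝ} (hε : 0 < ε) :
    exp (-4) / 2 ≤ exp (psiF ε A) := by
  have n0 : (0:ℝ) < n := by exact_mod_cast hn
  have hd : (1/2 : ℝ) ^ n ≤ (A + ε • (1 : Matrix (Fin n) (Fin n) ℝ)).det := by
    refine det_lower (posDef_add_eps hA hε).isHermitian (by norm_num) fun θ => ?_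
    rw [Matrix.add_mulVec, Matrix.smul_mulVec, Matrix.one_mulVec, dotProduct_add, dotProduct_smul,
      smul_eq_mul]
    have := h1 θ
    have := mul_nonneg hε.le (dot_self_nonneg' θ)
    linarith
  have hl := Real.log_le_log (by positivity) hd
  rw [Real.log_pow] at hl
  have ht := trace_sq_upper hA h2
  have : Real.log (1/2) - 4 ≤ psiF ε A := by
    unfold psiF
    rw [le_div_iff₀ n0]
    nlinarith
  calc exp (-4) / 2 = exp (Real.log (1/2) - 4) := by
        rw [sub_eq_add_neg, exp_add, exp_log (by norm_num)]; ring
    _ ≤ _ := exp_le_exp.2 this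

lemma exp_psi_pow_le (hn : 1 ≤ n) {A : Matrix (Fin n) (Fin n) ℝ} (hA : A.PosSemidef) {ε : ℝ}
    (hε : 0 < ε) : exp (psiF ε A) ^ n ≤ (A + ε • (1 : Matrix (Fin n) (Fin n) ℝ)).det := by
  have n0 : (0:ℝ) < n := by exact_mod_cast hn
  rw [← exp_nat_mul, psiF, mul_div_cancel₀ _ n0.ne']
  have hp := (posDef_add_eps hA hε).det_pos
  rw [← Real.le_log_iff_exp_le hp]
  have : 0 ≤ (A * A).trace := by
    obtain ⟨Q, hQ⟩ := psd_factor hA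
    nth_rewrite 1 [hQ]
    rw [Matrix.mul_assoc, Matrix.trace_mul_comm, Matrix.mul_assoc]
    have := (hA.mul_mul_conjTranspose_same Q).trace_nonneg
    rwa [Matrix.conjTranspose_eq_transpose_of_trivial, Matrix.mul_assoc] at this
  linarith

lemma tangent_pow (n : ℕ) {c x : ℝ} (hc : 0 < c) (hx : 0 ≤ x) :
    c ^ n + n * c ^ n / c * (x - c) ≤ x ^ n := by
  have h := one_add_mul_le_pow (show -2 ≤ x / c - 1 by have := div_nonneg hx hc.le; linarith) n
  have h2 := mul_le_mul_of_nonneg_left h (pow_nonneg hc.le n)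
  rw [← mul_pow] at h2
  have e : c * (1 + (x / c - 1)) = x := by field_simp; ring
  rw [e] at h2
  refine le_trans (le_of_eq ?_) h2
  field_simp

lemma gphi_gw_le (s : ℝ) (g x : Fin n → ℝ) : gphi g * gw s g x ≤ 1 := by
  unfold gphi gw
  rw [mul_assoc, ← exp_add]
  have e : -(g ⬝ᵥ g) / 2 + (s * (g ⬝ᵥ x) - s ^ 2 / 2 * (x ⬝ᵥ x)) =
      -((g - s • x) ⬝ᵥ (g - s • x)) / 2 := by
    simp only [dotProduct_sub, sub_dotProduct, dotProduct_smul, smul_dotProduct, smul_eq_mul]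
    rw [dotProduct_comm x g]; ring
  rw [e]
  refine mul_le_one₀ (pow_le_one₀ (by positivity) ?_) (exp_pos _).le ?_
  · refine inv_le_one_of_one_le₀ (Real.one_le_sqrt.2 ?_)
    nlinarith [pi_gt_three]
  · rw [exp_le_one_iff]
    have := dot_self_nonneg' (g - s • x)
    linarith

lemma gphi_Z_le [IsProbabilityMeasure μ] (hμ : ∀ᵐ x ∂μ, ‖x‖ ≤ R) (s : ℝ) (g : Fin n → ℝ) :
    gphi g * Jm μ (fun _ => (1:ℝ)) s g ≤ 1 := by
  unfold Jm
  rw [← integral_const_mul]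
  have i := (Jm_integrable hμ (continuous_const (y := (1:ℝ))) s g).const_mul (gphi g)
  calc _ ≤ ∫ _x, (1:ℝ) ∂μ := integral_mono i (integrable_const _) fun x => by
        simpa using gphi_gw_le s g x
    _ = 1 := by simp

lemma cov_nuT_cont [IsProbabilityMeasure μ] (hμ : ∀ᵐ x ∂μ, ‖x‖ ≤ R) (s : ℝ) :
    Continuous fun g => cov (nuT μ s g) := by
  have e : ∀ g, cov (nuT μ s g) = covM (Jm μ Psi s g) := fun g => by
    rw [cov, nuT_int, covM_smul _ (inv_ne_zero (Jm_one_pos hμ s g).ne')]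
  simp_rw [e]
  refine continuous_matrix fun i j => continuous_iff_continuousAt.2 fun g => ?_
  have h1 := (covM_entry_contDiffAt (Jm μ Psi s g) (by
    rw [Jm_fst hμ]; exact (Jm_one_pos hμ s g).ne') i j).continuousAt
  exact ContinuousAt.comp (f := fun g => Jm μ Psi s g) h1 (Jm_continuous hμ continuous_Psi s).continuousAt

lemma det_bound (R : ℝ) : ∃ C, ∀ ν : Measure (Fin n → ℝ), IsProbabilityMeasure ν →
    (∀ᵐ x ∂ν, ‖x‖ ≤ R) → ∀ ε ∈ Set.Icc (0:ℝ) 1,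
      |(cov ν + ε • (1 : Matrix (Fin n) (Fin n) ℝ)).det| ≤ C := by
  obtain ⟨C, hC⟩ := int_mem_KK (n := n) R
  have hc : Continuous fun p : EE n × ℝ => ((Matrix.of fun i j => p.1.2.2 i j - p.1.2.1 i * p.1.2.1 j)
      + p.2 • (1 : Matrix (Fin n) (Fin n) ℝ)).det := by
    refine Continuous.matrix_det (Continuous.add ?_ (by fun_prop))
    exact continuous_matrix fun i j => by simp only [Matrix.of_apply]; fun_prop
  obtain ⟨D, hD⟩ := ((KK_compact (n := n) C).prod (isCompact_Icc (a := (0:ℝ)) (b := 1))).exists_bound_of_continuousOn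
    hc.continuousOn
  refine ⟨D, fun ν hp hν ε hε => ?_⟩
  have := hD (∫ x, Psi x ∂ν, ε) ⟨hC ν hp hν, hε⟩
  rw [Real.norm_eq_abs] at this
  convert this using 4
  ext i j
  rw [cov_apply hν, Psi_int hν]; rfl

lemma det_int_lower [IsProbabilityMeasure μ] (hn : 1 ≤ n) (hR : 0 ≤ R) (hμ : ∀ᵐ x ∂μ, ‖x‖ ≤ R)
    (hT : ∀ s g, TailLC (nuT μ s g))
    (h1 : ∀ θ : Fin n → ℝ, (1/2) * (θ ⬝ᵥ θ) ≤ θ ⬝ᵥ (cov μ).mulVec θ)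
    (h2 : ∀ θ : Fin n → ℝ, θ ⬝ᵥ (cov μ).mulVec θ ≤ 2 * (θ ⬝ᵥ θ)) {s : ℝ} (hs : 0 ≤ s)
    (hs2 : 12 * kurtC * exp (1 / 2) * √n * (s ^ 2 / 2) ≤ exp (-4) / 4) :
    Integrable (fun g => gphi g * Jm μ (fun _ => (1:ℝ)) s g * (cov (nuT μ s g)).det) ∧
    (exp (-4) / 4) ^ n ≤ ∫ g, gphi g * Jm μ (fun _ => (1:ℝ)) s g * (cov (nuT μ s g)).det := by
  set Z := fun g => Jm μ (fun _ => (1:ℝ)) s g with hZ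
  set c := exp (-4) / 4 with hc
  have c0 : 0 < c := by positivity
  have Zp : ∀ g, 0 < Z g := fun g => Jm_one_pos hμ s g
  obtain ⟨zi, z1⟩ := Z_total hR hμ s
  obtain ⟨C, hC⟩ := det_bound (n := n) R
  have meas : ∀ ε : ℝ, AEStronglyMeasurable (fun g => gphi g * Z g *
      (cov (nuT μ s g) + ε • (1 : Matrix (Fin n) (Fin n) ℝ)).det) volume := fun ε => by
    refine Continuous.aestronglyMeasurable ?_
    exact (continuous_gphi.mul (Jm_continuous hμ continuous_const s)).mul
      (((cov_nuT_cont hμ s).add continuous_const).matrix_det)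
  have bd : ∀ ε ∈ Set.Icc (0:ℝ) 1, ∀ g, ‖gphi g * Z g *
      (cov (nuT μ s g) + ε • (1 : Matrix (Fin n) (Fin n) ℝ)).det‖ ≤ gphi g * Z g * C := by
    intro ε hε g
    rw [norm_mul, Real.norm_eq_abs, Real.norm_eq_abs, abs_of_pos (mul_pos (gphi_pos g) (Zp g))]
    exact mul_le_mul_of_nonneg_left (hC _ (nuT_prob hμ s g) (nuT_ae hμ s g) ε hε)
      (mul_pos (gphi_pos g) (Zp g)).le
  have ib : ∀ ε ∈ Set.Icc (0:ℝ) 1, Integrable (fun g => gphi g * Z g *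
      (cov (nuT μ s g) + ε • (1 : Matrix (Fin n) (Fin n) ℝ)).det) := fun ε hε =>
    (zi.mul_const C).mono' (meas ε) (ae_of_all _ (bd ε hε))
  have low : ∀ ε : ℝ, 0 < ε → ε ≤ 1 → c ^ n ≤ ∫ g, gphi g * Z g *
      (cov (nuT μ s g) + ε • (1 : Matrix (Fin n) (Fin n) ℝ)).det := by
    intro ε hε hε1
    obtain ⟨mi, ml⟩ := main_lower hn hR hμ hT hε hε1 hs
    have init := psi_init hn (cov_psd hμ) h1 h2 hε
    have ml' : c ≤ ∫ g, gphi g * (Z g * exp (psiF ε (cov (nuT μ s g)))) := by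
      refine le_trans ?_ ml
      rw [hc] at hs2 ⊢; linarith
    have k0 : 0 ≤ n * c ^ n / c := by positivity
    have ii : Integrable (fun g => c ^ n * (gphi g * Z g) + n * c ^ n / c *
        (gphi g * (Z g * exp (psiF ε (cov (nuT μ s g)))) - c * (gphi g * Z g))) :=
      (zi.const_mul _).add ((mi.sub (zi.const_mul _)).const_mul _)
    calc c ^ n ≤ c ^ n * 1 + n * c ^ n / c *
          ((∫ g, gphi g * (Z g * exp (psiF ε (cov (nuT μ s g))))) - c * 1) := by
          have := mul_nonneg k0 (sub_nonneg.2 ml')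
          linarith
      _ = ∫ g, c ^ n * (gphi g * Z g) + n * c ^ n / c *
        (gphi g * (Z g * exp (psiF ε (cov (nuT μ s g)))) - c * (gphi g * Z g)) := by
          have j1 : Integrable (fun g => gphi g * (Z g * exp (psiF ε (cov (nuT μ s g))))
            - c * (gphi g * Z g)) := mi.sub (zi.const_mul _)
          rw [integral_add (zi.const_mul _) (j1.const_mul _), integral_const_mul, integral_const_mul,
            integral_sub mi (zi.const_mul _), integral_const_mul, z1]
      _ ≤ _ := by
          refine integral_mono ii (ib ε ⟨hε.le, hε1⟩) fun g => ?_
          have := nuT_prob hμ s g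
          have t1 := tangent_pow n c0 (exp_pos (psiF ε (cov (nuT μ s g)))).le
          have t2 := t1.trans (exp_psi_pow_le hn (cov_psd (nuT_ae hμ s g)) hε)
          have t3 := mul_le_mul_of_nonneg_left t2 (mul_pos (gphi_pos g) (Zp g)).le
          refine le_trans (le_of_eq ?_) t3
          ring
  have lim : Filter.Tendsto (fun k : ℕ => ∫ g, gphi g * Z g *
      (cov (nuT μ s g) + ((1:ℝ) / (k + 1)) • (1 : Matrix (Fin n) (Fin n) ℝ)).det) Filter.atTop
      (nhds (∫ g, gphi g * Z g * (cov (nuT μ s g) + (0:ℝ) • (1 : Matrix (Fin n) (Fin n) ℝ)).det)) := by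
    refine tendsto_integral_of_dominated_convergence (fun g => gphi g * Z g * C)
      (fun k => meas _) (zi.mul_const C) (fun k => ae_of_all _ (bd _ ⟨by positivity, ?_⟩))
      (ae_of_all _ fun g => ?_)
    · rw [div_le_one (by positivity)]; linarith [(Nat.cast_nonneg k : (0:ℝ) ≤ k)]
    · have hcont : Continuous fun ε : ℝ => gphi g * Z g *
        (cov (nuT μ s g) + ε • (1 : Matrix (Fin n) (Fin n) ℝ)).det := by
        refine continuous_const.mul (Continuous.matrix_det ?_)
        fun_prop
      exact (hcont.tendsto 0).comp tendsto_one_div_add_atTop_nhds_zero_nat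
  have i0 := ib 0 ⟨le_rfl, zero_le_one⟩
  simp only [zero_smul, add_zero] at i0 lim
  refine ⟨i0, ge_of_tendsto' lim fun k => low _ (by positivity) ?_⟩
  rw [div_le_one (by positivity)]; linarith [(Nat.cast_nonneg k : (0:ℝ) ≤ k)]

end Vol

section Vol2
variable {n : ℕ} {μ : Measure (Fin n → ℝ)} {R : ℝ}

lemma cov_nuT_pos [IsProbabilityMeasure μ] (hμ : ∀ᵐ x ∂μ, ‖x‖ ≤ R)
    (h1 : ∀ θ : Fin n → ℝ, (1/2) * (θ ⬝ᵥ θ) ≤ θ ⬝ᵥ (cov μ).mulVec θ) (s : ℝ) (g θ : Fin n → ℝ)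
    (hθ : θ ≠ 0) : 0 < θ ⬝ᵥ (cov (nuT μ s g)).mulVec θ := by
  have hp := nuT_prob hμ s g
  have hae := nuT_ae hμ s g
  rw [cov_quad hae]
  set c := θ ⬝ᵥ ∫ x, x ∂(nuT μ s g)
  refine lt_of_le_of_ne (integral_nonneg fun x => sq_nonneg _) fun h0 => ?_
  have hi : Integrable (fun x => (θ ⬝ᵥ x - c) ^ 2) (nuT μ s g) :=
    integrable_cont hae (((continuous_dot θ).sub continuous_const).pow 2)
  have hz := (integral_eq_zero_iff_of_nonneg (fun x => sq_nonneg _) hi).1 h0.symm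
  have hz' : ∀ᵐ x ∂μ, (θ ⬝ᵥ x - c) ^ 2 = 0 := by
    have ac : μ ≪ nuT μ s g := absolutelyContinuous_tilted (by
      simpa [gw] using Jm_integrable hμ (continuous_const (y := (1:ℝ))) s g)
    exact ac.ae_le hz
  have e : ∫ x, (θ ⬝ᵥ x - c) ^ 2 ∂μ = 0 := by
    rw [integral_congr_ae hz', integral_zero]
  have h2 := h1 θ
  rw [cov_quad hμ, sq_shift hμ] at h2
  rw [sq_shift hμ] at e
  have : 0 < θ ⬝ᵥ θ := lt_of_le_of_ne (dot_self_nonneg' θ) fun h => hθ (dotProduct_self_eq_zero.1 h.symm)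
  nlinarith [sq_nonneg (c - θ ⬝ᵥ ∫ x, x ∂μ)]

/-- barycenter map -/
noncomputable def bary (μ : Measure (Fin n → ℝ)) (s : ℝ) (g : Fin n → ℝ) : Fin n → ℝ :=
  ∫ x, x ∂(nuT μ s g)

lemma bary_hasFDerivAt [IsProbabilityMeasure μ] (hμ : ∀ᵐ x ∂μ, ‖x‖ ≤ R) (s : ℝ) (g : Fin n → ℝ) :
    HasFDerivAt (bary μ s) (s • (Matrix.toLin' (cov (nuT μ s g))).toContinuousLinearMap) g := by
  have Zp := Jm_one_pos hμ s g
  obtain ⟨D1, hD1, e1⟩ := Jm_hasFDerivAt hμ (continuous_const (y := (1:ℝ))) s g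
  obtain ⟨D2, hD2, e2⟩ := Jm_hasFDerivAt hμ (continuous_id (X := Fin n → ℝ)) s g
  have hinv := (hasDerivAt_inv Zp.ne').comp_hasFDerivAt g hD1
  have h := hinv.smul hD2
  have hb : bary μ s = fun g => (Jm μ (fun _ => (1:ℝ)) s g)⁻¹ • Jm μ id s g := by
    ext1 g; rw [bary, nuT_int]; rfl
  rw [hb]
  refine h.congr_fderiv ?_
  ext1 v
  have hp := nuT_prob hμ s g
  have hae := nuT_ae hμ s g
  have c1 : (Jm μ (fun _ => (1:ℝ)) s g)⁻¹ • Jm μ (fun x => (v ⬝ᵥ x) • x) s g =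
      ∫ x, (v ⬝ᵥ x) • x ∂(nuT μ s g) := (nuT_int _ s g).symm
  have c2 : (Jm μ (fun _ => (1:ℝ)) s g)⁻¹ • Jm μ (fun x => (v ⬝ᵥ x) • (1:ℝ)) s g =
      v ⬝ᵥ ∫ x, x ∂(nuT μ s g) := by
    rw [← mean_dot hae, ← nuT_int]; simp
  have c3 : (Jm μ (fun _ => (1:ℝ)) s g)⁻¹ • Jm μ id s g = ∫ x, x ∂(nuT μ s g) :=
    (nuT_int _ s g).symm
  have c4 : (cov (nuT μ s g)).mulVec v = ∫ x, (v ⬝ᵥ x) • x ∂(nuT μ s g) -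
      (v ⬝ᵥ ∫ x, x ∂(nuT μ s g)) • ∫ x, x ∂(nuT μ s g) := by
    have hd := continuous_dot v
    ext i
    have hc : ∀ j, Continuous fun x : Fin n → ℝ => (v ⬝ᵥ x) * x j := fun j => by fun_prop
    have hev : (∫ x, (v ⬝ᵥ x) • x ∂(nuT μ s g)) i = ∫ x, (v ⬝ᵥ x) * x i ∂(nuT μ s g) :=
      eval_integral (f := fun x : Fin n → ℝ => (v ⬝ᵥ x) • x)
        (fun j => integrable_cont hae (hc j)) i
    rw [Pi.sub_apply, hev, Pi.smul_apply, smul_eq_mul]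
    simp only [Matrix.mulVec, dotProduct, cov_apply hae, Finset.sum_mul, sub_mul,
      Finset.sum_sub_distrib]
    rw [integral_finsetSum _ fun j _ => integrable_cont hae (by fun_prop)]
    congr 1
    · refine Finset.sum_congr rfl fun j _ => ?_
      rw [mom2, Matrix.of_apply, ← integral_mul_const]
      congr 1; ext x; ring
    · exact Finset.sum_congr rfl fun j _ => by ring
  simp only [ContinuousLinearMap.add_apply, ContinuousLinearMap.smul_apply,
    ContinuousLinearMap.smulRight_apply, Function.comp_apply, e1, e2,
    LinearMap.coe_toContinuousLinearMap', Matrix.toLin'_apply, c4, id]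
  rw [← c1, ← c2, ← c3]
  set Z := Jm μ (fun _ => (1:ℝ)) s g
  ext i
  simp only [Pi.add_apply, Pi.smul_apply, Pi.sub_apply, smul_eq_mul]
  field_simp
  ring

lemma bary_inj [IsProbabilityMeasure μ] (hμ : ∀ᵐ x ∂μ, ‖x‖ ≤ R)
    (h1 : ∀ θ : Fin n → ℝ, (1/2) * (θ ⬝ᵥ θ) ≤ θ ⬝ᵥ (cov μ).mulVec θ) {s : ℝ} (hs : 0 < s) :
    Function.Injective (bary μ s) := by
  intro g h hgh
  by_contra hne
  set v := h - g with hv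
  have v0 : v ≠ 0 := sub_ne_zero.2 (Ne.symm hne)
  have hd : ∀ t : ℝ, HasDerivAt (fun t : ℝ => dotL v (bary μ s (g + t • v)))
      (s * (v ⬝ᵥ (cov (nuT μ s (g + t • v))).mulVec v)) t := by
    intro t
    have a1 : HasDerivAt (fun t : ℝ => g + t • v) v t := by
      simpa using ((hasDerivAt_id t).smul_const v).const_add g
    have a2 := (bary_hasFDerivAt hμ s (g + t • v)).comp_hasDerivAt t a1
    have a3 := (dotL v).hasFDerivAt.comp_hasDerivAt t a2
    refine a3.congr_deriv ?_
    rw [dotL_apply]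
    simp [dotProduct_comm]
  have sm : StrictMono (fun t : ℝ => dotL v (bary μ s (g + t • v))) :=
    strictMono_of_deriv_pos fun t => by
      rw [(hd t).deriv]
      exact mul_pos hs (cov_nuT_pos hμ h1 s _ v v0)
  have := sm (show (0:ℝ) < 1 by norm_num)
  simp [hv, hgh] at this

lemma vol_lower_aux [IsProbabilityMeasure μ] (hn : 1 ≤ n) (hR : 0 ≤ R) (hμ : ∀ᵐ x ∂μ, ‖x‖ ≤ R)
    (hT : ∀ s g, TailLC (nuT μ s g))
    (h1 : ∀ θ : Fin n → ℝ, (1/2) * (θ ⬝ᵥ θ) ≤ θ ⬝ᵥ (cov μ).mulVec θ)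
    (h2 : ∀ θ : Fin n → ℝ, θ ⬝ᵥ (cov μ).mulVec θ ≤ 2 * (θ ⬝ᵥ θ)) {s : ℝ} (hs : 0 < s)
    (hs2 : 12 * kurtC * exp (1 / 2) * √n * (s ^ 2 / 2) ≤ exp (-4) / 4)
    {K : Set (Fin n → ℝ)} (hK : Convex ℝ K) (hKc : IsClosed K) (hμK : ∀ᵐ x ∂μ, x ∈ K) :
    ENNReal.ofReal ((s * (exp (-4) / 4)) ^ n) ≤ volume K := by
  obtain ⟨i, l⟩ := det_int_lower hn hR hμ hT h1 h2 hs.le hs2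
  have Zp : ∀ g, 0 < Jm μ (fun _ => (1:ℝ)) s g := fun g => Jm_one_pos hμ s g
  have dp : ∀ g, 0 ≤ (cov (nuT μ s g)).det := fun g => by
    have := nuT_prob hμ s g
    exact (cov_psd (nuT_ae hμ s g)).det_nonneg
  have img : bary μ s '' Set.univ ⊆ K := by
    rintro _ ⟨g, -, rfl⟩
    have := nuT_prob hμ s g
    exact hK.integral_mem hKc ((tilted_absolutelyContinuous μ _).ae_le hμK)
      (integrable_cont (nuT_ae hμ s g) continuous_id)
  have cv := lintegral_abs_det_fderiv_eq_addHaar_image volume MeasurableSet.univ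
    (fun g _ => (bary_hasFDerivAt hμ s g).hasFDerivWithinAt) (bary_inj hμ h1 hs).injOn
  have detE : ∀ g, ContinuousLinearMap.det
      (s • (Matrix.toLin' (cov (nuT μ s g))).toContinuousLinearMap) = s ^ n * (cov (nuT μ s g)).det := by
    intro g
    have : (((s • (Matrix.toLin' (cov (nuT μ s g))).toContinuousLinearMap :
        (Fin n → ℝ) →L[ℝ] (Fin n → ℝ))) : (Fin n → ℝ) →ₗ[ℝ] (Fin n → ℝ)) =
        s • Matrix.toLin' (cov (nuT μ s g)) := by ext; simp
    rw [ContinuousLinearMap.det, this, LinearMap.det_smul, LinearMap.det_toLin']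
    simp
  calc ENNReal.ofReal ((s * (exp (-4) / 4)) ^ n)
      = ENNReal.ofReal (s ^ n) * ENNReal.ofReal ((exp (-4) / 4) ^ n) := by
        rw [mul_pow, ENNReal.ofReal_mul (by positivity)]
    _ ≤ ENNReal.ofReal (s ^ n) * ENNReal.ofReal
        (∫ g, gphi g * Jm μ (fun _ => (1:ℝ)) s g * (cov (nuT μ s g)).det) := by gcongr
    _ = ENNReal.ofReal (s ^ n) * ∫⁻ g, ENNReal.ofReal
        (gphi g * Jm μ (fun _ => (1:ℝ)) s g * (cov (nuT μ s g)).det) := by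
        rw [ofReal_integral_eq_lintegral_ofReal i (ae_of_all _ fun g =>
          mul_nonneg (mul_pos (gphi_pos g) (Zp g)).le (dp g))]
    _ ≤ ENNReal.ofReal (s ^ n) * ∫⁻ g, ENNReal.ofReal (cov (nuT μ s g)).det := by
        gcongr with g
        exact mul_le_of_le_one_left (dp g) (gphi_Z_le hμ s g)
    _ = ∫⁻ g, ENNReal.ofReal (s ^ n) * ENNReal.ofReal (cov (nuT μ s g)).det := by
        rw [lintegral_const_mul' _ _ ENNReal.ofReal_ne_top]
    _ = ∫⁻ g in Set.univ, ENNReal.ofReal |ContinuousLinearMap.det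
        (s • (Matrix.toLin' (cov (nuT μ s g))).toContinuousLinearMap)| := by
        rw [Measure.restrict_univ]
        congr 1; ext g
        rw [detE, abs_of_nonneg (mul_nonneg (by positivity) (dp g)), ENNReal.ofReal_mul (by positivity)]
    _ = volume (bary μ s '' Set.univ) := cv
    _ ≤ volume K := measure_mono img

/-- universal constant -/
noncomputable def cvol : ℝ := √(exp (-4) / (24 * kurtC * exp (1 / 2))) * (exp (-4) / 4)

lemma cvol_pos : 0 < cvol := by
  have := kurtC_ge
  have : 0 < kurtC := by linarith
  unfold cvol; positivity

lemma vol_lower [IsProbabilityMeasure μ] (hn : 1 ≤ n) (hR : 0 ≤ R) (hμ : ∀ᵐ x ∂μ, ‖x‖ ≤ R)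
    (hT : ∀ s g, TailLC (nuT μ s g))
    (h1 : ∀ θ : Fin n → ℝ, (1/2) * (θ ⬝ᵥ θ) ≤ θ ⬝ᵥ (cov μ).mulVec θ)
    (h2 : ∀ θ : Fin n → ℝ, θ ⬝ᵥ (cov μ).mulVec θ ≤ 2 * (θ ⬝ᵥ θ))
    {K : Set (Fin n → ℝ)} (hK : Convex ℝ K) (hKc : IsClosed K) (hμK : ∀ᵐ x ∂μ, x ∈ K) :
    ENNReal.ofReal (exp (n * log cvol - n / 4 * log n)) ≤ volume K := by
  have k0 : 0 < kurtC := by linarith [kurtC_ge]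
  have n0 : (0:ℝ) < n := by exact_mod_cast hn
  set b := √(exp (-4) / (24 * kurtC * exp (1 / 2))) with hb
  have b0 : 0 < b := by positivity
  set s := b * exp (-(log n / 4)) with hs
  have s0 : 0 < s := by positivity
  have hsn : √(n:ℝ) * exp (-(log n / 4)) ^ 2 = 1 := by
    rw [Real.sqrt_eq_rpow, Real.rpow_def_of_pos n0, ← exp_nat_mul, ← exp_add]
    rw [exp_eq_one_iff]; push_cast; ring
  have := vol_lower_aux hn hR hμ hT h1 h2 s0 (by
    have : b ^ 2 = exp (-4) / (24 * kurtC * exp (1 / 2)) := Real.sq_sqrt (by positivity)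
    have e : 12 * kurtC * exp (1 / 2) * √n * (s ^ 2 / 2) =
      6 * kurtC * exp (1/2) * b ^ 2 * (√(n:ℝ) * exp (-(log n / 4)) ^ 2) := by rw [hs]; ring
    rw [e, hsn, this]
    apply le_of_eq
    field_simp
    norm_num) hK hKc hμK
  refine le_trans (le_of_eq ?_) this
  congr 1
  have : s * (exp (-4) / 4) = exp (log cvol - log n / 4) := by
    rw [sub_eq_add_neg, exp_add, exp_log cvol_pos, hs, cvol]; ring
  rw [this, ← exp_nat_mul]
  congr 1; ring

end Vol2

section PartL
variable {n : ℕ}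

/-- log-concavity on `Fin n → ℝ`. -/
def LCpi (f : (Fin n → ℝ) → ℝ) : Prop :=
  (∀ x, 0 ≤ f x) ∧ ∀ x y : Fin n → ℝ, ∀ t : ℝ, 0 ≤ t → t ≤ 1 →
    f x ^ t * f y ^ (1 - t) ≤ f (t • x + (1 - t) • y)

lemma LCpi.mid {f : (Fin n → ℝ) → ℝ} (h : LCpi f) (x y : Fin n → ℝ) :
    f x * f y ≤ f ((2⁻¹ : ℝ) • (x + y)) ^ 2 := by
  have := h.2 x y 2⁻¹ (by norm_num) (by norm_num)
  rw [show (1 - 2⁻¹ : ℝ) = 2⁻¹ by norm_num, ← smul_add] at this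
  have h2 : (f x ^ (2⁻¹:ℝ) * f y ^ (2⁻¹:ℝ)) ^ 2 = f x * f y := by
    rw [mul_pow, ← rpow_natCast, ← rpow_mul (h.1 x), ← rpow_natCast, ← rpow_mul (h.1 y)]
    norm_num
  rw [← h2]
  exact pow_le_pow_left₀ (mul_nonneg (rpow_nonneg (h.1 _) _) (rpow_nonneg (h.1 _) _)) this 2

lemma LCpi.convex {f : (Fin n → ℝ) → ℝ} (h : LCpi f) {a : ℝ} (ha : 0 < a) :
    Convex ℝ {x | a ≤ f x} := by
  intro x hx y hy s t hs ht hst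
  have hx' : a ≤ f x := hx
  have hy' : a ≤ f y := hy
  show a ≤ f (s • x + t • y)
  have e : t = 1 - s := by linarith
  subst e
  refine le_trans ?_ (h.2 x y s hs (by linarith))
  calc a = a ^ s * a ^ (1 - s) := by rw [← rpow_add ha]; simp
    _ ≤ _ := mul_le_mul (rpow_le_rpow ha.le hx' hs) (rpow_le_rpow ha.le hy' ht) (by positivity)
      (rpow_nonneg (h.1 _) _)

lemma TailLC.smul {μ : Measure (Fin n → ℝ)} (h : TailLC μ) (c : ENNReal) : TailLC (c • μ) := by
  intro θ a b
  simp only [Measure.smul_apply, smul_eq_mul]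
  calc _ = c ^ 2 * (μ {x | a ≤ θ ⬝ᵥ x} * μ {x | b ≤ θ ⬝ᵥ x}) := by ring
    _ ≤ c ^ 2 * μ {x | (a + b) / 2 ≤ θ ⬝ᵥ x} ^ 2 := by gcongr; exact h θ a b
    _ = _ := by ring

lemma LCpi.tailLC {f : (Fin n → ℝ) → ℝ} (h : LCpi f) (hf : Measurable f) :
    TailLC (volume.withDensity (fun x => ENNReal.ofReal (f x))) := by
  apply tailLC_withDensity hf.ennreal_ofReal
  intro x y
  rw [← ENNReal.ofReal_mul (h.1 x), ← ENNReal.ofReal_pow (h.1 _)]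
  exact ENNReal.ofReal_le_ofReal (h.mid x y)

lemma LCpi.tailLC_nuT {f : (Fin n → ℝ) → ℝ} (h : LCpi f) (hf : Measurable f)
    {S : Set (Fin n → ℝ)} (hS : MeasurableSet S) (hSc : Convex ℝ S) (s : ℝ) (g : Fin n → ℝ) :
    TailLC (nuT (ProbabilityTheory.cond (volume.withDensity (fun x => ENNReal.ofReal (f x))) S)
      s g) := by
  set w : (Fin n → ℝ) → ℝ := fun x => exp (s * (g ⬝ᵥ x) - s ^ 2 / 2 * (x ⬝ᵥ x)) with hw
  have mw : Measurable w := by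
    have h1 := measurable_dot g
    have h2 : Measurable fun x : Fin n → ℝ => x ⬝ᵥ x := by unfold dotProduct; fun_prop
    fun_prop
  rw [nuT, Measure.tilted, ProbabilityTheory.cond, withDensity_smul_measure]
  apply TailLC.smul
  rw [restrict_withDensity hS, ← withDensity_indicator hS]
  set Z : ℝ := ∫ x, exp (s * (g ⬝ᵥ x) - s ^ 2 / 2 * (x ⬝ᵥ x)) ∂((volume.withDensity
    (fun x => ENNReal.ofReal (f x)) S)⁻¹ • volume.withDensity
    (S.indicator (fun x => ENNReal.ofReal (f x)))) with hZ
  have hZ0 : 0 ≤ Z := integral_nonneg fun x => (exp_pos _).le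
  have e : (fun x => ENNReal.ofReal (exp (s * (g ⬝ᵥ x) - s ^ 2 / 2 * (x ⬝ᵥ x)) / Z)) =
      ENNReal.ofReal Z⁻¹ • (fun x => ENNReal.ofReal (w x)) := by
    funext x
    simp only [Pi.smul_apply, smul_eq_mul, hw]
    rw [← ENNReal.ofReal_mul (inv_nonneg.2 hZ0), div_eq_inv_mul]
  rw [e, withDensity_smul _ mw.ennreal_ofReal]
  apply TailLC.smul
  rw [← withDensity_mul _ (hf.ennreal_ofReal.indicator hS) mw.ennreal_ofReal]
  apply tailLC_withDensity ((hf.ennreal_ofReal.indicator hS).mul mw.ennreal_ofReal)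
  intro x y
  simp only [Pi.mul_apply]
  by_cases hx : x ∈ S
  swap
  · simp [hx]
  by_cases hy : y ∈ S
  swap
  · simp [hy]
  have hz : (2⁻¹:ℝ) • (x + y) ∈ S := by
    rw [smul_add]; exact hSc hx hy (by norm_num) (by norm_num) (by norm_num)
  rw [Set.indicator_of_mem hx, Set.indicator_of_mem hy, Set.indicator_of_mem hz]
  have wp : ∀ x, 0 ≤ w x := fun x => (exp_pos _).le
  rw [← ENNReal.ofReal_mul (h.1 _), ← ENNReal.ofReal_mul (h.1 _), ← ENNReal.ofReal_mul (h.1 _),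
    ← ENNReal.ofReal_mul (mul_nonneg (h.1 _) (wp _)),
    ← ENNReal.ofReal_pow (mul_nonneg (h.1 _) (wp _))]
  apply ENNReal.ofReal_le_ofReal
  have hww : w x * w y ≤ w ((2⁻¹:ℝ) • (x + y)) ^ 2 := by
    simp only [hw]
    rw [← exp_add, ← exp_nat_mul, exp_le_exp]
    have d : 0 ≤ (x - y) ⬝ᵥ (x - y) := by
      unfold dotProduct; exact Finset.sum_nonneg fun i _ => mul_self_nonneg _
    simp only [dotProduct_sub, sub_dotProduct] at d
    simp only [dotProduct_smul, smul_dotProduct, dotProduct_add, add_dotProduct, smul_eq_mul]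
    rw [dotProduct_comm y x] at *
    push_cast
    nlinarith [mul_nonneg (sq_nonneg s) d]
  calc f x * w x * (f y * w y) = (f x * f y) * (w x * w y) := by ring
    _ ≤ f ((2⁻¹:ℝ) • (x + y)) ^ 2 * w ((2⁻¹:ℝ) • (x + y)) ^ 2 :=
      mul_le_mul (h.mid x y) hww (mul_nonneg (wp _) (wp _)) (sq_nonneg _)
    _ = _ := by ring

lemma lintegral_half (F : (Fin n → ℝ) → ENNReal) (x0 : Fin n → ℝ)  :
    ∫⁻ z, F ((2⁻¹:ℝ) • (z + x0)) = 2 ^ n * ∫⁻ z, F z := by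
  rw [lintegral_add_right_eq_self (fun z => F ((2⁻¹:ℝ) • z)) x0]
  have e := Measure.map_addHaar_smul (E := Fin n → ℝ) volume (r := 2⁻¹) (by norm_num)
  have hm : MeasurableEmbedding (fun x : Fin n → ℝ => (2⁻¹:ℝ) • x) :=
    (Homeomorph.smulOfNeZero (2⁻¹:ℝ) (by norm_num)).measurableEmbedding
  rw [← hm.lintegral_map, e, lintegral_smul_measure]
  have : ENNReal.ofReal |((2⁻¹:ℝ) ^ Module.finrank ℝ (Fin n → ℝ))⁻¹| = 2 ^ n := by
    rw [abs_of_nonneg (by positivity)]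
    simp
  rw [this, smul_eq_mul]

lemma LCpi.sqrt_int {f : (Fin n → ℝ) → ℝ} (h : LCpi f)
    (hP : ∫⁻ x, ENNReal.ofReal (f x) = 1) (x0 : Fin n → ℝ) :
    ∫⁻ z, ENNReal.ofReal (√(f z * f x0)) ≤ 2 ^ n := by
  calc _ ≤ ∫⁻ z, ENNReal.ofReal (f ((2⁻¹:ℝ) • (z + x0))) := by
        apply lintegral_mono; intro z
        apply ENNReal.ofReal_le_ofReal
        rw [← sqrt_sq (h.1 ((2⁻¹:ℝ) • (z + x0)))]
        exact sqrt_le_sqrt (h.mid z x0)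
    _ = _ := by rw [lintegral_half (fun x => ENNReal.ofReal (f x)), hP, mul_one]

lemma LCpi.small_mass {f : (Fin n → ℝ) → ℝ} (h : LCpi f) (hf : Measurable f)
    (hP : ∫⁻ x, ENNReal.ofReal (f x) = 1) (x0 : Fin n → ℝ) {a : ℝ} (ha : 0 ≤ a) :
    volume.withDensity (fun x => ENNReal.ofReal (f x)) {x | f x < a * f x0} ≤
      ENNReal.ofReal (√a) * 2 ^ n := by
  have ms : MeasurableSet {x | f x < a * f x0} := measurableSet_lt hf measurable_const
  rw [withDensity_apply _ ms]
  calc _ ≤ ∫⁻ x in {x | f x < a * f x0}, ENNReal.ofReal (√a) * ENNReal.ofReal (√(f x * f x0)) := by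
        apply setLIntegral_mono' ms
        intro x hx
        have hx' : f x < a * f x0 := hx
        rw [← ENNReal.ofReal_mul (sqrt_nonneg _)]
        apply ENNReal.ofReal_le_ofReal
        rw [← sqrt_mul ha]
        apply le_sqrt_of_sq_le
        nlinarith [h.1 x]
    _ ≤ ∫⁻ x, ENNReal.ofReal (√a) * ENNReal.ofReal (√(f x * f x0)) := setLIntegral_le_lintegral _ _
    _ ≤ _ := by
        rw [lintegral_const_mul' _ _ ENNReal.ofReal_ne_top]
        gcongr
        exact h.sqrt_int hP x0

lemma trunc_lower {P : Measure (Fin n → ℝ)} [IsProbabilityMeasure P] (hT : TailLC P)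
    {S : Set (Fin n → ℝ)} (hS : MeasurableSet S)
    (hδ : P Sᶜ ≤ ENNReal.ofReal (1 / (4 * kurtC))) (θ : Fin n → ℝ) (b : ℝ)
    (hI : Integrable (fun x => (θ ⬝ᵥ x - b) ^ 2) P) :
    (1 / 2) * ∫ x, (θ ⬝ᵥ x - b) ^ 2 ∂P ≤ ∫ x in S, (θ ⬝ᵥ x - b) ^ 2 ∂P := by
  have hk := kurtC_ge
  set V := ∫ x, (θ ⬝ᵥ x - b) ^ 2 ∂P with hV
  have hV0 : 0 ≤ V := integral_nonneg fun x => sq_nonneg _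
  rcases hV0.eq_or_lt with h0 | hVp
  · rw [← h0]; simpa using setIntegral_nonneg hS fun x _ => sq_nonneg _
  have hsplit := integral_add_compl hS hI
  have mY : Measurable fun x : Fin n → ℝ => θ ⬝ᵥ x - b := (measurable_dot θ).sub_const b
  have hV2 : ∫⁻ x, ENNReal.ofReal ((θ ⬝ᵥ x - b) ^ 2) ∂P = ENNReal.ofReal V :=
    (ofReal_integral_eq_lintegral_ofReal hI (ae_of_all _ fun x => sq_nonneg _)).symm
  have k4 := hT.kurt θ b
  rw [hV2, ← ENNReal.ofReal_pow hV0, ← ENNReal.ofReal_mul (by linarith)] at k4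
  have n4 : ∀ x : Fin n → ℝ, 0 ≤ (θ ⬝ᵥ x - b) ^ 4 := fun x => by positivity
  have i4 : Integrable (fun x => (θ ⬝ᵥ x - b) ^ 4) P := by
    refine ⟨(mY.pow_const 4).aestronglyMeasurable, ?_⟩
    rw [hasFiniteIntegral_iff_ofReal (ae_of_all _ n4)]
    exact k4.trans_lt ENNReal.ofReal_lt_top
  have k4' : ∫ x, (θ ⬝ᵥ x - b) ^ 4 ∂P ≤ kurtC * V ^ 2 := by
    rw [← ofReal_integral_eq_lintegral_ofReal i4 (ae_of_all _ n4)] at k4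
    exact (ENNReal.ofReal_le_ofReal_iff (by positivity)).1 k4
  have hδ' : P.real Sᶜ ≤ 1 / (4 * kurtC) := ENNReal.toReal_le_of_le_ofReal (by positivity) hδ
  set l := 4 * kurtC * V with hl
  have hlp : 0 < l := by positivity
  have hb : ∫ x in Sᶜ, (θ ⬝ᵥ x - b) ^ 2 ∂P ≤ V / 2 := by
    calc _ ≤ ∫ x in Sᶜ, (l⁻¹ * (θ ⬝ᵥ x - b) ^ 4 + l / 4) ∂P := by
          apply integral_mono hI.integrableOn
            ((i4.const_mul _).integrableOn.add (integrable_const _))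
          intro x
          show (θ ⬝ᵥ x - b) ^ 2 ≤ l⁻¹ * (θ ⬝ᵥ x - b) ^ 4 + l / 4
          have : l⁻¹ * (θ ⬝ᵥ x - b) ^ 4 + l / 4 - (θ ⬝ᵥ x - b) ^ 2 =
            l⁻¹ * ((θ ⬝ᵥ x - b) ^ 2 - l / 2) ^ 2 := by field_simp; ring
          have : 0 ≤ l⁻¹ * ((θ ⬝ᵥ x - b) ^ 2 - l / 2) ^ 2 := by positivity
          linarith
      _ = l⁻¹ * ∫ x in Sᶜ, (θ ⬝ᵥ x - b) ^ 4 ∂P + P.real Sᶜ * (l / 4) := by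
          have i4' : Integrable (fun x => l⁻¹ * (θ ⬝ᵥ x - b) ^ 4) (P.restrict Sᶜ) :=
            (i4.const_mul _).integrableOn
          rw [integral_add i4' (integrable_const _), integral_const_mul]
          simp
      _ ≤ l⁻¹ * (kurtC * V ^ 2) + 1 / (4 * kurtC) * (l / 4) := by
          gcongr
          exact (setIntegral_le_integral i4 (ae_of_all _ n4)).trans k4'
      _ = V / 2 := by rw [hl]; field_simp; norm_num
  linarith

end PartL

section PartM
variable {n : ℕ}

noncomputable def Ltr : ℝ := 2 * (log 2 + log (8 * kurtC))

lemma tight_ball (P : Measure (Fin n → ℝ)) [IsProbabilityMeasure P] {ε : ℝ} (hε : 0 < ε) :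
    ∃ R : ℝ, 0 ≤ R ∧ P {x | ‖x‖ ≤ R}ᶜ ≤ ENNReal.ofReal ε := by
  have h := tendsto_measure_iInter_atTop (μ := P) (s := fun k : ℕ => {x : Fin n → ℝ | ‖x‖ ≤ k}ᶜ)
    (fun k => (measurableSet_le measurable_norm measurable_const).compl.nullMeasurableSet)
    (by
      intro a b hab x hx
      have hx' : ¬ ‖x‖ ≤ b := hx
      show ¬ ‖x‖ ≤ a
      have : (a:ℝ) ≤ b := by exact_mod_cast hab
      intro h; exact hx' (h.trans this))
    ⟨0, measure_ne_top _ _⟩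
  have e : (⋂ k : ℕ, {x : Fin n → ℝ | ‖x‖ ≤ k}ᶜ) = ∅ := by
    ext x
    simp only [Set.mem_iInter, Set.mem_empty_iff_false, iff_false, not_forall]
    obtain ⟨k, hk⟩ := exists_nat_ge ‖x‖
    exact ⟨k, fun h => h hk⟩
  rw [e, measure_empty] at h
  obtain ⟨k, hk⟩ := ((tendsto_order.1 h).2 (ENNReal.ofReal ε) (by simpa using hε)).exists
  exact ⟨k, by positivity, hk.le⟩

theorem core (hn : 1 ≤ n) {f : (Fin n → ℝ) → ℝ} (h : LCpi f) (hf : Measurable f)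
    (hP : ∫⁻ x, ENNReal.ofReal (f x) = 1)
    (hI : ∀ (θ : Fin n → ℝ) (b : ℝ), Integrable (fun x => (θ ⬝ᵥ x - b) ^ 2)
      (volume.withDensity (fun x => ENNReal.ofReal (f x))))
    (hV : ∀ (θ : Fin n → ℝ) (b : ℝ), θ ⬝ᵥ θ ≤ ∫ x, (θ ⬝ᵥ x - b) ^ 2
      ∂(volume.withDensity (fun x => ENNReal.ofReal (f x))))
    (hm : ∀ θ : Fin n → ℝ, ∃ b : ℝ, ∫ x, (θ ⬝ᵥ x - b) ^ 2
      ∂(volume.withDensity (fun x => ENNReal.ofReal (f x))) ≤ θ ⬝ᵥ θ) (x0 : Fin n → ℝ) :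
    f x0 ≤ exp (n / 4 * log n + (Ltr - log cvol) * n) := by
  rcases (h.1 x0).eq_or_lt with h0 | hx0
  · rw [← h0]; positivity
  set P := volume.withDensity (fun x => ENNReal.ofReal (f x)) with hPdef
  have hPp : IsProbabilityMeasure P := ⟨by rw [hPdef, withDensity_apply _ .univ]; simpa using hP⟩
  have hk := kurtC_ge
  set a := exp (-(Ltr * n)) with ha
  have hap : 0 < a := exp_pos _
  have hn' : (1:ℝ) ≤ n := by exact_mod_cast hn
  -- small mass
  have sm : P {x | a * f x0 ≤ f x}ᶜ ≤ ENNReal.ofReal (1 / (8 * kurtC)) := by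
    have e : {x | a * f x0 ≤ f x}ᶜ = {x | f x < a * f x0} := by ext x; simp
    rw [e]
    refine (h.small_mass hf hP x0 hap.le).trans ?_
    have : (2:ENNReal) ^ n = ENNReal.ofReal (2 ^ n) := by
      rw [ENNReal.ofReal_pow (by norm_num)]; simp
    rw [this, ← ENNReal.ofReal_mul (sqrt_nonneg _)]
    apply ENNReal.ofReal_le_ofReal
    have s1 : √a = exp (-(Ltr * n) / 2) := by rw [ha, ← exp_half]
    have s2 : (2:ℝ) ^ n = exp (n * log 2) := by
      rw [exp_nat_mul, exp_log (by norm_num)]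
    have s3 : 1 / (8 * kurtC) = exp (- log (8 * kurtC)) := by
      rw [exp_neg, exp_log (by linarith), one_div]
    rw [s1, s2, s3, ← exp_add, exp_le_exp, Ltr]
    have : 0 ≤ log (8 * kurtC) := log_nonneg (by linarith)
    nlinarith
  obtain ⟨R, hR, hRP⟩ := tight_ball P (ε := 1 / (8 * kurtC)) (by positivity)
  set S : Set (Fin n → ℝ) := {x | a * f x0 ≤ f x} ∩ {x | ‖x‖ ≤ R} with hS
  have hSm : MeasurableSet S := (measurableSet_le measurable_const hf).inter
    (measurableSet_le measurable_norm measurable_const)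
  have hSc : Convex ℝ S := by
    refine (h.convex (by positivity)).inter ?_
    have : {x : Fin n → ℝ | ‖x‖ ≤ R} = Metric.closedBall 0 R := by ext x; simp
    rw [this]; exact convex_closedBall _ _
  have hSP : P Sᶜ ≤ ENNReal.ofReal (1 / (4 * kurtC)) := by
    rw [hS, Set.compl_inter]
    refine (measure_union_le _ _).trans ((add_le_add sm hRP).trans ?_)
    rw [← ENNReal.ofReal_add (by positivity) (by positivity)]
    apply ENNReal.ofReal_le_ofReal
    apply le_of_eq; field_simp; norm_num
  have hSc' : P.real Sᶜ ≤ 1 / (4 * kurtC) := ENNReal.toReal_le_of_le_ofReal (by positivity) hSP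
  have hSr : 1 / 2 ≤ P.real S := by
    have := probReal_compl_eq_one_sub (μ := P) hSm
    have h2 : 1 / (4 * kurtC) ≤ 1 / 2 := by
      apply one_div_le_one_div_of_le <;> linarith
    linarith
  have hS1 : P.real S ≤ 1 := measureReal_le_one
  have hS0 : P S ≠ 0 := by
    intro h0; rw [measureReal_def, h0] at hSr; norm_num at hSr
  set μ := ProbabilityTheory.cond P S with hμ
  have hμp : IsProbabilityMeasure μ := ProbabilityTheory.cond_isProbabilityMeasure hS0
  have hμS : ∀ᵐ x ∂μ, x ∈ S := by
    rw [hμ, ProbabilityTheory.cond]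
    exact Measure.ae_smul_measure (ae_restrict_mem hSm) _
  have hμR : ∀ᵐ x ∂μ, ‖x‖ ≤ R := hμS.mono fun x hx => hx.2
  have hint : ∀ F : (Fin n → ℝ) → ℝ, ∫ x, F x ∂μ = (P.real S)⁻¹ * ∫ x in S, F x ∂P := by
    intro F
    rw [hμ, ProbabilityTheory.cond, integral_smul_measure, smul_eq_mul, ENNReal.toReal_inv,
      measureReal_def]
  have h1 : ∀ θ : Fin n → ℝ, (1/2) * (θ ⬝ᵥ θ) ≤ θ ⬝ᵥ (cov μ).mulVec θ := by
    intro θ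
    rw [cov_quad hμR, hint]
    have t := trunc_lower (h.tailLC hf) hSm hSP θ (θ ⬝ᵥ ∫ x, x ∂μ) (hI _ _)
    have t2 := hV θ (θ ⬝ᵥ ∫ x, x ∂μ)
    have t3 : 0 ≤ ∫ x in S, (θ ⬝ᵥ x - θ ⬝ᵥ ∫ x, x ∂μ) ^ 2 ∂P :=
      setIntegral_nonneg hSm fun x _ => sq_nonneg _
    have t4 : 1 ≤ (P.real S)⁻¹ := (one_le_inv₀ (by linarith)).2 hS1
    nlinarith
  have h2 : ∀ θ : Fin n → ℝ, θ ⬝ᵥ (cov μ).mulVec θ ≤ 2 * (θ ⬝ᵥ θ) := by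
    intro θ
    obtain ⟨b, hb⟩ := hm θ
    have q1 : θ ⬝ᵥ (cov μ).mulVec θ ≤ ∫ x, (θ ⬝ᵥ x - b) ^ 2 ∂μ := by
      rw [cov_quad hμR, sq_shift hμR, sq_shift hμR]
      nlinarith [sq_nonneg (b - θ ⬝ᵥ ∫ x, x ∂μ)]
    refine q1.trans ?_
    rw [hint]
    have q2 : ∫ x in S, (θ ⬝ᵥ x - b) ^ 2 ∂P ≤ θ ⬝ᵥ θ :=
      (setIntegral_le_integral (hI θ b) (ae_of_all _ fun x => sq_nonneg _)).trans hb
    have q3 : 0 ≤ ∫ x in S, (θ ⬝ᵥ x - b) ^ 2 ∂P := setIntegral_nonneg hSm fun x _ => sq_nonneg _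
    have t4 : (P.real S)⁻¹ ≤ 2 := inv_le_of_inv_le₀ (by norm_num) (by linarith)
    nlinarith
  have key := vol_lower hn hR hμR (fun s g => h.tailLC_nuT hf hSm hSc s g) h1 h2
    hSc.closure isClosed_closure (hμS.mono fun x hx => subset_closure hx)
  have hcl : volume (closure S) ≤ volume S := by
    calc volume (closure S) ≤ volume (S ∪ frontier S) := by
          apply measure_mono
          rw [closure_eq_self_union_frontier]
      _ ≤ volume S + volume (frontier S) := measure_union_le _ _
      _ = volume S := by rw [hSc.addHaar_frontier volume, add_zero]
  have hmass : ENNReal.ofReal (a * f x0) * volume S ≤ 1 := by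
    calc _ = ∫⁻ x in S, ENNReal.ofReal (a * f x0) := by rw [setLIntegral_const]
      _ ≤ ∫⁻ x in S, ENNReal.ofReal (f x) := by
          apply setLIntegral_mono' hSm
          intro x hx; exact ENNReal.ofReal_le_ofReal hx.1
      _ ≤ ∫⁻ x, ENNReal.ofReal (f x) := setLIntegral_le_lintegral _ _
      _ = 1 := hP
  have fin : ENNReal.ofReal (a * f x0) * ENNReal.ofReal (exp (n * log cvol - n / 4 * log n)) ≤ 1 :=
    le_trans (by gcongr; exact key.trans hcl) hmass
  rw [← ENNReal.ofReal_mul (by positivity), ENNReal.ofReal_le_one] at fin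
  have e : exp (n / 4 * log n + (Ltr - log cvol) * n) *
    (a * exp (n * log cvol - n / 4 * log n)) = 1 := by
    rw [ha, ← exp_add, ← exp_add, exp_eq_one_iff]; ring
  have hp : 0 < a * exp (n * log cvol - n / 4 * log n) := by positivity
  by_contra hcon
  push Not at hcon
  have := mul_lt_mul_of_pos_right hcon hp
  rw [e] at this
  nlinarith

end PartM

section PartN
variable {n : ℕ}

lemma LCpi.exists_meas {f : (Fin n → ℝ) → ℝ} (h : LCpi f) :
    ∃ g : (Fin n → ℝ) → ℝ, LCpi g ∧ Measurable g ∧ f =ᵐ[volume] g := by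
  classical
  set U : Set (Fin n → ℝ) := {x | 0 < f x} with hU
  have hlog : ConcaveOn ℝ U (fun x => log (f x)) := by
    have hc : ∀ x ∈ U, ∀ y ∈ U, ∀ s t : ℝ, 0 ≤ s → 0 ≤ t → s + t = 1 →
        0 < f (s • x + t • y) ∧ s * log (f x) + t * log (f y) ≤ log (f (s • x + t • y)) := by
      intro x hx y hy s t hs ht hst
      have hx' : 0 < f x := hx
      have hy' : 0 < f y := hy
      have e : t = 1 - s := by linarith
      subst e
      have := h.2 x y s hs (by linarith)
      have p1 : 0 < f x ^ s := rpow_pos_of_pos hx' _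
      have p2 : 0 < f y ^ (1 - s) := rpow_pos_of_pos hy' _
      have p := mul_pos p1 p2
      refine ⟨lt_of_lt_of_le p this, ?_⟩
      rw [← log_rpow hx', ← log_rpow hy', ← log_mul p1.ne' p2.ne']
      exact log_le_log p this
    refine ⟨fun x hx y hy s t hs ht hst => (hc x hx y hy s t hs ht hst).1, ?_⟩
    intro x hx y hy s t hs ht hst
    exact (hc x hx y hy s t hs ht hst).2
  have hUc : Convex ℝ U := hlog.1
  have hcont : ContinuousOn f (interior U) := by
    have h1 := hlog.continuousOn_interior
    have h2 : ContinuousOn (fun x => exp (log (f x))) (interior U) := h1.rexp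
    refine h2.congr fun x hx => ?_
    have hx' : 0 < f x := interior_subset (s := U) hx
    exact (exp_log hx').symm
  have hIc : Convex ℝ (interior U) := hUc.interior
  refine ⟨(interior U).piecewise f (fun _ => 0), ⟨?_, ?_⟩,
    hcont.measurable_piecewise continuousOn_const isOpen_interior.measurableSet, ?_⟩
  · intro x
    by_cases hx : x ∈ interior U
    · rw [Set.piecewise_eq_of_mem _ _ _ hx]; exact h.1 x
    · rw [Set.piecewise_eq_of_notMem _ _ _ hx]
  · intro x y t ht0 ht1
    have nn : ∀ z, 0 ≤ (interior U).piecewise f (fun _ => 0) z := by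
      intro x
      by_cases hx : x ∈ interior U
      · rw [Set.piecewise_eq_of_mem _ _ _ hx]; exact h.1 x
      · rw [Set.piecewise_eq_of_notMem _ _ _ hx]
    rcases ht0.eq_or_lt with rfl | ht0'
    · rw [show (0:ℝ) • x + (1 - 0 : ℝ) • y = y by simp]; simp
    rcases ht1.eq_or_lt with rfl | ht1'
    · rw [show (1:ℝ) • x + (1 - 1 : ℝ) • y = x by simp]; simp
    by_cases hx : x ∈ interior U
    · by_cases hy : y ∈ interior U
      · have hz : t • x + (1 - t) • y ∈ interior U := hIc hx hy ht0 (by linarith) (by linarith)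
        rw [Set.piecewise_eq_of_mem _ _ _ hx, Set.piecewise_eq_of_mem _ _ _ hy,
          Set.piecewise_eq_of_mem _ _ _ hz]
        exact h.2 x y t ht0 ht1
      · rw [Set.piecewise_eq_of_notMem _ _ _ hy, zero_rpow (by linarith), mul_zero]
        exact nn _
    · rw [Set.piecewise_eq_of_notMem _ _ _ hx, zero_rpow (by linarith), zero_mul]
      exact nn _
  · have hz := hUc.addHaar_frontier volume
    have : ∀ᵐ x ∂(volume : Measure (Fin n → ℝ)), x ∉ frontier U := measure_eq_zero_iff_ae_notMem.1 hz
    filter_upwards [this] with x hx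
    by_cases hxI : x ∈ interior U
    · rw [Set.piecewise_eq_of_mem _ _ _ hxI]
    · rw [Set.piecewise_eq_of_notMem _ _ _ hxI]
      by_contra h0
      have hxU : x ∈ U := lt_of_le_of_ne (h.1 x) (Ne.symm h0)
      exact hx ⟨subset_closure hxU, hxI⟩

lemma sup_bound (hn : 1 ≤ n) {g : (Fin n → ℝ) → ℝ} (h : LCpi g) (hg : Measurable g)
    (hP : ∫⁻ x, ENNReal.ofReal (g x) = 1) {S : Matrix (Fin n) (Fin n) ℝ} (hS : S.PosDef)
    (hI : ∀ (θ : Fin n → ℝ) (b : ℝ), Integrable (fun x => (θ ⬝ᵥ x - b) ^ 2)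
      (volume.withDensity (fun x => ENNReal.ofReal (g x))))
    (hV : ∀ (θ : Fin n → ℝ) (b : ℝ), θ ⬝ᵥ S.mulVec θ ≤ ∫ x, (θ ⬝ᵥ x - b) ^ 2
      ∂(volume.withDensity (fun x => ENNReal.ofReal (g x))))
    (hm : ∀ θ : Fin n → ℝ, ∃ b : ℝ, ∫ x, (θ ⬝ᵥ x - b) ^ 2
      ∂(volume.withDensity (fun x => ENNReal.ofReal (g x))) ≤ θ ⬝ᵥ S.mulVec θ) (y0 : Fin n → ℝ) :
    g y0 ≤ exp (n / 4 * log n + (Ltr - log cvol) * n - 1 / 2 * log S.det) := by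
  obtain ⟨Q, hQ⟩ := psd_factor hS.posSemidef
  set T := Q.transpose with hT
  have hdet : S.det = T.det ^ 2 := by
    rw [hQ, Matrix.det_mul, hT, Matrix.det_transpose]; ring
  have hSd : 0 < S.det := hS.det_pos
  have hTd : T.det ≠ 0 := by
    intro h0; rw [hdet, h0] at hSd; norm_num at hSd
  have hTu : IsUnit T.det := isUnit_iff_ne_zero.2 hTd
  set d := |T.det| with hd
  have hdp : 0 < d := abs_pos.2 hTd
  set P := volume.withDensity (fun x => ENNReal.ofReal (g x)) with hPd
  set f : (Fin n → ℝ) → ℝ := fun x => d * g (T.mulVec x) with hf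
  have mT : Measurable fun x : Fin n → ℝ => T.mulVec x := by
    have : Continuous fun x : Fin n → ℝ => T.mulVec x := by fun_prop
    exact this.measurable
  have mf : Measurable f := (hg.comp mT).const_mul d
  have hLC : LCpi f := by
    refine ⟨fun x => mul_nonneg hdp.le (h.1 _), ?_⟩
    intro x y t ht0 ht1
    simp only [hf]
    rw [mul_rpow hdp.le (h.1 _), mul_rpow hdp.le (h.1 _), Matrix.mulVec_add, Matrix.mulVec_smul,
      Matrix.mulVec_smul]
    have e : d ^ t * d ^ (1 - t) = d := by rw [← rpow_add hdp]; simp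
    calc _ = (d ^ t * d ^ (1 - t)) * (g (T.mulVec x) ^ t * g (T.mulVec y) ^ (1 - t)) := by ring
      _ ≤ _ := by rw [e]; exact mul_le_mul_of_nonneg_left (h.2 _ _ t ht0 ht1) hdp.le
  have hmap : Measure.map (fun x : Fin n → ℝ => T.mulVec x)
      (volume.withDensity (fun x => ENNReal.ofReal (f x))) = P := by
    ext A hA
    rw [Measure.map_apply mT hA, withDensity_apply _ (mT hA), hPd, withDensity_apply _ hA,
      ← lintegral_indicator (mT hA), ← lintegral_indicator hA]
    have e1 : ∀ x, ((fun x : Fin n → ℝ => T.mulVec x) ⁻¹' A).indicator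
        (fun x => ENNReal.ofReal (f x)) x =
        ENNReal.ofReal d * A.indicator (fun x => ENNReal.ofReal (g x)) (T.mulVec x) := by
      intro x
      by_cases hx : T.mulVec x ∈ A
      · rw [Set.indicator_of_mem (by exact hx), Set.indicator_of_mem hx, ← ENNReal.ofReal_mul hdp.le]
      · rw [Set.indicator_of_notMem (by exact hx), Set.indicator_of_notMem hx, mul_zero]
    simp_rw [e1]
    have mi : Measurable (A.indicator (fun x => ENNReal.ofReal (g x))) :=
      hg.ennreal_ofReal.indicator hA
    have mm := Real.map_matrix_volume_pi_eq_smul_volume_pi hTd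
    have e2 : (⇑(Matrix.toLin' T)) = fun x : Fin n → ℝ => T.mulVec x := by
      funext x; exact Matrix.toLin'_apply T x
    rw [e2] at mm
    rw [lintegral_const_mul' _ _ ENNReal.ofReal_ne_top, ← lintegral_map mi mT, mm, lintegral_smul_measure,
      smul_eq_mul, ← mul_assoc, ← ENNReal.ofReal_mul hdp.le, abs_inv, mul_inv_cancel₀ hdp.ne']
    simp
  have hdot : ∀ (θ x : Fin n → ℝ), θ ⬝ᵥ x = (T⁻¹.transpose.mulVec θ) ⬝ᵥ (T.mulVec x) := by
    intro θ x
    rw [Matrix.mulVec_transpose, ← Matrix.dotProduct_mulVec, Matrix.mulVec_mulVec,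
      Matrix.nonsing_inv_mul _ hTu, Matrix.one_mulVec]
  have hquad : ∀ θ : Fin n → ℝ, (T⁻¹.transpose.mulVec θ) ⬝ᵥ S.mulVec (T⁻¹.transpose.mulVec θ) =
      θ ⬝ᵥ θ := by
    intro θ
    have : S = T * T.transpose := by rw [hQ, hT, Matrix.transpose_transpose]
    rw [this, ← Matrix.mulVec_mulVec, ← hdot, Matrix.mulVec_mulVec, ← Matrix.transpose_mul,
      Matrix.nonsing_inv_mul _ hTu, Matrix.transpose_one, Matrix.one_mulVec]
  have msq : ∀ (η : Fin n → ℝ) (b : ℝ), Measurable fun y : Fin n → ℝ => (η ⬝ᵥ y - b) ^ 2 :=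
    fun η b => ((measurable_dot η).sub_const b).pow_const 2
  have hint : ∀ (θ : Fin n → ℝ) (b : ℝ), ∫ x, (θ ⬝ᵥ x - b) ^ 2
      ∂(volume.withDensity (fun x => ENNReal.ofReal (f x))) =
      ∫ y, ((T⁻¹.transpose.mulVec θ) ⬝ᵥ y - b) ^ 2 ∂P := by
    intro θ b
    rw [← hmap, integral_map mT.aemeasurable (msq _ b).aestronglyMeasurable]
    simp_rw [← hdot]
  have hP' : ∫⁻ x, ENNReal.ofReal (f x) = 1 := by
    have h1 : P Set.univ = 1 := by rw [hPd, withDensity_apply _ .univ]; simpa using hP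
    rw [← hmap, Measure.map_apply mT .univ, Set.preimage_univ, withDensity_apply _ .univ] at h1
    simpa using h1
  have key := core hn hLC mf hP'
    (fun θ b => by
      have := hI (T⁻¹.transpose.mulVec θ) b
      rw [← hmap, integrable_map_measure (msq _ b).aestronglyMeasurable mT.aemeasurable] at this
      refine this.congr (ae_of_all _ fun x => ?_)
      simp only [Function.comp]
      rw [← hdot])
    (fun θ b => by
      rw [hint, ← hquad]; exact hV _ _)
    (fun θ => by
      obtain ⟨b, hb⟩ := hm (T⁻¹.transpose.mulVec θ)
      exact ⟨b, by rw [hint, ← hquad]; exact hb⟩) (T⁻¹.mulVec y0)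
  simp only [hf] at key
  rw [Matrix.mulVec_mulVec, Matrix.mul_nonsing_inv _ hTu, Matrix.one_mulVec] at key
  have e3 : 1 / 2 * log S.det = log d := by
    rw [hdet, ← sq_abs, ← hd, log_pow]; push_cast; ring
  rw [e3, exp_sub, exp_log hdp, le_div_iff₀ hdp]
  linarith

lemma ent_bound {g : (Fin n → ℝ) → ℝ} (h : LCpi g) (hg : Measurable g)
    (hP : ∫⁻ x, ENNReal.ofReal (g x) = 1) {B : ℝ} (hB : ∀ x, g x ≤ exp B) :
    ∫ x, g x * log (g x) ≤ B := by
  have ig : Integrable g := by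
    refine ⟨hg.aestronglyMeasurable, ?_⟩
    rw [hasFiniteIntegral_iff_ofReal (ae_of_all _ h.1), hP]; simp
  have i1 : ∫ x, g x = 1 := by
    rw [integral_eq_lintegral_of_nonneg_ae (ae_of_all _ h.1) hg.aestronglyMeasurable, hP]; simp
  obtain ⟨x0, hx0⟩ : ∃ x0, 0 < g x0 := by
    by_contra hcon
    push Not at hcon
    have : ∀ x, g x = 0 := fun x => le_antisymm (hcon x) (h.1 x)
    simp [this] at i1
  have isq : Integrable (fun x => √(g x)) := by
    have i2 : Integrable (fun x => √(g x * g x0)) := by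
      refine ⟨(hg.mul_const _).sqrt.aestronglyMeasurable, ?_⟩
      rw [hasFiniteIntegral_iff_ofReal (ae_of_all _ fun x => sqrt_nonneg _)]
      exact (h.sqrt_int hP x0).trans_lt (by finiteness)
    have i3 := i2.const_mul (√(g x0))⁻¹
    refine i3.congr (ae_of_all _ fun x => ?_)
    show (√(g x0))⁻¹ * √(g x * g x0) = √(g x)
    rw [sqrt_mul (h.1 x)]
    have := sqrt_pos.2 hx0
    field_simp
  have mgl : Measurable fun x => g x * log (g x) := hg.mul hg.log
  have iel : Integrable (fun x => g x * log (g x)) := by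
    refine ((isq.const_mul 2).add (ig.const_mul (exp B))).mono' mgl.aestronglyMeasurable
      (ae_of_all _ fun x => ?_)
    show ‖g x * log (g x)‖ ≤ 2 * √(g x) + exp B * g x
    rw [norm_eq_abs]
    rcases (h.1 x).eq_or_lt with h0 | hp
    · rw [← h0]; simp
    have hs := sqrt_pos.2 hp
    rcases le_total (g x) 1 with h1 | h1
    · have hs1 : √(g x) ≤ 1 := sqrt_le_iff.2 ⟨by norm_num, by simpa using h1⟩
      have := abs_log_mul_self_lt _ hs hs1
      have e : g x * log (g x) = 2 * √(g x) * (log (√(g x)) * √(g x)) := by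
        rw [log_sqrt hp.le]
        calc _ = (√(g x) * √(g x)) * log (g x) := by rw [mul_self_sqrt hp.le]
          _ = _ := by ring
      rw [e, abs_mul, abs_of_pos (by positivity : 0 < 2 * √(g x))]
      have : 2 * √(g x) * |log √(g x) * √(g x)| ≤ 2 * √(g x) * 1 := by gcongr
      have : 0 ≤ exp B * g x := by positivity
      linarith
    · rw [abs_of_nonneg (mul_nonneg hp.le (log_nonneg h1))]
      have l1 : log (g x) ≤ exp B := (log_le_self hp.le).trans (hB x)
      nlinarith
  calc ∫ x, g x * log (g x) ≤ ∫ x, B * g x := by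
        apply integral_mono iel (ig.const_mul B)
        intro x
        show g x * log (g x) ≤ B * g x
        rcases (h.1 x).eq_or_lt with h0 | hp
        · rw [← h0]; simp
        have : log (g x) ≤ B := (log_le_iff_le_exp hp).2 (hB x)
        nlinarith
    _ = B := by rw [integral_const_mul, i1, mul_one]

end PartN

section PartO
variable {n : ℕ}

lemma quad_stats {P : Measure (Fin n → ℝ)} [IsProbabilityMeasure P]
    (h2 : ∀ i, MemLp (fun x : Fin n → ℝ => x i) 2 P) {m : Fin n → ℝ}
    {S : Matrix (Fin n) (Fin n) ℝ} (hm : ∀ i, m i = ∫ x, x i ∂P)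
    (hS : ∀ i j, S i j = ∫ x, (x i - m i) * (x j - m j) ∂P) (θ : Fin n → ℝ) (b : ℝ) :
    Integrable (fun x => (θ ⬝ᵥ x - b) ^ 2) P ∧
    ∫ x, (θ ⬝ᵥ x - b) ^ 2 ∂P = θ ⬝ᵥ S.mulVec θ + (θ ⬝ᵥ m - b) ^ 2 := by
  have i1 : ∀ i, Integrable (fun x : Fin n → ℝ => x i) P := fun i => (h2 i).integrable (by norm_num)
  have i1' : ∀ i, Integrable (fun x : Fin n → ℝ => x i - m i) P := fun i =>
    (i1 i).sub (integrable_const _)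
  have h2' : ∀ i, MemLp (fun x : Fin n → ℝ => x i - m i) 2 P := fun i =>
    (h2 i).sub (memLp_const _)
  have i2 : ∀ i j, Integrable (fun x : Fin n → ℝ => (x i - m i) * (x j - m j)) P := fun i j =>
    (h2' i).integrable_mul (h2' j)
  have e : ∀ x : Fin n → ℝ, (θ ⬝ᵥ x - b) ^ 2 =
      (∑ i, ∑ j, θ i * θ j * ((x i - m i) * (x j - m j))) +
      (∑ i, 2 * (θ ⬝ᵥ m - b) * θ i * (x i - m i)) + (θ ⬝ᵥ m - b) ^ 2 := by
    intro x
    have e1 : ∑ i, ∑ j, θ i * θ j * ((x i - m i) * (x j - m j)) = (θ ⬝ᵥ x - θ ⬝ᵥ m) ^ 2 := by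
      rw [sq, ← dotProduct_sub]
      simp only [dotProduct, Finset.sum_mul_sum, Pi.sub_apply]
      exact Finset.sum_congr rfl fun i _ => Finset.sum_congr rfl fun j _ => by ring
    have e2 : ∑ i, 2 * (θ ⬝ᵥ m - b) * θ i * (x i - m i) =
        2 * (θ ⬝ᵥ m - b) * (θ ⬝ᵥ x - θ ⬝ᵥ m) := by
      rw [← dotProduct_sub]
      simp only [dotProduct, Finset.mul_sum, Pi.sub_apply, mul_assoc]
    rw [e1, e2]; ring
  have iA : Integrable (fun x : Fin n → ℝ => ∑ i, ∑ j, θ i * θ j * ((x i - m i) * (x j - m j))) P :=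
    integrable_finsetSum _ fun i _ => integrable_finsetSum _ fun j _ => (i2 i j).const_mul _
  have iB : Integrable (fun x : Fin n → ℝ => ∑ i, 2 * (θ ⬝ᵥ m - b) * θ i * (x i - m i)) P :=
    integrable_finsetSum _ fun i _ => (i1' i).const_mul _
  have iAB : Integrable (fun x : Fin n → ℝ =>
      (∑ i, ∑ j, θ i * θ j * ((x i - m i) * (x j - m j))) +
      (∑ i, 2 * (θ ⬝ᵥ m - b) * θ i * (x i - m i))) P := iA.add iB
  rw [show (fun x : Fin n → ℝ => (θ ⬝ᵥ x - b) ^ 2) = _ from funext e]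
  refine ⟨iAB.add (integrable_const _), ?_⟩
  rw [integral_add iAB (integrable_const _), integral_add iA iB,
    integral_finsetSum _ fun i _ => integrable_finsetSum _ fun j _ => (i2 i j).const_mul _,
    integral_finsetSum _ fun i _ => (i1' i).const_mul _]
  have z : ∀ i, ∫ x : Fin n → ℝ, 2 * (θ ⬝ᵥ m - b) * θ i * (x i - m i) ∂P = 0 := by
    intro i
    rw [integral_const_mul, integral_sub (i1 i) (integrable_const _), ← hm]; simp
  have q : ∀ i, ∫ x : Fin n → ℝ, ∑ j, θ i * θ j * ((x i - m i) * (x j - m j)) ∂P =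
      θ i * S.mulVec θ i := by
    intro i
    rw [integral_finsetSum _ fun j _ => (i2 i j).const_mul _]
    simp only [integral_const_mul, ← hS, Matrix.mulVec, dotProduct, Finset.mul_sum]
    exact Finset.sum_congr rfl fun j _ => by ring
  simp only [z, q]
  simp [dotProduct]

theorem pi_version (hn : 1 ≤ n) {f : (Fin n → ℝ) → ℝ} (h : LCpi f)
    {P : Measure (Fin n → ℝ)} [hPp : IsProbabilityMeasure P]
    (hPd : P = volume.withDensity (fun x => ENNReal.ofReal (f x)))
    (h2 : ∀ i, MemLp (fun x : Fin n → ℝ => x i) 2 P) {m : Fin n → ℝ}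
    {S : Matrix (Fin n) (Fin n) ℝ} (hm : ∀ i, m i = ∫ x, x i ∂P)
    (hS : ∀ i j, S i j = ∫ x, (x i - m i) * (x j - m j) ∂P) (hSp : S.PosDef) :
    ∫ x, f x * log (f x) ≤ n / 4 * log n + (Ltr - log cvol) * n - 1 / 2 * log S.det := by
  obtain ⟨g, hg, mg, hfg⟩ := h.exists_meas
  have hPg : P = volume.withDensity (fun x => ENNReal.ofReal (g x)) := by
    rw [hPd]
    exact withDensity_congr_ae (hfg.mono fun x hx => by simp only [hx])
  have hP1 : ∫⁻ x, ENNReal.ofReal (g x) = 1 := by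
    have := hPp.measure_univ
    rw [hPg, withDensity_apply _ .univ] at this
    simpa using this
  have e : ∫ x, f x * log (f x) = ∫ x, g x * log (g x) :=
    integral_congr_ae (hfg.mono fun x hx => by simp only [hx])
  rw [e]
  apply ent_bound hg mg hP1
  have st := quad_stats h2 hm hS
  rw [hPg] at st
  exact sup_bound hn hg mg hP1 hSp (fun θ b => (st θ b).1)
    (fun θ b => by rw [(st θ b).2]; nlinarith [sq_nonneg (θ ⬝ᵥ m - b)])
    (fun θ => ⟨θ ⬝ᵥ m, by rw [(st θ _).2]; simp⟩)

end PartO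

/-- There is a universal constant `c` such that every log-concave density `f`
on ℝⁿ with finite second moments satisfies `D(f) ≤ (1/4) n log n + c n`, where
`D(f) = h(g) - h(f)` is the relative entropy from the Gaussian `g` with the same
mean `m` and (positive definite) covariance matrix `Σ` as `f`, and
`h(g) = (1/2) log((2πe)ⁿ det Σ)`. -/
theorem relative_entropy_from_gaussian_bound :
    ∃ c : ℝ, 0 < c ∧
    ∀ (n : ℕ), 1 ≤ n →
    ∀ (f : EuclideanSpace ℝ (Fin n) → ℝ),
      IsLogConcave f →
      IsProbabilityMeasure (volume.withDensity (fun x => ENNReal.ofReal (f x))) →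
      Integrable (fun x => ‖x‖ ^ 2)
        (volume.withDensity (fun x => ENNReal.ofReal (f x))) →
      ∀ (m : EuclideanSpace ℝ (Fin n)) (S : Matrix (Fin n) (Fin n) ℝ),
        m = ∫ x, x ∂(volume.withDensity (fun x => ENNReal.ofReal (f x))) →
        S = Matrix.of (fun i j => ∫ x, (x i - m i) * (x j - m j)
              ∂(volume.withDensity (fun x => ENNReal.ofReal (f x)))) →
        S.PosDef →
        (1 / 2) * Real.log ((2 * Real.pi * Real.exp 1) ^ n * S.det) - hEnt f
          ≤ (1 / 4) * n * Real.log n + c * n := by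
  refine ⟨|1 / 2 * log (2 * π * exp 1) + (Ltr - log cvol)| + 1, by positivity, ?_⟩
  intro n hn f hf hPp h2 m S hm hS hSp
  set PE := volume.withDensity (fun x => ENNReal.ofReal (f x)) with hPE
  set e := MeasurableEquiv.toLp 2 (Fin n → ℝ) with he
  have hmp : MeasurePreserving e (volume : Measure (Fin n → ℝ)) volume :=
    PiLp.volume_preserving_toLp (Fin n)
  set F : (Fin n → ℝ) → ℝ := fun x => f (e x) with hF
  set P := volume.withDensity (fun x => ENNReal.ofReal (F x)) with hP
  have hmap : Measure.map e P = PE := by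
    ext A hA
    rw [Measure.map_apply e.measurable hA, hP, withDensity_apply _ (e.measurable hA), hPE,
      withDensity_apply _ hA]
    exact hmp.setLIntegral_comp_preimage_emb e.measurableEmbedding
      (fun x => ENNReal.ofReal (f x)) A
  have hPP : IsProbabilityMeasure P := by
    constructor
    have := hPp.measure_univ
    rw [← hmap, Measure.map_apply e.measurable .univ] at this
    simpa using this
  have hLC : LCpi F := by
    refine ⟨fun x => hf.1 _, fun x y t h0 h1 => ?_⟩
    exact hf.2 (e x) (e y) t h0 h1
  have h2E : ∀ i, MemLp (fun x : EuclideanSpace ℝ (Fin n) => x i) 2 PE := by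
    intro i
    have c : Continuous fun x : EuclideanSpace ℝ (Fin n) => x i := by fun_prop
    rw [memLp_two_iff_integrable_sq c.aestronglyMeasurable]
    refine h2.mono' (c.pow 2).aestronglyMeasurable (ae_of_all _ fun x => ?_)
    have := PiLp.norm_apply_le x i
    rw [norm_eq_abs, abs_of_nonneg (by positivity), ← sq_abs]
    exact pow_le_pow_left₀ (abs_nonneg _) this 2
  have h2P : ∀ i, MemLp (fun x : Fin n → ℝ => x i) 2 P := by
    intro i
    have := h2E i
    rw [← hmap, memLp_map_measure_iff
      (by fun_prop : Continuous fun x : EuclideanSpace ℝ (Fin n) => x i).aestronglyMeasurable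
      e.measurable.aemeasurable] at this
    exact this
  have hm' : ∀ i, m i = ∫ x : Fin n → ℝ, x i ∂P := by
    intro i
    rw [hm, eval_integral_piLp (fun j => (h2E j).integrable (by norm_num)) i, ← hmap,
      integral_map_equiv]
    rfl
  have hS' : ∀ i j, S i j = ∫ x : Fin n → ℝ, (x i - m i) * (x j - m j) ∂P := by
    intro i j
    rw [hS, Matrix.of_apply, ← hmap, integral_map_equiv]
    rfl
  have key := pi_version hn hLC hP h2P hm' hS' hSp
  have hE : hEnt f = -∫ x, F x * log (F x) := by
    rw [hEnt, ← hmp.integral_comp e.measurableEmbedding (fun x => f x * log (f x))]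
  have hd : 0 < S.det := hSp.det_pos
  rw [hE, log_mul (by positivity) hd.ne', log_pow]
  have hn0 : (0:ℝ) ≤ n := by positivity
  have ab := mul_le_mul_of_nonneg_right
    (le_abs_self (1 / 2 * log (2 * π * exp 1) + (Ltr - log cvol))) hn0
  linarith
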